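/- Let K be a number field and let m ≥ 1 be a natural number. Then the set {(a₁, …, a_m) ∈ (Kˣ)^m : the quadratic form a₁x₁² + ⋯ + a_mx_m² is anisotropic over K, i.e. a₁x₁² + ⋯ + a_mx_m² = 0 has no nonzero solution (x₁, …, x_m) ∈ K^m} is diophantine over K. -/

import Mathlib

/-- A subset `S ⊆ K^ι` is diophantine over `K` if there are `m ∈ ℕ` and a polynomial
`f` in the variables `y_i` (`i : ι`) and `x_1, …, x_m` with coefficients in `K` such that
`a ∈ S` iff `f(a, x) = 0` has a solution `x ∈ K^m`. -/
def IsDiophantine {K : Type*} [Field K] {ι : Type*} [Fintype ι] (S : Set (ι → K)) : Prop :=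
  ∃ (m : ℕ) (f : MvPolynomial (ι ⊕ Fin m) K),
    ∀ a : ι → K, a ∈ S ↔ ∃ x : Fin m → K, MvPolynomial.eval (Sum.elim a x) f = 0



namespace QF

section LocalGeneral
variable {K : Type*} [Field K]

/-- The local squares: elements which become arbitrarily close to `1` after scaling by a square. -/
def locSq (v : AbsoluteValue K ℝ) : Subgroup Kˣ where
  carrier := {u | ∀ ε > 0, ∃ y : K, v ((u : K) * y ^ 2 - 1) < ε}
  one_mem' := fun ε hε => ⟨1, by simpa using hε⟩
  mul_mem' := by
    intro a b ha hb ε hε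
    obtain ⟨y, hy⟩ := ha (min 1 (ε / 3)) (by positivity)
    obtain ⟨z, hz⟩ := hb (min 1 (ε / 3)) (by positivity)
    refine ⟨y * z, ?_⟩
    have h1 : ((a * b : Kˣ) : K) * (y * z) ^ 2 - 1
        = (a * y ^ 2 - 1) * (b * z ^ 2 - 1) + ((a * y ^ 2 - 1) + (b * z ^ 2 - 1)) := by
      push_cast; ring
    rw [h1]
    have h2 := v.add_le ((a * y ^ 2 - 1) * (b * z ^ 2 - 1)) ((a * y ^ 2 - 1) + (b * z ^ 2 - 1))
    have h3 := v.add_le ((a : K) * y ^ 2 - 1) (b * z ^ 2 - 1)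
    rw [map_mul] at h2
    have h4 := v.nonneg ((a : K) * y ^ 2 - 1)
    have h5 := v.nonneg ((b : K) * z ^ 2 - 1)
    have h6 := min_le_left 1 (ε / 3)
    have h7 := min_le_right 1 (ε / 3)
    nlinarith
  inv_mem' := by
    intro a ha ε hε
    obtain ⟨y, hy⟩ := ha ε hε
    refine ⟨a * y, ?_⟩
    convert hy using 3
    simp only [Units.val_inv_eq_inv_val]
    have := a.ne_zero
    field_simp

theorem mem_locSq {v : AbsoluteValue K ℝ} {u : Kˣ} :
    u ∈ locSq v ↔ ∀ ε > 0, ∃ y : K, v ((u : K) * y ^ 2 - 1) < ε := Iff.rfl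

theorem sq_mem_locSq (v : AbsoluteValue K ℝ) (u : Kˣ) : u ^ 2 ∈ locSq v := by
  intro ε hε
  refine ⟨(u : K)⁻¹, ?_⟩
  have := u.ne_zero
  simpa [← mul_pow] using hε

/-- Norms from `K(√c)`. -/
def nrm (c : Kˣ) : Subgroup Kˣ where
  carrier := {u | ∃ y z : K, (u : K) = y ^ 2 - c * z ^ 2}
  one_mem' := ⟨1, 0, by simp⟩
  mul_mem' := by
    rintro a b ⟨y, z, h⟩ ⟨y', z', h'⟩
    refine ⟨y * y' + c * z * z', y * z' + z * y', ?_⟩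
    push_cast; rw [h, h']; ring
  inv_mem' := by
    rintro a ⟨y, z, h⟩
    refine ⟨y / a, z / a, ?_⟩
    have := a.ne_zero
    rw [Units.val_inv_eq_inv_val]
    field_simp
    exact h

theorem mem_nrm {c u : Kˣ} : u ∈ nrm c ↔ ∃ y z : K, (u : K) = y ^ 2 - c * z ^ 2 := Iff.rfl

theorem sq_mem_nrm (c u : Kˣ) : u ^ 2 ∈ nrm c := ⟨u, 0, by simp⟩

theorem neg_self_mem_nrm (c : Kˣ) : -c ∈ nrm c := ⟨0, 1, by simp⟩

/-- Local norms at `v`. -/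
def locN (v : AbsoluteValue K ℝ) (c : Kˣ) : Subgroup Kˣ := locSq v ⊔ nrm c

theorem locSq_le_locN (v : AbsoluteValue K ℝ) (c : Kˣ) : locSq v ≤ locN v c := le_sup_left
theorem nrm_le_locN (v : AbsoluteValue K ℝ) (c : Kˣ) : nrm c ≤ locN v c := le_sup_right

/-- `v`-adic openness of the local squares. -/
def Hens (v : AbsoluteValue K ℝ) : Prop :=
  ∃ ε > 0, ∀ u : Kˣ, v ((u : K) - 1) < ε → u ∈ locSq v

theorem Hens.near {v : AbsoluteValue K ℝ} (h : Hens v) (u : Kˣ) :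
    ∃ ε > 0, ∀ x : K, v (x - u) < ε → ∃ hx : x ≠ 0, u⁻¹ * Units.mk0 x hx ∈ locSq v := by
  obtain ⟨ε, hε, H⟩ := h
  have hu : 0 < v (u : K) := v.pos u.ne_zero
  refine ⟨min ε 1 * v u, by positivity, fun x hx => ?_⟩
  have h1 : v (x - u) < v u := hx.trans_le (by nlinarith [min_le_right ε 1])
  have hx0 : x ≠ 0 := by
    rintro rfl
    simp at h1
  refine ⟨hx0, H _ ?_⟩
  have : ((u⁻¹ * Units.mk0 x hx0 : Kˣ) : K) - 1 = (x - u) / u := by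
    have := u.ne_zero
    push_cast; field_simp; simp
  rw [this, map_div₀, div_lt_iff₀ hu]
  exact hx.trans_le (by nlinarith [min_le_left ε 1])

theorem exists_sq_near {v : AbsoluteValue K ℝ} {p : Kˣ} (hp : p ∈ locSq v) {ε : ℝ} (hε : 0 < ε) :
    ∃ s : K, v (s ^ 2 - p) < ε := by
  have hpp : 0 < v (p : K) := v.pos p.ne_zero
  obtain ⟨y, hy⟩ := (locSq v).inv_mem hp (ε / v p) (by positivity)
  refine ⟨y, ?_⟩
  have h := p.ne_zero
  have : y ^ 2 - p = p * (((p⁻¹ : Kˣ) : K) * y ^ 2 - 1) := by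
    push_cast; field_simp
  rw [this, map_mul]
  rw [lt_div_iff₀ hpp] at hy
  linarith

theorem nrm_mul_sq (c s : Kˣ) : nrm (c * s ^ 2) = nrm c := by
  ext u
  have h := s.ne_zero
  constructor
  · rintro ⟨y, z, hh⟩
    exact ⟨y, s * z, by rw [hh]; push_cast; ring⟩
  · rintro ⟨y, z, hh⟩
    exact ⟨y, z / s, by rw [hh]; push_cast; field_simp⟩

theorem nrm_le_locN_mul {v : AbsoluteValue K ℝ} (h : Hens v) (c : Kˣ) {p : Kˣ}
    (hp : p ∈ locSq v) : nrm (c * p) ≤ locN v c := by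
  rintro x ⟨y, z, hx⟩
  obtain ⟨ε, hε, H⟩ := h.near x
  obtain ⟨s, hs⟩ := exists_sq_near hp (ε := ε / (v (c * z ^ 2) + 1))
    (by have := v.nonneg (c * z ^ 2); positivity)
  have hc := v.nonneg (c * z ^ 2)
  obtain ⟨hx', hx2⟩ := H (y ^ 2 - c * (s * z) ^ 2) (by
    have : y ^ 2 - c * (s * z) ^ 2 - x = - ((c * z ^ 2) * (s ^ 2 - p)) := by
      rw [hx]; push_cast; ring
    rw [this, map_neg_eq_map, map_mul]
    rw [lt_div_iff₀ (by positivity)] at hs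
    nlinarith [v.nonneg (s ^ 2 - (p : K))])
  have h3 : Units.mk0 _ hx' ∈ nrm c := ⟨y, s * z, rfl⟩
  have h4 : x = (x⁻¹ * Units.mk0 _ hx')⁻¹ * Units.mk0 _ hx' := by rw [mul_inv, inv_inv, inv_mul_cancel_right]
  rw [h4]
  exact Subgroup.mul_mem_sup ((locSq v).inv_mem hx2) h3

theorem locN_mul {v : AbsoluteValue K ℝ} (h : Hens v) (c : Kˣ) {p : Kˣ}
    (hp : p ∈ locSq v) : locN v (c * p) = locN v c := by
  apply le_antisymm
  · exact sup_le le_sup_left (nrm_le_locN_mul h c hp)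
  · refine sup_le le_sup_left ?_
    have := nrm_le_locN_mul h (c * p) ((locSq v).inv_mem hp)
    rwa [mul_inv_cancel_right] at this

theorem nrm_one [CharZero K] : nrm (1 : Kˣ) = ⊤ := by
  rw [eq_top_iff]
  rintro x -
  exact ⟨(x + 1) / 2, (x - 1) / 2, by push_cast; ring⟩

theorem locN_top [CharZero K] {v : AbsoluteValue K ℝ} (h : Hens v) {c : Kˣ}
    (hc : c ∈ locSq v) : locN v c = ⊤ := by
  have := locN_mul h 1 hc
  rw [one_mul] at this
  rw [this, locN, nrm_one, sup_top_eq]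

theorem nrm_symm [CharZero K] {c e : Kˣ} (h : e ∈ nrm c) : c ∈ nrm e := by
  obtain ⟨y, z, h⟩ := h
  by_cases hz : z = 0
  · subst hz
    have hy : y ≠ 0 := by
      rintro rfl
      simp at h
    have : nrm e = nrm 1 := by
      rw [← nrm_mul_sq 1 (Units.mk0 y hy)]
      congr 1
      ext; simpa using h
    rw [this, nrm_one]; trivial
  · exact ⟨y / z, 1 / z, by rw [h]; field_simp; ring⟩

theorem mem_locN_iff {v : AbsoluteValue K ℝ} {c e : Kˣ} :
    e ∈ locN v c ↔ ∃ p ∈ locSq v, ∃ n ∈ nrm c, p * n = e := Subgroup.mem_sup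

theorem locN_symm [CharZero K] {v : AbsoluteValue K ℝ} (h : Hens v) {c e : Kˣ}
    (he : e ∈ locN v c) : c ∈ locN v e := by
  obtain ⟨p, hp, n, hn, rfl⟩ := mem_locN_iff.1 he
  have := nrm_le_locN v _ (nrm_symm hn)
  rwa [mul_comm, locN_mul h n hp]

theorem locN_comm [CharZero K] {v : AbsoluteValue K ℝ} (h : Hens v) {c e : Kˣ} :
    e ∈ locN v c ↔ c ∈ locN v e := ⟨locN_symm h, locN_symm h⟩

/-- weak approximation, elementary form -/
theorem weakApprox {ι : Type*} [Finite ι] {v : ι → AbsoluteValue K ℝ}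
    (h : ∀ i, (v i).IsNontrivial) (hv : Pairwise fun i j ↦ ¬(v i).IsEquiv (v j))
    (g : ι → K) (ε : ι → ℝ) (hε : ∀ i, 0 < ε i) : ∃ x : K, ∀ i, v i (x - g i) < ε i := by
  have := Fintype.ofFinite ι
  have hd := AbsoluteValue.denseRange_algebraMap_pi h hv
  let U : Set ((i : ι) → WithAbs (v i)) :=
    Set.pi Set.univ fun i => Metric.ball (WithAbs.toAbs (v i) (g i)) (ε i)
  have hU : IsOpen U := isOpen_set_pi Set.finite_univ fun i _ => Metric.isOpen_ball
  obtain ⟨x, hx⟩ := hd.exists_mem_open hU ⟨fun i => WithAbs.toAbs (v i) (g i), fun i _ => by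
    simpa using hε i⟩
  refine ⟨x, fun i => ?_⟩
  have := hx i trivial
  rw [Metric.mem_ball, dist_eq_norm] at this
  exact this

/-- Finite index abstract lemma. -/
theorem index_lemma {A B : Type*} [CommGroup A] [CommGroup B] (i : A →* B) (N : B →* A)
    (QA : Subgroup A) (QB : Subgroup B) [QA.FiniteIndex] [QB.FiniteIndex]
    (h1 : ∀ a, N (i a) ∈ QA) (h2 : ∀ b ∈ QB, N b ∈ QA)
    (h3 : ∀ b, N b ∈ QA → ∃ a, ∃ q ∈ QB, b = i a * q)
    (h4 : QA ≤ QB.comap i) (h5 : QA.relIndex (QB.comap i) = 2) :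
    (N.range ⊔ QA).index * QB.index * 2 = QA.index ^ 2 := by
  have e1 : (QA.comap N) = i.range ⊔ QB := by
    ext b
    constructor
    · intro hb
      obtain ⟨a, q, hq, rfl⟩ := h3 b hb
      exact Subgroup.mul_mem_sup ⟨a, rfl⟩ hq
    · intro hb
      obtain ⟨_, ⟨a, rfl⟩, q, hq, rfl⟩ := Subgroup.mem_sup.1 hb
      rw [Subgroup.mem_comap, map_mul]
      exact QA.mul_mem (h1 a) (h2 q hq)
  have e2 : (QA.comap N).index * (N.range ⊔ QA).index = QA.index := by
    rw [Subgroup.index_comap, ← Subgroup.relIndex_sup_right,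
      Subgroup.relIndex_mul_index le_sup_right]
  have e3 : (QB.comap i).index * (i.range ⊔ QB).index = QB.index := by
    rw [Subgroup.index_comap, ← Subgroup.relIndex_sup_right,
      Subgroup.relIndex_mul_index le_sup_right]
  have e4 : 2 * (QB.comap i).index = QA.index := by
    rw [← h5, Subgroup.relIndex_mul_index h4]
  rw [e1] at e2
  rw [← e3, sq]
  nth_rewrite 1 [← e2]
  rw [← e4]
  ring

end LocalGeneral
end QF


namespace QF
open NumberField IsDedekindDomain HeightOneSpectrum

section NA
variable {K : Type*} [Field K]

theorem na_add {v : AbsoluteValue K ℝ} (hv : IsNonarchimedean v) (x y : K) :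
    v (x + y) ≤ max (v x) (v y) := hv x y

theorem na_sub {v : AbsoluteValue K ℝ} (hv : IsNonarchimedean v) (x y : K) :
    v (x - y) ≤ max (v x) (v y) := by
  have := hv x (-y)
  rwa [← sub_eq_add_neg, map_neg_eq_map] at this

theorem na_add_lt {v : AbsoluteValue K ℝ} (hv : IsNonarchimedean v) {x y : K} (h : v y < v x) :
    v (x + y) = v x := by
  apply le_antisymm
  · exact (hv x y).trans (by simp [h.le])
  · have h1 := na_sub hv (x + y) y
    rw [add_sub_cancel_right] at h1
    rcases le_max_iff.1 h1 with h2 | h2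
    · exact h2
    · exact absurd h2 (not_le.2 h)

theorem na_nat {v : AbsoluteValue K ℝ} (hv : IsNonarchimedean v) (n : ℕ) : v (n : K) ≤ 1 := by
  induction n with
  | zero => simp
  | succ n ih =>
    push_cast
    exact (hv _ _).trans (by simp [ih])

theorem na_near_one {v : AbsoluteValue K ℝ} (hv : IsNonarchimedean v) {x : K} (h : v (x - 1) < 1) :
    v x = 1 := by
  have := na_add_lt hv (x := 1) (y := x - 1) (by simpa using h)
  simpa using this

theorem na_hens [CharZero K] {v : AbsoluteValue K ℝ} (hv : IsNonarchimedean v) {u : Kˣ}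
    (hu : v ((u : K) - 1) < v 4) : u ∈ locSq v := by
  have h40 : (4 : K) ≠ 0 := by norm_num
  have h4 : 0 < v (4 : K) := v.pos h40
  have h2 : v (2 : K) ≤ 1 := na_nat hv 2
  set t := v ((u : K) - 1) / v 4 with ht
  have ht1 : t < 1 := by rw [ht, div_lt_one h4]; exact hu
  have ht0 : 0 ≤ t := div_nonneg (v.nonneg _) h4.le
  have key : ∀ n : ℕ, ∃ y : K, v ((u : K) * y ^ 2 - 1) ≤ v 4 * t ^ (n + 1) := by
    intro n
    induction n with
    | zero => exact ⟨1, by rw [ht, zero_add, pow_one, mul_div_cancel₀ _ h4.ne']; simp⟩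
    | succ n ih =>
      obtain ⟨y, hy⟩ := ih
      set m := ((u : K) * y ^ 2 - 1) / 4 with hm
      have hm1 : v m ≤ t ^ (n + 1) := by
        rw [hm, map_div₀, div_le_iff₀ h4]; linarith
      have hm2 : v m < 1 := hm1.trans_lt (pow_lt_one₀ ht0 ht1 (by simp))
      have h1 : v (1 + 2 * m) = 1 := by
        rw [na_add_lt hv, map_one]
        rw [map_mul, map_one]
        nlinarith [v.nonneg m]
      have h10 : 1 + 2 * m ≠ 0 := by
        intro h
        rw [h] at h1
        simp at h1
      refine ⟨y / (1 + 2 * m), ?_⟩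
      have huy : (u : K) * y ^ 2 = 1 + 4 * m := by rw [hm]; field_simp; ring
      have e : (u : K) * (y / (1 + 2 * m)) ^ 2 - 1 = - (4 * m ^ 2 / (1 + 2 * m) ^ 2) := by
        rw [div_pow, mul_div_assoc', huy]
        have h11 : (1 + 2 * m) ^ 2 ≠ 0 := pow_ne_zero _ h10
        rw [div_sub_one h11, ← neg_div]
        congr 1
        ring
      rw [e, map_neg_eq_map, map_div₀, map_pow, h1, map_mul, map_pow, one_pow, div_one]
      gcongr
      calc v m ^ 2 ≤ (t ^ (n + 1)) ^ 2 := by gcongr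
        _ = t ^ (2 * n + 2) := by rw [← pow_mul]; ring_nf
        _ ≤ t ^ (n + 1 + 1) := pow_le_pow_of_le_one ht0 ht1.le (by omega)
  intro ε hε
  obtain ⟨n, hn⟩ := exists_pow_lt_of_lt_one (show 0 < ε / v 4 by positivity) ht1
  obtain ⟨y, hy⟩ := key n
  refine ⟨y, hy.trans_lt ?_⟩
  rw [lt_div_iff₀ h4] at hn
  calc v 4 * t ^ (n + 1) ≤ v 4 * t ^ n := by
        gcongr 1
        exact pow_le_pow_of_le_one ht0 ht1.le (by omega)
    _ < ε := by linarith

end NA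

variable (K : Type*) [Field K] [NumberField K]

/-- finite places -/
abbrev FP := HeightOneSpectrum (𝓞 K)

/-- finite or real places -/
abbrev Pl := FP K ⊕ (K →+* ℝ)

variable {K}

/-- the real absolute value -/
noncomputable def rabv (σ : K →+* ℝ) : AbsoluteValue K ℝ where
  toFun x := |σ x|
  map_mul' := by simp [abs_mul]
  nonneg' := by simp
  eq_zero' := by simp
  add_le' := by intro x y; simpa using abs_add_le (σ x) (σ y)

/-- absolute value attached to a place -/
noncomputable def abv : Pl K → AbsoluteValue K ℝ
  | .inl v => adicAbv K v
  | .inr σ => rabv σ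

@[simp] theorem rabv_apply (σ : K →+* ℝ) (x : K) : abv (.inr σ) x = |σ x| := rfl

theorem fna (v : FP K) : IsNonarchimedean (abv (.inl v)) := isNonarchimedean_adicAbv K v

/-- the order of vanishing -/
noncomputable def ord (v : FP K) : Kˣ →* Multiplicative ℤ := (v.valuationOfNeZero)⁻¹

theorem valuation_eq_ord (v : FP K) (x : Kˣ) :
    v.valuation K (x : K) = WithZero.exp (-(ord v x).toAdd) := by
  rw [← valuationOfNeZero_eq]
  simp [ord, WithZero.exp]

theorem fabv_eq (v : FP K) (x : Kˣ) :
    abv (.inl v) (x : K) = (Ideal.absNorm v.asIdeal : ℝ) ^ (-(ord v x).toAdd) := by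
  change adicAbv K v (x : K) = _
  have h : v.valuation K (x : K) ≠ 0 := by simp
  rw [adicAbv_def, WithZeroMulInt.toNNReal_neg_apply _ h]
  have : (WithZero.unzero h) = v.valuationOfNeZero x := by
    rw [← WithZero.coe_inj, WithZero.coe_unzero, valuationOfNeZero_eq]
  rw [this]
  simp [ord]

theorem absNorm_gt (v : FP K) : 1 < (Ideal.absNorm v.asIdeal : ℝ) := by
  exact_mod_cast one_lt_absNorm v

theorem fabv_le_iff (v : FP K) (x : Kˣ) (k : ℤ) :
    abv (.inl v) (x : K) ≤ (Ideal.absNorm v.asIdeal : ℝ) ^ (-k) ↔ k ≤ (ord v x).toAdd := by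
  rw [fabv_eq, zpow_le_zpow_iff_right₀ (absNorm_gt v)]
  omega

theorem fabv_lt_one_iff (v : FP K) (x : Kˣ) :
    abv (.inl v) (x : K) < 1 ↔ 0 < (ord v x).toAdd := by
  rw [fabv_eq, zpow_lt_one_iff_right₀ (absNorm_gt v)]
  omega

theorem fabv_le_one_iff (v : FP K) (x : Kˣ) :
    abv (.inl v) (x : K) ≤ 1 ↔ 0 ≤ (ord v x).toAdd := by
  rw [fabv_eq, zpow_le_one_iff_right₀ (absNorm_gt v)]
  omega

theorem fabv_eq_one_iff (v : FP K) (x : Kˣ) :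
    abv (.inl v) (x : K) = 1 ↔ ord v x = 1 := by
  have h1 := fabv_lt_one_iff v x
  have h2 := fabv_le_one_iff v x
  rw [← toAdd_eq_zero]
  constructor
  · intro h
    have := h2.1 h.le
    by_contra hh
    have := h1.2 (by omega)
    linarith
  · intro h
    apply le_antisymm (h2.2 h.ge)
    by_contra hh
    have := h1.1 (not_le.1 hh)
    omega

theorem fabv_lt_iff_mem (v : FP K) (x : 𝓞 K) : abv (.inl v) (x : K) < 1 ↔ x ∈ v.asIdeal :=
  v.adicAbv_coe_lt_one_iff (one_lt_absNorm_nnreal v) x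

theorem fabv_int_le (v : FP K) (x : 𝓞 K) : abv (.inl v) (x : K) ≤ 1 :=
  v.adicAbv_coe_le_one (one_lt_absNorm_nnreal v) x

theorem fabv_le_one_valuation (v : FP K) (x : K) :
    abv (.inl v) x ≤ 1 ↔ v.valuation K x ≤ 1 := by
  change adicAbv K v (x : K) ≤ 1 ↔ _
  rw [adicAbv_def]
  exact_mod_cast WithZeroMulInt.toNNReal_le_one_iff (one_lt_absNorm_nnreal v)

theorem exists_unif (v : FP K) : ∃ π : Kˣ, (ord v π).toAdd = 1 := by
  obtain ⟨π, hπ⟩ := v.valuation_exists_uniformizer K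
  have h0 : π ≠ 0 := by rintro rfl; rw [map_zero] at hπ; exact WithZero.exp_ne_zero hπ.symm
  refine ⟨Units.mk0 π h0, ?_⟩
  have := valuation_eq_ord v (Units.mk0 π h0)
  rw [Units.val_mk0, hπ, WithZero.exp_inj] at this
  omega

theorem ord_finite (x : Kˣ) : {v : FP K | ord v x ≠ 1}.Finite := by
  have h := FinitePlace.hasFiniteMulSupport (K := K) x.ne_zero
  rw [Function.HasFiniteMulSupport] at h
  refine ((h.image FinitePlace.maximalIdeal)).subset ?_
  intro v hv
  refine ⟨FinitePlace.mk v, ?_, FinitePlace.maximalIdeal_mk v⟩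
  rw [Function.mem_mulSupport]
  rw [Set.mem_ofPred, Ne, ← fabv_eq_one_iff] at hv
  rwa [FinitePlace.mk_apply, FinitePlace.norm_embedding]

theorem abv_inequiv : Pairwise fun i j : Pl K ↦ ¬(abv i).IsEquiv (abv j) := by
  have hfr : ∀ (v : FP K) (σ : K →+* ℝ), ¬(abv (.inl v)).IsEquiv (abv (.inr σ)) := by
    intro v σ h
    have h1 := h.le_one_iff (x := 2)
    have h2 := na_nat (fna v) 2
    have := h1.1 (by exact_mod_cast h2)
    rw [rabv_apply, map_ofNat] at this
    norm_num at this
  intro i j hij h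
  match i, j with
  | .inl v, .inl w =>
    apply hij
    congr 1
    ext x
    rw [← fabv_lt_iff_mem, ← fabv_lt_iff_mem]
    exact h.lt_one_iff
  | .inl v, .inr σ => exact hfr v σ h
  | .inr σ, .inl v => exact hfr v σ h.symm
  | .inr σ, .inr τ =>
    apply hij
    congr 1
    ext x
    by_contra hne
    wlog hlt : σ x < τ x generalizing σ τ
    · exact this τ σ (fun h => hij h.symm) h.symm (fun h => hne h.symm)
        (lt_of_le_of_ne (not_lt.1 hlt) (fun h => hne h.symm))
    -- find rationals `a < σ x < b < τ x`, scale
    obtain ⟨b, hb1, hb2⟩ := exists_rat_btwn hlt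
    obtain ⟨M, hM⟩ := exists_rat_gt (max (τ x) (-σ x))
    have h3 := lt_max_iff.not.1 (not_lt.2 hM.le)
    push Not at h3
    have e1 := h.le_iff_le (x := x + M) (y := (b : K) + M)
    simp only [rabv_apply, map_add, map_ratCast] at e1
    rw [abs_of_nonneg (by linarith), abs_of_nonneg (by linarith), abs_of_nonneg (by linarith)] at e1
    have := e1.1 (by linarith)
    linarith

theorem abv_nontrivial (i : Pl K) : (abv i).IsNontrivial := by
  match i with
  | .inl v =>
    obtain ⟨π, hπ⟩ := exists_unif v
    refine ⟨π, π.ne_zero, ?_⟩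
    have := (fabv_lt_one_iff v π).2 (by omega)
    exact this.ne
  | .inr σ =>
    refine ⟨2, by norm_num, ?_⟩
    rw [rabv_apply, map_ofNat]; norm_num

theorem mem_locSq_real (σ : K →+* ℝ) (u : Kˣ) : u ∈ locSq (abv (.inr σ)) ↔ 0 < σ u := by
  constructor
  · intro h
    obtain ⟨y, hy⟩ := h 1 one_pos
    rw [rabv_apply, map_sub, map_mul, map_pow, map_one, abs_lt] at hy
    have : 0 < σ u * σ y ^ 2 := by linarith
    exact pos_of_mul_pos_left this (sq_nonneg _)
  · intro h ε hε
    have hc : Continuous fun y : ℝ => |σ u * y ^ 2 - 1| := by fun_prop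
    have ho : IsOpen {y : ℝ | |σ u * y ^ 2 - 1| < ε} := isOpen_lt hc continuous_const
    obtain ⟨q, hq⟩ := Rat.denseRange_cast (𝕜 := ℝ) |>.exists_mem_open ho
      ⟨(Real.sqrt (σ u))⁻¹, by
        simp only [Set.mem_ofPred_eq, inv_pow, Real.sq_sqrt h.le]
        rw [mul_inv_cancel₀ h.ne']; simpa using hε⟩
    refine ⟨q, ?_⟩
    rw [rabv_apply]
    simpa using hq

theorem hens (w : Pl K) : Hens (abv w) := by
  match w with
  | .inl v => exact ⟨_, (abv (.inl v)).pos (by norm_num : (4 : K) ≠ 0), fun u hu => na_hens (fna v) hu⟩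
  | .inr σ =>
    refine ⟨1, one_pos, fun u hu => (mem_locSq_real σ u).2 ?_⟩
    rw [rabv_apply, map_sub, map_one, abs_lt] at hu
    linarith

/-- local squares at a place -/
noncomputable abbrev P (w : Pl K) : Subgroup Kˣ := locSq (abv w)
/-- local norms at a place -/
noncomputable abbrev Nw (w : Pl K) (c : Kˣ) : Subgroup Kˣ := locN (abv w) c

/-- weak approximation for a finite set of places -/
theorem wa (F : Set (Pl K)) (hF : F.Finite) (g : Pl K → K) (ε : Pl K → ℝ) (hε : ∀ w ∈ F, 0 < ε w) :
    ∃ x : K, ∀ w ∈ F, abv w (x - g w) < ε w := by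
  have := hF.to_subtype
  obtain ⟨x, hx⟩ := weakApprox (v := fun w : F => abv w.1) (fun w => abv_nontrivial w.1)
    (fun i j hij => abv_inequiv (fun h => hij (Subtype.ext h))) (fun w => g w.1) (fun w => ε w.1)
    (fun w => hε w.1 w.2)
  exact ⟨x, fun w hw => hx ⟨w, hw⟩⟩

/-- weak approximation modulo local squares -/
theorem wa_sq (F : Set (Pl K)) (hF : F.Finite) (g : Pl K → Kˣ) :
    ∃ x : Kˣ, ∀ w ∈ F, (g w)⁻¹ * x ∈ P w := by
  choose ε hε H using fun w : Pl K => (hens w).near (g w)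
  by_cases hne : F.Nonempty
  · obtain ⟨x, hx⟩ := wa F hF (fun w => g w) ε (fun w _ => hε w)
    obtain ⟨w0, hw0⟩ := hne
    obtain ⟨hx0, -⟩ := H w0 x (hx w0 hw0)
    refine ⟨Units.mk0 x hx0, fun w hw => ?_⟩
    obtain ⟨_, h⟩ := H w x (hx w hw)
    exact h
  · exact ⟨1, fun w hw => absurd ⟨w, hw⟩ hne⟩

end QF


namespace QF
open NumberField IsDedekindDomain HeightOneSpectrum

theorem index_sq_sup {A : Type*} [CommGroup A] (V : Subgroup A) (hV : V.index ≠ 0) :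
    ((powMonoidHom 2 : A →* A).range ⊔ V).index = V.relIndex (V.comap (powMonoidHom 2)) := by
  have e2 : (V.comap (powMonoidHom 2)).index * ((powMonoidHom 2 : A →* A).range ⊔ V).index
      = V.index := by
    rw [Subgroup.index_comap, ← Subgroup.relIndex_sup_right,
      Subgroup.relIndex_mul_index le_sup_right]
  have h4 : V ≤ V.comap (powMonoidHom 2) := fun x hx => V.pow_mem hx 2
  have e4 := Subgroup.relIndex_mul_index h4
  have h0 : (V.comap (powMonoidHom 2)).index ≠ 0 := by
    intro h; rw [h] at e2; simp at e2; exact hV e2.symm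
  rw [mul_comm] at e4
  exact mul_left_cancel₀ h0 (e2.trans e4.symm)

variable {K : Type*} [Field K] [NumberField K]

/-- residue cardinality -/
noncomputable abbrev nv (v : FP K) : ℝ := (Ideal.absNorm v.asIdeal : ℝ)

theorem nv_gt (v : FP K) : 1 < nv v := absNorm_gt v
theorem nv_pos (v : FP K) : 0 < nv v := by have := absNorm_gt v; positivity

theorem fabv_le_val (v : FP K) (x : K) (k : ℤ) :
    abv (.inl v) x ≤ nv v ^ (-k) ↔ v.valuation K x ≤ WithZero.exp (-k) := by
  by_cases hx : x = 0
  · subst hx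
    have : 0 < nv v ^ (-k) := zpow_pos (nv_pos v) _
    rw [map_zero, map_zero]
    exact iff_of_true this.le zero_le
  · have h1 := fabv_le_iff v (Units.mk0 x hx) k
    have h2 := valuation_eq_ord v (Units.mk0 x hx)
    rw [Units.val_mk0] at h1 h2
    rw [h1, h2, WithZero.exp_le_exp]
    omega

theorem fabv_ge (v : FP K) (x : K) (k : ℤ) (h : ¬ abv (.inl v) x ≤ nv v ^ (-(k + 1))) :
    nv v ^ (-k) ≤ abv (.inl v) x := by
  by_cases hx : x = 0
  · subst hx
    have : 0 < nv v ^ (-(k + 1)) := zpow_pos (nv_pos v) _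
    exact absurd (by simpa using this.le) h
  · have h1 := fabv_le_iff v (Units.mk0 x hx) (k + 1)
    rw [Units.val_mk0] at h1
    rw [h1] at h
    have := fabv_eq v (Units.mk0 x hx)
    rw [Units.val_mk0] at this
    rw [this, zpow_le_zpow_iff_right₀ (nv_gt v)]
    omega

theorem fabv_le_mem (v : FP K) (x : 𝓞 K) (k : ℕ) :
    abv (.inl v) (x : K) ≤ nv v ^ (-(k : ℤ)) ↔ x ∈ v.asIdeal ^ k := by
  rw [fabv_le_val, ← intValuation_le_pow_iff_mem, ← valuation_of_algebraMap (K := K)]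

theorem exists_int_near (v : FP K) {x : K} (hx : abv (.inl v) x ≤ 1) (k : ℤ) :
    ∃ a : 𝓞 K, abv (.inl v) (x - a) ≤ nv v ^ (-k) := by
  obtain ⟨a, ha⟩ := exists_valuation_sub_lt_of_integer v ((fabv_le_one_valuation v x).1 hx)
    (Units.mk0 (WithZero.exp (-k)) WithZero.exp_ne_zero)
  refine ⟨a, ?_⟩
  rw [fabv_le_val, Valuation.map_sub_swap]
  exact ha.le

theorem finite_quot (v : FP K) (k : ℕ) : Finite (𝓞 K ⧸ v.asIdeal ^ k) :=
  Ideal.finiteQuotientOfFreeOfNeBot _ (pow_ne_zero _ v.ne_bot)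

theorem card_quot (v : FP K) (k : ℕ) :
    Nat.card (𝓞 K ⧸ v.asIdeal ^ k) = Ideal.absNorm v.asIdeal ^ k := by
  rw [← map_pow, Ideal.absNorm_apply, Submodule.cardQuot_apply]

/-- residue modulo `v ^ k` -/
noncomputable def res (v : FP K) (k : ℕ) (x : K) : 𝓞 K ⧸ v.asIdeal ^ k :=
  open Classical in
  if h : ∃ a : 𝓞 K, abv (.inl v) (x - a) ≤ nv v ^ (-(k : ℤ)) then
    Ideal.Quotient.mk _ h.choose else 0

theorem res_eq_iff (v : FP K) (k : ℕ) {x : K} (hx : abv (.inl v) x ≤ 1) (a : 𝓞 K) :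
    res v k x = Ideal.Quotient.mk _ a ↔ abv (.inl v) (x - a) ≤ nv v ^ (-(k : ℤ)) := by
  have h := exists_int_near v hx k
  rw [res, dif_pos h, Ideal.Quotient.eq, ← fabv_le_mem]
  have hs := h.choose_spec
  push_cast
  constructor
  · intro h1
    have := na_add (fna v) (x - h.choose) (h.choose - a)
    rw [sub_add_sub_cancel] at this
    exact this.trans (max_le hs h1)
  · intro h1
    have := na_sub (fna v) (x - a) (x - h.choose)
    rw [sub_sub_sub_cancel_left] at this
    exact this.trans (max_le h1 hs)

/-- units at `v` -/
noncomputable def Un (v : FP K) : Subgroup Kˣ := (ord v).ker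

theorem mem_Un {v : FP K} {u : Kˣ} : u ∈ Un v ↔ abv (.inl v) (u : K) = 1 := by
  rw [Un, MonoidHom.mem_ker, fabv_eq_one_iff]

/-- higher units -/
noncomputable def Uk (v : FP K) (k : ℕ) : Subgroup Kˣ where
  carrier := {u | u ∈ Un v ∧ abv (.inl v) ((u : K) - 1) ≤ nv v ^ (-(k : ℤ))}
  one_mem' := ⟨one_mem _, by simp [zpow_nonneg (nv_pos v).le]⟩
  mul_mem' := by
    rintro a b ⟨ha, ha'⟩ ⟨hb, hb'⟩
    refine ⟨mul_mem ha hb, ?_⟩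
    have : ((a * b : Kˣ) : K) - 1 = a * (b - 1) + (a - 1) := by push_cast; ring
    rw [this]
    refine (na_add (fna v) _ _).trans (max_le ?_ ha')
    rw [map_mul, mem_Un.1 ha, one_mul]
    exact hb'
  inv_mem' := by
    rintro a ⟨ha, ha'⟩
    refine ⟨inv_mem ha, ?_⟩
    have : ((a⁻¹ : Kˣ) : K) - 1 = - ((a - 1) / a) := by
      have := a.ne_zero
      push_cast; field_simp; ring
    rw [this, map_neg_eq_map, map_div₀, mem_Un.1 ha, div_one]
    exact ha'

theorem mem_Uk {v : FP K} {k : ℕ} {u : Kˣ} :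
    u ∈ Uk v k ↔ u ∈ Un v ∧ abv (.inl v) ((u : K) - 1) ≤ nv v ^ (-(k : ℤ)) := Iff.rfl

theorem Uk_le_Un (v : FP K) (k : ℕ) : Uk v k ≤ Un v := fun _ h => h.1

theorem nv_anti (v : FP K) {i j : ℤ} (h : i ≤ j) : nv v ^ (-j) ≤ nv v ^ (-i) :=
  zpow_le_zpow_right₀ (nv_gt v).le (by omega)

theorem Uk_anti (v : FP K) {i j : ℕ} (h : i ≤ j) : Uk v j ≤ Uk v i :=
  fun _ hu => ⟨hu.1, hu.2.trans (nv_anti v (by exact_mod_cast h))⟩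

theorem mem_Uk_of_pos {v : FP K} {k : ℕ} (hk : 1 ≤ k) {u : Kˣ} 
    (h : abv (.inl v) ((u : K) - 1) ≤ nv v ^ (-(k : ℤ))) : u ∈ Uk v k := by
  refine ⟨mem_Un.2 (na_near_one (fna v) (h.trans_lt ?_)), h⟩
  exact zpow_lt_one_of_neg₀ (nv_gt v) (by omega)

theorem Uk_relIndex_ne_zero (v : FP K) (k : ℕ) : (Uk v k).relIndex (Un v) ≠ 0 := by
  have := finite_quot v k
  let f : Un v ⧸ (Uk v k).subgroupOf (Un v) → (𝓞 K ⧸ v.asIdeal ^ k) :=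
    fun x => res v k ((x.out : Kˣ) : K)
  have hf : Function.Injective f := by
    intro x y hxy
    rw [← x.out_eq, ← y.out_eq]
    set a := x.out
    set b := y.out
    have ha := mem_Un.1 a.2
    have hb := mem_Un.1 b.2
    obtain ⟨c, hc⟩ := exists_int_near v hb.le k
    have h1 := (res_eq_iff v k hb.le c).2 hc
    have h2 := (res_eq_iff v k ha.le c).1 (hxy.trans h1)
    refine Quotient.sound (QuotientGroup.leftRel_apply.2 ?_)
    rw [Subgroup.mem_subgroupOf]
    refine ⟨(a⁻¹ * b).2, ?_⟩
    have e : (((a⁻¹ * b : Un v) : Kˣ) : K) - 1 = (((b : Kˣ) : K) - c - (((a : Kˣ) : K) - c)) / ((a : Kˣ) : K) := by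
      have := (a : Kˣ).ne_zero
      push_cast; field_simp; simp
    rw [e, map_div₀, ha, div_one]
    exact (na_sub (fna v) _ _).trans (max_le hc h2)
  have := Finite.of_injective f hf
  exact Subgroup.index_ne_zero_of_finite

theorem Uk_relIndex (v : FP K) (e : ℕ) :
    (Uk v (2 * e + 1)).relIndex (Uk v (e + 1)) = Ideal.absNorm v.asIdeal ^ e := by
  obtain ⟨π, hπ⟩ := exists_unif v
  have hπe : abv (.inl v) ((π : K) ^ (e + 1)) = nv v ^ (-((e + 1 : ℕ) : ℤ)) := by
    have := fabv_eq v (π ^ (e + 1))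
    rw [map_pow, toAdd_pow, hπ] at this
    simpa using this
  have hπ0 : (π : K) ^ (e + 1) ≠ 0 := pow_ne_zero _ π.ne_zero
  have hpos : ∀ k : ℤ, 0 < nv v ^ k := fun k => zpow_pos (nv_pos v) k
  have hInt : ∀ u ∈ Uk v (e + 1), abv (.inl v) (((u : K) - 1) / (π : K) ^ (e + 1)) ≤ 1 := by
    intro u hu
    rw [map_div₀, hπe, div_le_one (hpos _)]
    exact hu.2
  let φ : Uk v (e + 1) →* Multiplicative (𝓞 K ⧸ v.asIdeal ^ e) :=
    { toFun := fun u => .ofAdd (res v e ((((u : Kˣ) : K) - 1) / (π : K) ^ (e + 1)))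
      map_one' := by
        have : res v e 0 = Ideal.Quotient.mk _ 0 := by
          rw [res_eq_iff _ _ (by simp)]; simp [(hpos _).le]
        simpa using this
      map_mul' := by
        intro a b
        rw [← ofAdd_add]
        congr 1
        have ha := hInt a a.2
        have hb := hInt b b.2
        have hab := hInt _ (a * b).2
        obtain ⟨x, hx⟩ := exists_int_near v ha e
        obtain ⟨y, hy⟩ := exists_int_near v hb e
        rw [(res_eq_iff v e ha x).2 hx, (res_eq_iff v e hb y).2 hy, ← map_add, res_eq_iff v e hab]
        have : (((a * b : Uk v (e + 1)) : Kˣ) : K) - 1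
          = (((a : Kˣ) : K) - 1) * (((b : Kˣ) : K) - 1) + ((((a : Kˣ) : K) - 1) + (((b : Kˣ) : K) - 1)) := by
            push_cast; ring
        rw [this, add_div, add_div]
        have e2 : ∀ p q r : K, p + (q + r) - ((x + y : 𝓞 K) : K) = p + ((q - x) + (r - y)) := by
          intro p q r; push_cast; ring
        rw [e2]
        refine (na_add (fna v) _ _).trans (max_le ?_ ((na_add (fna v) _ _).trans (max_le hx hy)))
        rw [mul_div_assoc, map_mul]
        calc _ ≤ nv v ^ (-((e + 1 : ℕ) : ℤ)) * 1 := by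
              gcongr
              · exact a.2.2
          _ ≤ _ := by rw [mul_one]; exact nv_anti v (by push_cast; omega) }
  have hker : φ.ker = (Uk v (2 * e + 1)).subgroupOf (Uk v (e + 1)) := by
    ext u
    rw [MonoidHom.mem_ker, Subgroup.mem_subgroupOf]
    change res v e _ = 0 ↔ _
    rw [← map_zero (Ideal.Quotient.mk (v.asIdeal ^ e)), res_eq_iff v e (hInt u u.2)]
    rw [mem_Uk, and_iff_right u.2.1]
    rw [show ((0 : 𝓞 K) : K) = 0 from rfl, sub_zero, map_div₀, hπe, div_le_iff₀ (hpos _), ← zpow_add₀ (nv_pos v).ne']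
    rw [show -(e : ℤ) + -((e + 1 : ℕ) : ℤ) = -((2 * e + 1 : ℕ) : ℤ) by push_cast; ring]
  have hsurj : Function.Surjective φ := by
    intro y
    obtain ⟨a, ha⟩ := Ideal.Quotient.mk_surjective y.toAdd
    have hsm : abv (.inl v) ((a : K) * (π : K) ^ (e + 1)) ≤ nv v ^ (-((e + 1 : ℕ) : ℤ)) := by
      rw [map_mul, hπe]
      have := fabv_int_le v a
      have := hpos (-((e + 1 : ℕ) : ℤ))
      nlinarith
    have hlt : abv (.inl v) ((1 + (a : K) * (π : K) ^ (e + 1)) - 1) < 1 := by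
      rw [add_sub_cancel_left]
      exact hsm.trans_lt (zpow_lt_one_of_neg₀ (nv_gt v) (by omega))
    have h0 : 1 + (a : K) * (π : K) ^ (e + 1) ≠ 0 := by
      intro h
      have := na_near_one (fna v) hlt
      rw [h] at this
      simp at this
    have hm : Units.mk0 _ h0 ∈ Uk v (e + 1) := mem_Uk_of_pos (by omega) (by
      rw [Units.val_mk0, add_sub_cancel_left]; exact hsm)
    refine ⟨⟨_, hm⟩, ?_⟩
    change res v e _ = y.toAdd
    rw [← ha, res_eq_iff v e (hInt _ hm)]
    simp [hπ0, (hpos _).le]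
  rw [Subgroup.relIndex, ← hker, Subgroup.index_ker, MonoidHom.range_eq_top.2 hsurj,
    Subgroup.card_top]
  exact card_quot v e

/-- order of two -/
noncomputable def e2 (v : FP K) : ℕ := (ord v (Units.mk0 2 two_ne_zero)).toAdd.toNat

theorem abv_two (v : FP K) : abv (.inl v) (2 : K) = nv v ^ (-(e2 v : ℤ)) := by
  have h := fabv_eq v (Units.mk0 2 two_ne_zero)
  have h1 := (fabv_le_one_iff v (Units.mk0 2 two_ne_zero)).1 (by simpa using na_nat (fna v) 2)
  rw [Units.val_mk0] at h
  rw [h, e2, Int.toNat_of_nonneg h1]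

theorem abv_four (v : FP K) : abv (.inl v) (4 : K) = nv v ^ (-(2 * e2 v : ℤ)) := by
  rw [show (4 : K) = 2 * 2 by norm_num, map_mul, abv_two, ← zpow_add₀ (nv_pos v).ne']
  congr 1; ring

theorem Uk_le_P (v : FP K) : Uk v (2 * e2 v + 1) ≤ P (.inl v) := by
  intro u hu
  refine na_hens (fna v) (hu.2.trans_lt ?_)
  rw [abv_four]
  exact zpow_lt_zpow_right₀ (nv_gt v) (by push_cast; omega)

theorem P_mem_iff (v : FP K) {u : Kˣ} (k : ℕ) (hk : 1 ≤ k) (hu : u ∈ P (.inl v)) :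
    ∃ y : Kˣ, u * y ^ 2 ∈ Uk v k := by
  obtain ⟨y, hy⟩ := hu (nv v ^ (-(k : ℤ))) (zpow_pos (nv_pos v) _)
  have hy0 : y ≠ 0 := by
    rintro rfl
    have : nv v ^ (-(k : ℤ)) < 1 := zpow_lt_one_of_neg₀ (nv_gt v) (by omega)
    rw [zero_pow two_ne_zero, mul_zero, zero_sub, map_neg_eq_map, map_one] at hy
    linarith
  exact ⟨Units.mk0 y hy0, mem_Uk_of_pos hk (by
    have := hy.le; rw [Units.val_mul, Units.val_pow_eq_pow_val, Units.val_mk0]; exact this)⟩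

theorem sup_sq_P (v : FP K) : (powMonoidHom 2 : Un v →* Un v).range ⊔
    (Uk v (2 * e2 v + 1)).subgroupOf (Un v) = (P (.inl v)).subgroupOf (Un v) := by
  apply le_antisymm
  · refine sup_le ?_ ?_
    · rintro _ ⟨x, rfl⟩
      exact sq_mem_locSq _ (x : Kˣ)
    · intro x hx
      exact Uk_le_P v hx
  · intro u hu
    obtain ⟨y, hy⟩ := P_mem_iff v (2 * e2 v + 1) (by omega) hu
    change (u : Kˣ) * y ^ 2 ∈ _ at hy
    have hyU : y ∈ Un v := by
      have h3 := mem_Un.1 hy.1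
      have h4 := mem_Un.1 u.2
      rw [Units.val_mul, Units.val_pow_eq_pow_val, map_mul, h4, one_mul, map_pow] at h3
      rw [mem_Un]
      exact (pow_eq_one_iff_of_nonneg (AbsoluteValue.nonneg _ _) (by norm_num)).1 h3
    have : u = (⟨y, hyU⟩⁻¹ : Un v) ^ 2 * (u * ⟨y, hyU⟩ ^ 2) := by
      rw [inv_pow, mul_comm, mul_inv_cancel_right]
    rw [this]
    exact Subgroup.mul_mem_sup ⟨_, rfl⟩ hy

theorem sq_Uk (v : FP K) {x : Kˣ} (hx : x ∈ Uk v (e2 v + 1)) : x ^ 2 ∈ Uk v (2 * e2 v + 1) := by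
  refine ⟨pow_mem hx.1 2, ?_⟩
  have hx2 := hx.2
  have : ((x ^ 2 : Kˣ) : K) - 1 = ((x : K) - 1) * (2 + ((x : K) - 1)) := by
    push_cast; ring
  rw [this, map_mul]
  have h5 : abv (.inl v) (2 + ((x : K) - 1)) ≤ nv v ^ (-(e2 v : ℤ)) :=
    (na_add (fna v) _ _).trans (max_le (abv_two v).le (hx2.trans (nv_anti v (by push_cast; omega))))
  calc _ ≤ nv v ^ (-((e2 v + 1 : ℕ) : ℤ)) * nv v ^ (-(e2 v : ℤ)) :=
        mul_le_mul hx2 h5 (AbsoluteValue.nonneg _ _) (zpow_nonneg (nv_pos v).le _)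
    _ = _ := by
        rw [← zpow_add₀ (nv_pos v).ne']
        congr 1; push_cast; ring

theorem sq_Uk_conv (v : FP K) {b : Kˣ} (hb : b ∈ Un v) (hb2 : b ^ 2 ∈ Uk v (2 * e2 v + 1)) :
    Xor (b * (-1) ∈ Uk v (e2 v + 1)) (b ∈ Uk v (e2 v + 1)) := by
  have hb3 := hb2.2
  have : ((b ^ 2 : Kˣ) : K) - 1 = ((b : K) - 1) * ((b : K) + 1) := by
    push_cast; ring
  rw [this, map_mul] at hb3
  have hm1 : (-1 : Kˣ) ∈ Un v := by rw [mem_Un]; simp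
  have hneg : b * (-1) ∈ Uk v (e2 v + 1) ↔
      abv (.inl v) ((b : K) + 1) ≤ nv v ^ (-((e2 v + 1 : ℕ) : ℤ)) := by
    rw [mem_Uk, and_iff_right (mul_mem hb hm1), ← map_neg_eq_map,
      show -(((b * -1 : Kˣ) : K) - 1) = (b : K) + 1 by push_cast; ring]
  rw [hneg, mem_Uk, and_iff_right hb]
  by_cases hc1 : abv (.inl v) ((b : K) + 1) ≤ nv v ^ (-((e2 v + 1 : ℕ) : ℤ))
  · refine Or.inl ⟨hc1, fun hc2 => ?_⟩
    have := na_sub (fna v) ((b : K) + 1) ((b : K) - 1)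
    rw [show (b : K) + 1 - ((b : K) - 1) = 2 by ring, abv_two] at this
    have h7 := this.trans (max_le hc1 hc2)
    rw [zpow_le_zpow_iff_right₀ (nv_gt v)] at h7
    push_cast at h7
    omega
  · refine Or.inr ⟨?_, hc1⟩
    by_contra hc2
    have g1 := fabv_ge v _ (e2 v) (by push_cast at hc1; exact hc1)
    have g2 := fabv_ge v _ (e2 v) (by push_cast at hc2; exact hc2)
    have hp := zpow_pos (nv_pos v) (-(e2 v : ℤ))
    have g3 := (mul_le_mul g2 g1 hp.le (AbsoluteValue.nonneg _ _)).trans hb3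
    rw [← zpow_add₀ (nv_pos v).ne', zpow_le_zpow_iff_right₀ (nv_gt v)] at g3
    push_cast at g3
    omega

theorem P_relIndex_Un (v : FP K) :
    (P (.inl v)).relIndex (Un v) = 2 * Ideal.absNorm v.asIdeal ^ (e2 v) := by
  rw [Subgroup.relIndex, ← sup_sq_P, index_sq_sup _ (Uk_relIndex_ne_zero v _)]
  have hVW : (Uk v (2 * e2 v + 1)).subgroupOf (Un v) ≤ (Uk v (e2 v + 1)).subgroupOf (Un v) :=
    fun x hx => Uk_anti v (by omega) hx
  have hWW : (Uk v (e2 v + 1)).subgroupOf (Un v) ≤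
      ((Uk v (2 * e2 v + 1)).subgroupOf (Un v)).comap (powMonoidHom 2) :=
    fun x hx => sq_Uk v (x := (x : Kˣ)) hx
  rw [← Subgroup.relIndex_mul_relIndex _ _ _ hVW hWW]
  have h6 : ((Uk v (2 * e2 v + 1)).subgroupOf (Un v)).relIndex ((Uk v (e2 v + 1)).subgroupOf (Un v))
      = Ideal.absNorm v.asIdeal ^ (e2 v) := by
    rw [Subgroup.relIndex_subgroupOf (Uk_le_Un v _)]
    exact Uk_relIndex v _
  rw [h6, mul_comm]
  congr 1
  rw [Subgroup.relIndex_eq_two_iff]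
  have hm1 : (-1 : Kˣ) ∈ Un v := by rw [mem_Un]; simp
  refine ⟨⟨-1, hm1⟩, ?_, ?_⟩
  · rw [Subgroup.mem_comap]
    have : powMonoidHom 2 (⟨-1, hm1⟩ : Un v) = 1 := by
      ext; simp
    rw [this]; exact one_mem _
  intro b hb
  exact sq_Uk_conv v b.2 hb

theorem ord_even_of_P (v : FP K) {u : Kˣ} (hu : u ∈ P (.inl v)) : Even (ord v u).toAdd := by
  obtain ⟨y, hy⟩ := P_mem_iff v 1 le_rfl hu
  have h := hy.1
  rw [Un, MonoidHom.mem_ker, map_mul, map_pow, ← toAdd_eq_zero, toAdd_mul, toAdd_pow] at h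
  exact ⟨-(ord v y).toAdd, by simp only [nsmul_eq_mul, Nat.cast_ofNat] at h; omega⟩

theorem exists_unit_of_even (v : FP K) {u : Kˣ} (hu : Even (ord v u).toAdd) :
    ∃ y : Kˣ, u * y ^ 2 ∈ Un v := by
  obtain ⟨k, hk⟩ := hu
  obtain ⟨π, hπ⟩ := exists_unif v
  refine ⟨π ^ (-k), ?_⟩
  rw [Un, MonoidHom.mem_ker, map_mul, map_pow, map_zpow, ← toAdd_eq_zero, toAdd_mul, toAdd_pow,
    toAdd_zpow, hπ]
  simp only [nsmul_eq_mul, Nat.cast_ofNat, smul_eq_mul, mul_one]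
  omega

theorem P_index_fin (v : FP K) :
    (P (.inl v)).index = 4 * Ideal.absNorm v.asIdeal ^ (e2 v) := by
  have h1 : (P (.inl v)).relIndex (Un v ⊔ P (.inl v)) = (P (.inl v)).relIndex (Un v) :=
    Subgroup.relIndex_sup_right _ _
  rw [← Subgroup.relIndex_mul_index (le_sup_right : P (.inl v) ≤ Un v ⊔ P (.inl v)), h1,
    P_relIndex_Un]
  have h2 : (Un v ⊔ P (.inl v)).index = 2 := by
    rw [Subgroup.index_eq_two_iff]
    obtain ⟨π, hπ⟩ := exists_unif v
    have hmem : ∀ b, b ∈ Un v ⊔ P (.inl v) ↔ Even (ord v b).toAdd := by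
      intro b
      constructor
      · intro hb
        obtain ⟨x, hx, y, hy, rfl⟩ := Subgroup.mem_sup.1 hb
        have hx' : ord v x = 1 := hx
        rw [map_mul, hx', one_mul]
        exact ord_even_of_P v hy
      · intro hb
        obtain ⟨y, hy⟩ := exists_unit_of_even v hb
        have : b = (b * y ^ 2) * (y⁻¹) ^ 2 := by rw [inv_pow, mul_inv_cancel_right]
        rw [this]
        exact Subgroup.mul_mem_sup hy (sq_mem_locSq _ _)
    refine ⟨π, fun b => ?_⟩
    rw [hmem, hmem, map_mul, toAdd_mul, hπ, Int.even_add_one]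
    by_cases h : Even (ord v b).toAdd
    · exact Or.inr ⟨h, not_not.2 h⟩
    · exact Or.inl ⟨h, h⟩
  rw [h2]; ring

theorem P_index_real (σ : K →+* ℝ) : (P (.inr σ)).index = 2 := by
  rw [Subgroup.index_eq_two_iff]
  refine ⟨-1, fun b => ?_⟩
  have h := b.ne_zero
  have h0 : σ b ≠ 0 := by simpa using h
  rw [mem_locSq_real, mem_locSq_real]
  rcases lt_or_gt_of_ne h0 with h | h
  · exact Or.inl ⟨by simpa using h, by linarith⟩
  · exact Or.inr ⟨h, by simpa using h.le⟩

theorem P_index_ne_zero (w : Pl K) : (P w).index ≠ 0 := by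
  match w with
  | .inl v =>
    rw [P_index_fin]
    have := one_lt_absNorm v
    positivity
  | .inr σ => rw [P_index_real]; norm_num

end QF


namespace QF
open NumberField IsDedekindDomain HeightOneSpectrum

section Grp
variable {G : Type*} [CommGroup G]

/-- the subgroup of squares of elements of `H` -/
def sqs (H : Subgroup G) : Subgroup G := H.map (powMonoidHom 2)

theorem mem_sqs {H : Subgroup G} {x : G} : x ∈ sqs H ↔ ∃ y ∈ H, y ^ 2 = x := Iff.rfl

theorem sqs_le (H : Subgroup G) : sqs H ≤ H := by
  rintro _ ⟨y, hy, rfl⟩; exact pow_mem hy 2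

theorem q2_step (H : Subgroup G) (φ : G →* Multiplicative ℤ) (h : ∃ x ∈ H, φ x ≠ 1) :
    (sqs H).relIndex H = 2 * (sqs (H ⊓ φ.ker)).relIndex (H ⊓ φ.ker) := by
  -- a generator of the image
  obtain ⟨g, hg⟩ := (isCyclic_iff_exists_zpowers_eq_top (α := (H.map φ))).1 inferInstance
  obtain ⟨π, hπH, hπ⟩ := g.2
  replace hπH : π ∈ H := hπH
  have hgen : ∀ x ∈ H, ∃ k : ℤ, φ x = φ π ^ k := by
    intro x hx
    have : (⟨φ x, ⟨x, hx, rfl⟩⟩ : H.map φ) ∈ Subgroup.zpowers g := hg ▸ Subgroup.mem_top _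
    obtain ⟨k, hk⟩ := this
    refine ⟨k, ?_⟩
    have := congrArg Subtype.val hk
    simpa [hπ] using this.symm
  have hπ1 : (φ π).toAdd ≠ 0 := by
    intro h0
    obtain ⟨x, hx, hx1⟩ := h
    obtain ⟨k, hk⟩ := hgen x hx
    rw [toAdd_eq_zero.1 h0] at hk
    simp at hk
    exact hx1 hk
  set B := H ⊓ φ.ker with hB
  have hle : sqs H ≤ sqs H ⊔ B := le_sup_left
  have hle2 : sqs H ⊔ B ≤ H := sup_le (sqs_le H) inf_le_left
  rw [← Subgroup.relIndex_mul_relIndex _ _ _ hle hle2, Subgroup.relIndex_sup_left, mul_comm]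
  have h1 : (sqs H).relIndex B = (sqs B).relIndex B := by
    rw [← Subgroup.inf_relIndex_right, ← Subgroup.inf_relIndex_right (sqs B)]
    congr 1
    ext x
    simp only [Subgroup.mem_inf]
    refine and_congr_left fun hx => ⟨?_, fun h => Subgroup.map_mono inf_le_left h⟩
    rintro ⟨y, hy, rfl⟩
    refine ⟨y, ⟨hy, ?_⟩, rfl⟩
    have := hx.2
    change φ (y ^ 2) = 1 at this
    change φ y = 1
    rw [map_pow, ← toAdd_eq_zero, toAdd_pow] at this
    rw [← toAdd_eq_zero]
    simpa using this
  rw [h1]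
  congr 1
  rw [Subgroup.relIndex_eq_two_iff]
  have hmem : ∀ x ∈ H, ∀ k : ℤ, φ x = φ π ^ k → (x ∈ sqs H ⊔ B ↔ Even k) := by
    intro x hx k hk
    constructor
    · intro hx2
      obtain ⟨_, ⟨y, hy, rfl⟩, b, hb, rfl⟩ := Subgroup.mem_sup.1 hx2
      obtain ⟨j, hj⟩ := hgen y hy
      change φ (y ^ 2 * b) = _ at hk
      rw [map_mul, map_pow, hj, MonoidHom.mem_ker.1 hb.2, mul_one] at hk
      have := congrArg Multiplicative.toAdd hk
      simp only [toAdd_pow, toAdd_zpow, smul_eq_mul, nsmul_eq_mul, Nat.cast_ofNat] at this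
      have h3 : 2 * j = k := mul_right_cancel₀ hπ1 (by linarith)
      exact ⟨j, by omega⟩
    · rintro ⟨j, rfl⟩
      have : x = (π ^ j) ^ 2 * (x * ((π ^ j) ^ 2)⁻¹) := by
        rw [mul_comm x, mul_inv_cancel_left]
      rw [this]
      refine Subgroup.mul_mem_sup ⟨π ^ j, zpow_mem hπH j, rfl⟩ (Subgroup.mem_inf.2
        ⟨mul_mem hx (inv_mem (pow_mem (zpow_mem hπH j) 2)), ?_⟩)
      rw [MonoidHom.mem_ker, map_mul, hk, map_inv, map_pow, map_zpow, ← zpow_natCast, ← zpow_mul,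
        mul_inv_eq_one]
      congr 1; push_cast; ring
  refine ⟨π, hπH, fun b hb => ?_⟩
  obtain ⟨k, hk⟩ := hgen b hb
  rw [hmem b hb k hk, hmem (b * π) (mul_mem hb hπH) (k + 1) (by rw [map_mul, hk, zpow_add_one])]
  rw [Int.even_add_one]
  by_cases h : Even k
  · exact Or.inr ⟨h, not_not.2 h⟩
  · exact Or.inl ⟨h, h⟩

end Grp

variable {K : Type*} [Field K] [NumberField K]

/-- S-units -/
noncomputable def US (S : Set (FP K)) : Subgroup Kˣ := ⨅ v ∈ Sᶜ, (ord v).ker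

theorem mem_US {S : Set (FP K)} {u : Kˣ} : u ∈ US S ↔ ∀ v ∉ S, ord v u = 1 := by
  simp [US, Subgroup.mem_iInf, MonoidHom.mem_ker]

theorem US_mono {S T : Set (FP K)} (h : S ⊆ T) : US S ≤ US T := by
  intro u hu
  rw [mem_US] at hu ⊢
  exact fun v hv => hu v (fun h' => hv (h h'))

theorem US_insert (S : Set (FP K)) (p : FP K) (hp : p ∉ S) : US (insert p S) ⊓ (ord p).ker = US S := by
  ext u
  rw [Subgroup.mem_inf, mem_US, mem_US, MonoidHom.mem_ker]
  constructor
  · rintro ⟨h1, h2⟩ v hv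
    by_cases hvp : v = p
    · rw [hvp, h2]
    · exact h1 v (by simp [hvp, hv])
  · intro h
    exact ⟨fun v hv => h v (fun h' => hv (Or.inr h')), h p hp⟩

theorem int_ord (x : 𝓞 K) (hx : (x : K) ≠ 0) (v : FP K) :
    0 ≤ (ord v (Units.mk0 (x : K) hx)).toAdd :=
  (fabv_le_one_iff v _).1 (fabv_int_le v x)

theorem int_ord_pos (x : 𝓞 K) (hx : (x : K) ≠ 0) (v : FP K) :
    0 < (ord v (Units.mk0 (x : K) hx)).toAdd ↔ x ∈ v.asIdeal := by
  rw [← fabv_lt_one_iff, ← fabv_lt_iff_mem]; rfl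

theorem int_ord_one (x : 𝓞 K) (hx : (x : K) ≠ 0) (v : FP K) :
    ord v (Units.mk0 (x : K) hx) = 1 ↔ x ∉ v.asIdeal := by
  rw [← int_ord_pos x hx, ← toAdd_eq_zero]
  have := int_ord x hx v
  omega

theorem exists_pow_gen (p : FP K) : ∃ x : Kˣ, ord p x ≠ 1 ∧ ∀ v ≠ p, ord v x = 1 := by
  have h0 : p.asIdeal ∈ nonZeroDivisors (Ideal (𝓞 K)) := mem_nonZeroDivisors_of_ne_zero p.ne_bot
  have hc : ClassGroup.mk0 (⟨p.asIdeal, h0⟩ ^ (Fintype.card (ClassGroup (𝓞 K)))) = 1 := by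
    rw [map_pow, pow_card_eq_one]
  rw [ClassGroup.mk0_eq_one_iff] at hc
  have hn : Fintype.card (ClassGroup (𝓞 K)) ≠ 0 := Fintype.card_ne_zero
  set n := Fintype.card (ClassGroup (𝓞 K))
  have hc' : (p.asIdeal ^ n).IsPrincipal := by simpa using hc
  obtain ⟨x, hx⟩ := hc'
  rw [Ideal.submodule_span_eq] at hx
  have hx0 : x ≠ 0 := by
    rintro rfl
    rw [Ideal.span_singleton_zero] at hx
    exact pow_ne_zero n p.ne_bot hx
  have hxK : (x : K) ≠ 0 := by simpa using hx0
  have hxp : x ∈ p.asIdeal ^ n := by rw [hx]; exact Ideal.mem_span_singleton_self x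
  refine ⟨Units.mk0 (x : K) hxK, ?_, fun v hv => ?_⟩
  · rw [Ne, int_ord_one, not_not]
    exact Ideal.pow_le_self hn hxp
  · rw [int_ord_one]
    intro hxv
    have : p.asIdeal ^ n ≤ v.asIdeal := by rw [hx, Ideal.span_singleton_le_iff_mem]; exact hxv
    have h1 := Ideal.IsPrime.le_of_pow_le this
    have := p.isMaximal.eq_of_le v.isPrime.ne_top h1
    exact hv (HeightOneSpectrum.ext this.symm)

theorem torsion_sq : (powMonoidHom 2 : Units.torsion K →* Units.torsion K).range.index = 2 := by
  have h1 := Subgroup.index_mul_card (powMonoidHom 2 : Units.torsion K →* Units.torsion K).range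
  have h2 := Subgroup.index_mul_card (powMonoidHom 2 : Units.torsion K →* Units.torsion K).ker
  rw [Subgroup.index_ker] at h2
  have h3 : Nat.card (powMonoidHom 2 : Units.torsion K →* Units.torsion K).ker = 2 := by
    rw [Nat.card_eq_two_iff]
    have hm : (-1 : (𝓞 K)ˣ) ∈ Units.torsion K := by
      rw [Units.torsion, CommGroup.mem_torsion, isOfFinOrder_iff_pow_eq_one]
      exact ⟨2, by norm_num, by simp⟩
    have hm1 : (⟨-1, hm⟩ : Units.torsion K) ∈ (powMonoidHom 2 : Units.torsion K →* Units.torsion K).ker := by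
      rw [MonoidHom.mem_ker]; ext; simp
    refine ⟨1, ⟨_, hm1⟩, ?_, ?_⟩
    · intro h
      have := congrArg (fun t : (powMonoidHom 2 : Units.torsion K →* Units.torsion K).ker =>
        (((t : Units.torsion K) : (𝓞 K)ˣ) : 𝓞 K)) h
      simp at this
      have h4 : (1 : 𝓞 K) + 1 = 0 := by nth_rewrite 1 [this]; ring
      norm_num at h4
    · ext t
      simp only [Set.mem_insert_iff, Set.mem_singleton_iff, Set.mem_univ, iff_true]
      have ht := t.2
      rw [MonoidHom.mem_ker] at ht
      have ht2 := congrArg (fun t => (((t : Units.torsion K) : (𝓞 K)ˣ) : 𝓞 K)) ht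
      simp at ht2
      rcases ht2 with h | h
      · left; ext; simp [h]
      · right; ext; simp [h]
  rw [h3] at h2
  have h0 : Nat.card (powMonoidHom 2 : Units.torsion K →* Units.torsion K).range ≠ 0 := Nat.card_pos.ne'
  exact mul_right_cancel₀ h0 (by rw [h1, ← h2, mul_comm])

theorem Zr_sq (r : ℕ) : (powMonoidHom 2 : Multiplicative (Fin r → ℤ) →* Multiplicative (Fin r → ℤ)).range.index
    = 2 ^ r := by
  let f : (Fin r → ℤ) →+ (Fin r → ZMod 2) := (Int.castAddHom (ZMod 2)).compLeft (Fin r)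
  have hs : Function.Surjective f := by
    intro y
    choose g hg using fun i => ZMod.intCast_surjective (n := 2) (y i)
    exact ⟨g, funext hg⟩
  have : (powMonoidHom 2 : Multiplicative (Fin r → ℤ) →* Multiplicative (Fin r → ℤ)).range
     = (AddMonoidHom.toMultiplicative f).ker := by
    ext x
    rw [MonoidHom.mem_ker]
    have e : (AddMonoidHom.toMultiplicative f) x = 1 ↔ ∀ i, ((x.toAdd i : ℤ) : ZMod 2) = 0 := by
      change f x.toAdd = 0 ↔ _
      rw [funext_iff]; rfl
    rw [e]
    constructor
    · rintro ⟨y, rfl⟩ i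
      rw [ZMod.intCast_zmod_eq_zero_iff_dvd]
      exact ⟨y.toAdd i, by simp⟩
    · intro h
      simp_rw [ZMod.intCast_zmod_eq_zero_iff_dvd] at h
      choose y hy using h
      refine ⟨Multiplicative.ofAdd y, ?_⟩
      apply Multiplicative.toAdd.injective
      funext i
      simp [hy i]
  rw [this, Subgroup.index_ker, MonoidHom.range_eq_top.2 (show Function.Surjective (AddMonoidHom.toMultiplicative f) from hs),
    Subgroup.card_top]
  change Nat.card (Fin r → ZMod 2) = _
  simp

theorem units_sq : (powMonoidHom 2 : (𝓞 K)ˣ →* (𝓞 K)ˣ).range.index = 2 ^ Fintype.card (InfinitePlace K) := by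
  let g : Units.torsion K × Multiplicative (Fin (Units.rank K) → ℤ) →* (𝓞 K)ˣ :=
    { toFun := fun x => x.1 * ∏ i, (Units.fundSystem K i) ^ (x.2.toAdd i)
      map_one' := by simp
      map_mul' := by
        intro x y
        simp only [Prod.fst_mul, Prod.snd_mul, toAdd_mul, Pi.add_apply, zpow_add, Finset.prod_mul_distrib, Subgroup.coe_mul]
        exact mul_mul_mul_comm _ _ _ _ }
  have hb : Function.Bijective g := by
    rw [Function.bijective_iff_existsUnique]
    intro y
    obtain ⟨x, hx, hu⟩ := Units.exist_unique_eq_mul_prod K y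
    refine ⟨(x.1, .ofAdd x.2), hx.symm, ?_⟩
    rintro ⟨a, b⟩ hab
    have := hu (a, b.toAdd) hab.symm
    rw [← this]; rfl
  have hmap : (powMonoidHom 2 : (𝓞 K)ˣ →* (𝓞 K)ˣ).range =
      ((powMonoidHom 2 : _ →* Units.torsion K).range.prod (powMonoidHom 2 : _ →* Multiplicative (Fin (Units.rank K) → ℤ)).range).map g := by
    ext x
    constructor
    · rintro ⟨y, rfl⟩
      obtain ⟨z, rfl⟩ := hb.2 y
      exact ⟨z ^ 2, ⟨⟨z.1, rfl⟩, ⟨z.2, rfl⟩⟩, by simp⟩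
    · rintro ⟨⟨_, _⟩, ⟨⟨a, rfl⟩, ⟨b, rfl⟩⟩, rfl⟩
      exact ⟨g (a, b), by rw [powMonoidHom_apply, ← map_pow]; rfl⟩
  rw [hmap, Subgroup.index_map_of_bijective hb, Subgroup.index_prod, torsion_sq, Zr_sq, Units.rank]
  have : 0 < Fintype.card (InfinitePlace K) := Fintype.card_pos
  rw [← pow_succ']
  congr 1; omega

theorem US_empty : US (∅ : Set (FP K)) = (Units.map (algebraMap (𝓞 K) K : 𝓞 K →* K)).range := by
  ext u
  rw [mem_US]
  constructor
  · intro h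
    have h1 : ∀ x : Kˣ, (∀ v : FP K, ord v x = 1) → ∃ y : 𝓞 K, (y : K) = x := by
      intro x hx
      have := (HeightOneSpectrum.mem_integers_of_valuation_le_one (R := 𝓞 K) K (x : K) (fun v => by
        rw [valuation_eq_ord, hx v]; simp))
      exact this
    obtain ⟨a, ha⟩ := h1 u (fun v => h v (by simp))
    obtain ⟨b, hb⟩ := h1 u⁻¹ (fun v => by rw [map_inv, h v (by simp), inv_one])
    have hab : a * b = 1 := by
      apply RingOfIntegers.coe_injective
      rw [map_mul, map_one]
      change (a : K) * (b : K) = 1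
      erw [ha, hb]; simp
    exact ⟨⟨a, b, hab, by rw [mul_comm, hab]⟩, by ext; exact ha⟩
  · rintro ⟨y, rfl⟩ v -
    have h0 : ((y : 𝓞 K) : K) ≠ 0 := by simp
    have : Units.map (algebraMap (𝓞 K) K : 𝓞 K →* K) y = Units.mk0 ((y : 𝓞 K) : K) h0 := by ext; rfl
    rw [this, int_ord_one]
    intro hy
    exact v.isPrime.ne_top (Ideal.eq_top_of_isUnit_mem _ hy y.isUnit)

/-- G0 -/
theorem US_sq (S : Set (FP K)) (hS : S.Finite) :
    (sqs (US S)).relIndex (US S) = 2 ^ (S.ncard + Fintype.card (InfinitePlace K)) := by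
  induction S, hS using Set.Finite.induction_on with
  | empty =>
    rw [Set.ncard_empty, zero_add, ← units_sq, US_empty, sqs, MonoidHom.range_eq_map, Subgroup.map_map]
    have : ((powMonoidHom 2).comp (Units.map (algebraMap (𝓞 K) K : 𝓞 K →* K))) =
      (Units.map (algebraMap (𝓞 K) K : 𝓞 K →* K)).comp (powMonoidHom 2) := by
        ext; simp
    rw [this, ← Subgroup.map_map, Subgroup.relIndex_map_map_of_injective, Subgroup.relIndex_top_right,
      ← MonoidHom.range_eq_map]
    exact Units.map_injective RingOfIntegers.coe_injective
  | @insert p S hp hS ih =>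
    obtain ⟨x, hx1, hx2⟩ := exists_pow_gen p
    rw [q2_step _ (ord p) ⟨x, mem_US.2 fun v hv => hx2 v (fun h => hv (by simp [h])), hx1⟩,
      US_insert _ _ hp, ih, Set.ncard_insert_of_notMem hp hS]
    ring

/-- uniformizers up to a finite set -/
theorem exists_Scl (K : Type*) [Field K] [NumberField K] : ∃ S : Set (FP K), S.Finite ∧
    ∀ q : FP K, q ∉ S → ∃ κ : Kˣ, (ord q κ).toAdd = 1 ∧ ∀ v ∉ S, v ≠ q → ord v κ = 1 := by
  choose I hI using ClassGroup.mk0_surjective (R := 𝓞 K)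
  have hI0 : ∀ c, (I c : Ideal (𝓞 K)) ≠ ⊥ := fun c => nonZeroDivisors.coe_ne_zero (I c)
  refine ⟨⋃ c, {v | v.asIdeal ∣ (I c : Ideal (𝓞 K))}, ?_, ?_⟩
  · exact Set.finite_iUnion fun c => Ideal.finite_factors (hI0 c)
  · intro q hq
    simp only [Set.mem_iUnion, Set.mem_ofPred_eq, not_exists] at hq
    have h0 : q.asIdeal ∈ nonZeroDivisors (Ideal (𝓞 K)) := mem_nonZeroDivisors_of_ne_zero q.ne_bot
    set J := I (ClassGroup.mk0 ⟨q.asIdeal, h0⟩)⁻¹ with hJ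
    have hc : ClassGroup.mk0 (⟨q.asIdeal, h0⟩ * J) = 1 := by
      rw [map_mul, hI, mul_inv_cancel]
    rw [ClassGroup.mk0_eq_one_iff] at hc
    obtain ⟨x, hx⟩ : (q.asIdeal * (J : Ideal (𝓞 K))).IsPrincipal := by simpa using hc
    rw [Ideal.submodule_span_eq] at hx
    have hx0 : x ≠ 0 := by
      rintro rfl
      rw [Ideal.span_singleton_zero] at hx
      exact mul_ne_zero q.ne_bot (hI0 _) hx
    have hxK : (x : K) ≠ 0 := by simpa using hx0
    refine ⟨Units.mk0 (x : K) hxK, ?_, ?_⟩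
    · have h1 : x ∈ q.asIdeal := (Ideal.mul_le_left : q.asIdeal * (J : Ideal (𝓞 K)) ≤ _) (by rw [hx]; exact Ideal.mem_span_singleton_self x)
      rw [← int_ord_pos x hxK] at h1
      have h2 : ¬ x ∈ q.asIdeal ^ 2 := by
        intro h
        have : q.asIdeal ^ 2 ∣ q.asIdeal * (J : Ideal (𝓞 K)) := by
          rw [Ideal.dvd_iff_le, hx, Ideal.span_singleton_le_iff_mem]; exact h
        rw [sq] at this
        exact hq _ ((mul_dvd_mul_iff_left q.ne_bot).1 this)
      rw [← fabv_le_mem] at h2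
      have h3 := (fabv_le_iff q (Units.mk0 (x : K) hxK) (2 : ℕ))
      rw [Units.val_mk0] at h3
      rw [h3] at h2
      push_cast at h2
      omega
    · intro v hv hvq
      simp only [Set.mem_iUnion, Set.mem_ofPred_eq, not_exists] at hv
      rw [int_ord_one]
      intro h
      have : v.asIdeal ∣ q.asIdeal * (J : Ideal (𝓞 K)) := by
        rw [Ideal.dvd_iff_le, hx, Ideal.span_singleton_le_iff_mem]; exact h
      rcases v.prime.dvd_or_dvd this with h1 | h1
      · rw [Ideal.dvd_iff_le] at h1
        have := q.isMaximal.eq_of_le v.isPrime.ne_top h1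
        exact hvq (HeightOneSpectrum.ext this.symm)
      · exact hv _ h1

end QF


namespace QF
open NumberField IsDedekindDomain HeightOneSpectrum

/-- quadratic extension data -/
structure QE (K L : Type*) [Field K] [Field L] [Algebra K L] (c : Kˣ) where
  δ : L
  sq : δ ^ 2 = algebraMap K L c
  nonsq : ¬ IsSquare (c : K)
  σ : L ≃ₐ[K] L
  σδ : σ δ = -δ
  N : Lˣ →* Kˣ
  hN : ∀ x : Lˣ, algebraMap K L (N x) = x * σ x
  span : ∀ x, ∃ a b : K, x = algebraMap K L a + algebraMap K L b * δ
  fr : Module.finrank K L = 2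

universe u

section QA
variable {K : Type u} [Field K] (c : K)

theorem qa_om : (QuadraticAlgebra.omega : QuadraticAlgebra K c 0) * QuadraticAlgebra.omega =
    algebraMap K (QuadraticAlgebra K c 0) c := by
  ext <;> simp

/-- conjugation hom -/
noncomputable def qaτ : QuadraticAlgebra K c 0 →ₐ[K] QuadraticAlgebra K c 0 :=
  QuadraticAlgebra.lift ⟨-QuadraticAlgebra.omega, by
    rw [neg_mul_neg, qa_om]; simp [Algebra.algebraMap_eq_smul_one]⟩

theorem qaτ_eq (z : QuadraticAlgebra K c 0) : qaτ c z = star z := by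
  simp only [qaτ, QuadraticAlgebra.lift]
  ext
  · simp
    erw [QuadraticAlgebra.re_one, mul_one]
  · simp
    right
    exact QuadraticAlgebra.im_one

theorem qaτ_qaτ (z : QuadraticAlgebra K c 0) : qaτ c (qaτ c z) = z := by
  rw [qaτ_eq, qaτ_eq, star_star]

/-- conjugation -/
noncomputable def qaσ : QuadraticAlgebra K c 0 ≃ₐ[K] QuadraticAlgebra K c 0 :=
  AlgEquiv.ofAlgHom (qaτ c) (qaτ c) (AlgHom.ext (qaτ_qaτ c)) (AlgHom.ext (qaτ_qaτ c))

theorem qaσ_eq (z : QuadraticAlgebra K c 0) : qaσ c z = star z := qaτ_eq c z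
theorem qa_σδ : qaσ c QuadraticAlgebra.omega = -QuadraticAlgebra.omega := by
  rw [qaσ_eq]; ext <;> simp
theorem qa_span (x : QuadraticAlgebra K c 0) : x = algebraMap K _ x.re + algebraMap K _ x.im * QuadraticAlgebra.omega := by
  ext <;> simp
end QA

theorem exists_QE {K : Type u} [Field K] [NumberField K] (c : Kˣ) (hc : ¬ IsSquare (c : K)) :
    ∃ (L : Type u) (_ : Field L) (_ : NumberField L) (_ : Algebra K L), Nonempty (QE K L c) := by
  haveI hF : Fact (∀ r : K, r ^ 2 ≠ (c : K) + 0 * r) := ⟨fun r h => hc ⟨r, by rw [← sq, h]; ring⟩⟩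
  haveI : CharZero (QuadraticAlgebra K (c : K) 0) :=
    charZero_of_injective_algebraMap (algebraMap K (QuadraticAlgebra K (c : K) 0)).injective
  haveI : NumberField (QuadraticAlgebra K (c : K) 0) := NumberField.of_module_finite K _
  refine ⟨QuadraticAlgebra K (c : K) 0, inferInstance, inferInstance, inferInstance, ⟨?_⟩⟩
  refine ⟨QuadraticAlgebra.omega, by rw [_root_.sq, qa_om], hc, qaσ _, qa_σδ _,
    Units.map QuadraticAlgebra.norm, ?_, fun x => ⟨_, _, qa_span _ x⟩, QuadraticAlgebra.finrank_eq_two _ _⟩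
  intro x
  rw [qaσ_eq, ← QuadraticAlgebra.algebraMap_norm_eq_mul_star]
  rfl

theorem cz {K L : Type*} [Field K] [Field L] [Algebra K L] [CharZero K] : CharZero L :=
  charZero_of_injective_algebraMap (algebraMap K L).injective

section
variable {K L : Type*} [Field K] [Field L] [Algebra K L] {c : Kˣ} (E : QE K L c)
include E

/-- embedding of units -/
noncomputable abbrev io (K L : Type*) [Field K] [Field L] [Algebra K L] : Kˣ →* Lˣ :=
  Units.map (algebraMap K L : K →* L)

omit E in
theorem io_inj : Function.Injective (io K L) := Units.map_injective (algebraMap K L).injective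

theorem QE.δ0 : E.δ ≠ 0 := by
  intro h
  have := E.sq
  rw [h, zero_pow two_ne_zero] at this
  exact c.ne_zero (by simpa using this.symm)

theorem QE.σσ (x : L) : E.σ (E.σ x) = x := by
  obtain ⟨a, b, rfl⟩ := E.span x
  simp [E.σδ]

/-- conjugation on units -/
noncomputable def QE.τ : Lˣ →* Lˣ := Units.map (E.σ : L →* L)

theorem QE.τ_coe (x : Lˣ) : ((E.τ x : Lˣ) : L) = E.σ x := rfl

theorem QE.ττ (x : Lˣ) : E.τ (E.τ x) = x := by ext; simp [QE.τ_coe, E.σσ]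

theorem QE.io_N (x : Lˣ) : io K L (E.N x) = x * E.τ x := by
  ext; simp [E.hN, QE.τ_coe]

theorem QE.τ_io (x : Kˣ) : E.τ (io K L x) = io K L x := by
  ext; simp [QE.τ_coe]

theorem QE.N_io (x : Kˣ) : E.N (io K L x) = x ^ 2 := by
  apply io_inj (L := L)
  rw [E.io_N, E.τ_io, map_pow, _root_.sq]

theorem QE.N_τ (x : Lˣ) : E.N (E.τ x) = E.N x := by
  apply io_inj (L := L)
  rw [E.io_N, E.io_N, E.ττ, mul_comm]

/-- delta as a unit -/
noncomputable def QE.d : Lˣ := Units.mk0 E.δ E.δ0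

theorem QE.d_sq : E.d ^ 2 = io K L c := by ext; simp [QE.d, E.sq]

theorem QE.τ_d : E.τ E.d = -E.d := by ext; simp [QE.d, QE.τ_coe, E.σδ]

theorem QE.h90 {x : Lˣ} (h : E.N x = 1) : ∃ z : Lˣ, x = z * (E.τ z)⁻¹ := by
  have h1 : x * E.τ x = 1 := by rw [← E.io_N, h, map_one]
  by_cases hx : (1 : L) + x = 0
  · refine ⟨E.d, ?_⟩
    rw [E.τ_d]
    have : x = -1 := by ext; push_cast; linear_combination hx
    rw [this]; ext; simp [E.δ0, QE.d]
  · refine ⟨Units.mk0 _ hx, ?_⟩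
    rw [eq_mul_inv_iff_mul_eq]
    ext
    have h2 : (x : L) * E.σ x = 1 := by
      have := congrArg Units.val h1
      simpa [QE.τ_coe] using this
    rw [Units.val_mul, QE.τ_coe, Units.val_mk0, map_add, map_one]
    linear_combination h2

variable [CharZero K]

theorem QE.sq_K {a : Kˣ} {y : Lˣ} (h : y ^ 2 = io K L a) : 
    (∃ b, a = b ^ 2 ∧ y = io K L b) ∨ ∃ b, a = c * b ^ 2 ∧ y = io K L b * E.d := by
  haveI := cz (K := K) (L := L)
  obtain ⟨p, q, hpq⟩ := E.span y
  have h1 : (y : L) ^ 2 = algebraMap K L a := by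
    have := congrArg Units.val h; simpa using this
  have h2 := congrArg E.σ h1
  rw [map_pow, E.σ.commutes, ← h1, hpq] at h2
  simp only [map_add, map_mul, AlgEquiv.commutes, E.σδ] at h2
  have h3 : algebraMap K L (p * q) = 0 := by
    have h4 : (4 : L) * E.δ ≠ 0 := mul_ne_zero (by norm_num) E.δ0
    apply mul_left_cancel₀ h4
    rw [map_mul]
    linear_combination -h2
  have h5 : p * q = 0 := by simpa using h3
  rcases mul_eq_zero.1 h5 with h6 | h6
  · right
    subst h6
    have hq : q ≠ 0 := by
      rintro rfl
      simp at hpq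
    have hy : y = io K L (Units.mk0 q hq) * E.d := by
      ext; simp [hpq, QE.d]
    refine ⟨Units.mk0 q hq, ?_, hy⟩
    apply io_inj (L := L)
    rw [← h, hy, mul_pow, E.d_sq, map_mul, map_pow, mul_comm]
  · left
    subst h6
    have hp : p ≠ 0 := by
      rintro rfl
      simp at hpq
    have hy : y = io K L (Units.mk0 p hp) := by
      ext; simp [hpq]
    refine ⟨Units.mk0 p hp, ?_, hy⟩
    apply io_inj (L := L)
    rw [← h, hy, map_pow]

theorem QE.c_nsq (b : Kˣ) : c ≠ b ^ 2 := by
  intro h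
  exact E.nonsq ⟨b, by rw [h]; push_cast; ring⟩

theorem QE.range_N : E.N.range = nrm c := by
  ext u
  rw [mem_nrm]
  constructor
  · rintro ⟨x, rfl⟩
    obtain ⟨a, b, hab⟩ := E.span x
    refine ⟨a, b, ?_⟩
    apply (algebraMap K L).injective
    rw [E.hN, hab]
    simp only [map_add, map_mul, AlgEquiv.commutes, E.σδ, map_sub, map_pow]
    rw [← E.sq]; ring
  · rintro ⟨a, b, hab⟩
    have e : (algebraMap K L a + algebraMap K L b * E.δ) * E.σ (algebraMap K L a + algebraMap K L b * E.δ) = algebraMap K L u := by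
      rw [hab]
      simp only [map_add, map_mul, AlgEquiv.commutes, E.σδ, map_sub, map_pow]
      rw [← E.sq]; ring
    have h0 : algebraMap K L a + algebraMap K L b * E.δ ≠ 0 := by
      intro h
      rw [h, zero_mul] at e
      have := u.ne_zero
      apply this
      simpa using e.symm
    refine ⟨Units.mk0 _ h0, ?_⟩
    ext
    apply (algebraMap K L).injective
    rw [E.hN]
    exact e

theorem QE.tr (x : L) : ∃ t : K, x + E.σ x = algebraMap K L t := by
  obtain ⟨a, b, rfl⟩ := E.span x
  refine ⟨2 * a, ?_⟩
  rw [map_add, map_mul, AlgEquiv.commutes, AlgEquiv.commutes, E.σδ, map_mul, map_ofNat]; ring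

end

section places
variable {K L : Type*} [Field K] [NumberField K] [Field L] [NumberField L] [Algebra K L]

/-- place below -/
noncomputable def dn (K : Type*) {L : Type*} [Field K] [NumberField K] [Field L] [NumberField L] [Algebra K L]
    (W : FP L) : FP K := W.under (𝓞 K)

instance dn_lo (W : FP L) : W.asIdeal.LiesOver (dn K W).asIdeal := ⟨rfl⟩

/-- ramification -/
noncomputable def eR (K : Type*) {L : Type*} [Field K] [NumberField K] [Field L] [NumberField L] [Algebra K L]
    (W : FP L) : ℕ := (dn K W).asIdeal.ramificationIdx' W.asIdeal

/-- inertia -/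
noncomputable def fR (K : Type*) {L : Type*} [Field K] [NumberField K] [Field L] [NumberField L] [Algebra K L]
    (W : FP L) : ℕ := (dn K W).asIdeal.inertiaDeg' W.asIdeal

theorem eR_pos (W : FP L) : 0 < eR K W :=
  Nat.pos_of_ne_zero (Ideal.IsDedekindDomain.ramificationIdx'_ne_zero_of_liesOver W.asIdeal (dn K W).ne_bot)

theorem fR_pos (W : FP L) : 0 < fR K W := by
  haveI := (dn K W).isMaximal
  exact Ideal.inertiaDeg'_pos _ _

theorem ord_io (W : FP L) (a : Kˣ) : (ord W (io K L a)).toAdd = eR K W * (ord (dn K W) a).toAdd := by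
  have h := valuation_liesOver L (dn K W) W (a : K)
  have e : algebraMap K L a = ((io K L a : Lˣ) : L) := rfl
  rw [e, valuation_eq_ord, valuation_eq_ord, ← WithZero.exp_nsmul, WithZero.exp_inj] at h
  rw [nsmul_eq_mul] at h
  change (eR K W : ℤ) * _ = _ at h
  linarith

theorem absNorm_dn (W : FP L) : Ideal.absNorm W.asIdeal = Ideal.absNorm (dn K W).asIdeal ^ fR K W :=
  Ideal.absNorm_eq_pow_inertiaDeg'_of_liesOver _ _ (dn K W).isPrime (dn K W).ne_bot

theorem abv_io (W : FP L) (a : K) : abv (.inl W) (algebraMap K L a) =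
    abv (.inl (dn K W)) a ^ (eR K W * fR K W) := by
  by_cases ha : a = 0
  · subst ha
    simp [(eR_pos (K := K) W).ne', (fR_pos (K := K) W).ne']
  · have h1 := fabv_eq W (io K L (Units.mk0 a ha))
    have h2 := fabv_eq (dn K W) (Units.mk0 a ha)
    rw [Units.val_mk0] at h2
    have e : ((io K L (Units.mk0 a ha) : Lˣ) : L) = algebraMap K L a := rfl
    rw [e] at h1
    rw [h1, h2, ord_io, absNorm_dn (K := K)]
    push_cast
    rw [← zpow_natCast, ← zpow_mul, ← zpow_natCast, ← zpow_mul]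
    congr 1; push_cast; ring

theorem abv_io_lt (W : FP L) (ε : ℝ) (hε : 0 < ε) :
    ∃ η > 0, ∀ a : K, abv (.inl (dn K W)) a < η → abv (.inl W) (algebraMap K L a) < ε := by
  refine ⟨min 1 ε, by positivity, fun a ha => ?_⟩
  rw [abv_io (K := K)]
  have h0 := AbsoluteValue.nonneg (abv (.inl (dn K W))) a
  have h1 : abv (.inl (dn K W)) a ≤ 1 := (ha.trans_le (min_le_left _ _)).le
  have h2 : eR K W * fR K W ≠ 0 := (Nat.mul_pos (eR_pos W) (fR_pos W)).ne'
  exact (pow_le_of_le_one h0 h1 h2).trans_lt (ha.trans_le (min_le_right _ _))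

theorem abv_lt_of_io (W : FP L) (ε : ℝ) (hε : 0 < ε) (a : K)
    (ha : abv (.inl W) (algebraMap K L a) < ε ^ (eR K W * fR K W)) : abv (.inl (dn K W)) a < ε := by
  rw [abv_io (K := K)] at ha
  exact lt_of_pow_lt_pow_left₀ _ hε.le ha

theorem P_io (W : FP L) {a : Kˣ} (ha : a ∈ P (.inl (dn K W))) : io K L a ∈ P (.inl W) := by
  intro ε hε
  obtain ⟨η, hη, h⟩ := abv_io_lt (K := K) W ε hε
  obtain ⟨y, hy⟩ := ha η hη
  refine ⟨algebraMap K L y, ?_⟩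
  have := h _ hy
  simpa using this

theorem exists_up (L : Type*) [Field L] [NumberField L] [Algebra K L] (w : FP K) : ∃ W : FP L, dn K W = w := by
  haveI := w.isMaximal
  obtain ⟨P, hP, hP2⟩ := Ideal.exists_maximal_ideal_liesOver_of_isIntegral w.asIdeal (S := 𝓞 L)
  have : P ≠ ⊥ := Ideal.ne_bot_of_liesOver_of_ne_bot w.ne_bot P
  refine ⟨⟨P, hP.isPrime, this⟩, HeightOneSpectrum.ext hP2.over.symm⟩

theorem le_ord_iff (W : FP L) (x : 𝓞 L) (hx : (x : L) ≠ 0) (k : ℕ) :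
    (k : ℤ) ≤ (ord W (Units.mk0 (x : L) hx)).toAdd ↔ x ∈ W.asIdeal ^ k := by
  rw [← fabv_le_iff, ← fabv_le_mem]; rfl

variable {c : Kˣ} (E : QE K L c)
include E

/-- conjugate place -/
noncomputable def QE.sg (W : FP L) : FP L :=
  W.comap (RingOfIntegers.mapRingEquiv E.σ.toRingEquiv : 𝓞 L →+* 𝓞 L)
    (RingOfIntegers.mapRingEquiv E.σ.toRingEquiv).surjective

theorem QE.mem_sg (W : FP L) (x : 𝓞 L) (k : ℕ) :
    x ∈ (E.sg W).asIdeal ^ k ↔ RingOfIntegers.mapRingEquiv E.σ.toRingEquiv x ∈ W.asIdeal ^ k := by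
  set s := RingOfIntegers.mapRingEquiv E.σ.toRingEquiv with hs
  have h1 : (E.sg W).asIdeal = Ideal.map s.symm W.asIdeal := by
    rw [Ideal.map_symm]; rfl
  rw [h1, ← Ideal.map_pow, Ideal.map_symm]
  exact Ideal.mem_comap

theorem QE.sg_int (W : FP L) (x : 𝓞 L) (hx : (x : L) ≠ 0) :
    ord (E.sg W) (Units.mk0 (x : L) hx) = ord W (E.τ (Units.mk0 (x : L) hx)) := by
  set s := RingOfIntegers.mapRingEquiv E.σ.toRingEquiv with hs
  have hsx : ((s x : 𝓞 L) : L) ≠ 0 := by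
    change E.σ (x : L) ≠ 0
    simpa using hx
  have e : E.τ (Units.mk0 (x : L) hx) = Units.mk0 ((s x : 𝓞 L) : L) hsx := by
    ext; rfl
  rw [e]
  apply Multiplicative.toAdd.injective
  have h1 := int_ord x hx (E.sg W)
  have h2 := int_ord (s x) hsx W
  have h3 : ∀ k : ℕ, (k : ℤ) ≤ (ord (E.sg W) (Units.mk0 (x : L) hx)).toAdd ↔ (k : ℤ) ≤ (ord W (Units.mk0 ((s x : 𝓞 L) : L) hsx)).toAdd := by
    intro k
    rw [le_ord_iff, le_ord_iff, E.mem_sg]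
  obtain ⟨a, ha⟩ := Int.eq_ofNat_of_zero_le h1
  obtain ⟨b, hb⟩ := Int.eq_ofNat_of_zero_le h2
  have h4 := h3 a
  have h5 := h3 b
  omega

theorem QE.sg_ord (W : FP L) (x : Lˣ) : ord (E.sg W) x = ord W (E.τ x) := by
  obtain ⟨a, b, hb, hab⟩ := IsFractionRing.div_surjective (A := 𝓞 L) (x : L)
  have hb0 : (b : L) ≠ 0 := by
    have := nonZeroDivisors.ne_zero hb
    simpa using this
  have ha0 : (a : L) ≠ 0 := by
    intro h
    have h2 : algebraMap (𝓞 L) L a = 0 := h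
    rw [h2, zero_div] at hab
    exact x.ne_zero hab.symm
  have : x = Units.mk0 (a : L) ha0 / Units.mk0 (b : L) hb0 := by
    ext; rw [← hab]; simp
  rw [this, map_div, map_div, map_div, E.sg_int, E.sg_int]

theorem QE.sg_absNorm (W : FP L) : Ideal.absNorm (E.sg W).asIdeal = Ideal.absNorm W.asIdeal := by
  rw [Ideal.absNorm_apply, Ideal.absNorm_apply, Submodule.cardQuot_apply, Submodule.cardQuot_apply]
  set s := RingOfIntegers.mapRingEquiv E.σ.toRingEquiv with hs
  refine Nat.card_congr (Ideal.quotientEquiv _ _ s ?_).toEquiv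
  ext x
  have := E.mem_sg W (s.symm x) 1
  rw [pow_one, pow_one, ← hs, RingEquiv.apply_symm_apply] at this
  rw [← this]
  change _ ↔ x ∈ Ideal.map s _
  rw [← Ideal.comap_symm, Ideal.mem_comap]

theorem QE.sg_abv (W : FP L) (x : L) : abv (.inl (E.sg W)) x = abv (.inl W) (E.σ x) := by
  by_cases hx : x = 0
  · simp [hx]
  · have h1 := fabv_eq (E.sg W) (Units.mk0 x hx)
    have h2 := fabv_eq W (E.τ (Units.mk0 x hx))
    rw [E.sg_ord, E.sg_absNorm, ← h2] at h1
    exact h1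

theorem QE.dn_sg (W : FP L) : dn K (E.sg W) = dn K W := by
  apply HeightOneSpectrum.ext
  ext x
  have h1 := fabv_lt_iff_mem (E.sg W) (algebraMap (𝓞 K) (𝓞 L) x)
  have h2 := fabv_lt_iff_mem W (algebraMap (𝓞 K) (𝓞 L) x)
  change algebraMap (𝓞 K) (𝓞 L) x ∈ (E.sg W).asIdeal ↔ algebraMap (𝓞 K) (𝓞 L) x ∈ W.asIdeal
  rw [← h1, ← h2, E.sg_abv]
  have : ((algebraMap (𝓞 K) (𝓞 L) x : 𝓞 L) : L) = algebraMap K L (x : K) := rfl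
  rw [this, E.σ.commutes]

theorem QE.fiber {W1 W2 : FP L} (h : dn K W1 = dn K W2) : W2 = W1 ∨ W2 = E.sg W1 := by
  by_contra hn
  push Not at hn
  have key : ¬ ((W2.asIdeal : Set (𝓞 L)) ⊆ W1.asIdeal ∪ (E.sg W1).asIdeal) := by
    rw [Ideal.subset_union]
    rintro (h1 | h1)
    · exact hn.1 (HeightOneSpectrum.ext (W2.isMaximal.eq_of_le W1.isPrime.ne_top h1))
    · exact hn.2 (HeightOneSpectrum.ext (W2.isMaximal.eq_of_le (E.sg W1).isPrime.ne_top h1))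
  rw [Set.not_subset] at key
  obtain ⟨x, hx, hx2⟩ := key
  rw [Set.mem_union, not_or] at hx2
  obtain ⟨hx3, hx4⟩ := hx2
  have hx0 : (x : L) ≠ 0 := by
    intro h0
    have : x = 0 := RingOfIntegers.ext h0
    rw [this] at hx3
    exact hx3 (zero_mem _)
  set X := Units.mk0 (x : L) hx0
  have h1 : 0 < (ord W2 X).toAdd := (int_ord_pos x hx0 W2).2 hx
  have h2 : ord W1 X = 1 := (int_ord_one x hx0 W1).2 hx3
  have h3 : ord (E.sg W1) X = 1 := (int_ord_one x hx0 _).2 hx4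
  rw [E.sg_ord] at h3
  have h4 : 0 ≤ (ord W2 (E.τ X)).toAdd := by
    rw [← E.sg_ord]; exact int_ord x hx0 _
  have h5 : ord W1 (io K L (E.N X)) = 1 := by rw [E.io_N, map_mul, h2, h3, one_mul]
  have h6 : 0 < (ord W2 (io K L (E.N X))).toAdd := by rw [E.io_N, map_mul, toAdd_mul]; omega
  rw [← toAdd_eq_zero, ord_io] at h5
  rw [ord_io, ← h] at h6
  have h7 := eR_pos (K := K) W1
  rcases mul_eq_zero.1 h5 with h8 | h8
  · omega
  · rw [h8] at h6; simp at h6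

theorem QE.sgsg (W : FP L) : E.sg (E.sg W) = W := by
  apply HeightOneSpectrum.ext
  ext x
  rw [← fabv_lt_iff_mem, ← fabv_lt_iff_mem, E.sg_abv, E.sg_abv, E.σσ]

theorem QE.split_iff (W : FP L) : c ∈ P (.inl (dn K W)) ↔ E.sg W ≠ W := by
  have h2δ : 0 < abv (.inl W) (2 * E.δ) := by
    rw [AbsoluteValue.pos_iff]
    exact mul_ne_zero two_ne_zero E.δ0
  constructor
  · intro hc hW
    have hsym : ∀ x, abv (.inl W) (E.σ x) = abv (.inl W) x := by
      intro x; rw [← E.sg_abv, hW]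
    obtain ⟨η, hη, h⟩ := abv_io_lt (K := K) W (abv (.inl W) (2 * E.δ) ^ 2) (by positivity)
    obtain ⟨a, ha⟩ := exists_sq_near hc hη
    have h1 := h _ ha
    rw [map_sub, map_pow, ← E.sq, sq_sub_sq, map_mul] at h1
    have h3 : abv (.inl W) (algebraMap K L a + E.δ) = abv (.inl W) (algebraMap K L a - E.δ) := by
      rw [← hsym, map_add, E.σ.commutes, E.σδ, sub_eq_add_neg]
    rw [h3, ← _root_.sq] at h1
    have h4 := lt_of_pow_lt_pow_left₀ _ h2δ.le h1
    have h5 := na_sub (fna W) (algebraMap K L a + E.δ) (algebraMap K L a - E.δ)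
    rw [h3, max_self, add_sub_sub_cancel, ← two_mul] at h5
    linarith
  · intro hW
    -- approximate
    have hd : Set.Finite {Sum.inl W, (Sum.inl (E.sg W) : Pl L)} := Set.toFinite _
    intro ε hε
    have hc0 : (0 : ℝ) < abv (.inl (dn K W)) (c : K) := by simp
    set M := (ε * abv (.inl (dn K W)) (c : K)) ^ (eR K W * fR K W) with hM
    have hMp : 0 < M := by positivity
    -- η small
    obtain ⟨η, hη, hηM⟩ : ∃ η > 0, η * max η (abv (.inl W) (2 * E.δ)) < M * abv (.inl W) (4 : L) := by
      have h4 : 0 < abv (.inl W) (4 : L) := by simp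
      set B := M * abv (.inl W) (4 : L)
      have hB : 0 < B := by positivity
      refine ⟨min (B / (2 * abv (.inl W) (2 * E.δ))) (min 1 (B / 2)), by positivity, ?_⟩
      set η := min (B / (2 * abv (.inl W) (2 * E.δ))) (min 1 (B / 2)) with hη
      have e1 : η ≤ B / (2 * abv (.inl W) (2 * E.δ)) := min_le_left _ _
      have e2 : η ≤ 1 := (min_le_right _ _).trans (min_le_left _ _)
      have e3 : η ≤ B / 2 := (min_le_right _ _).trans (min_le_right _ _)
      have e0 : 0 < η := by positivity
      rw [mul_max_of_nonneg _ _ e0.le, max_lt_iff]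
      constructor
      · nlinarith
      · rw [le_div_iff₀ (by positivity)] at e1
        nlinarith
    classical
    obtain ⟨x, hx⟩ := wa _ hd (fun w => if w = .inl W then E.δ else -E.δ) (fun _ => η) (fun _ _ => hη)
    have hx1 := hx (.inl W) (by simp)
    have hx2 := hx (.inl (E.sg W)) (by simp)
    have hne : (Sum.inl (E.sg W) : Pl L) ≠ .inl W := fun h => hW (Sum.inl_injective h)
    simp only [if_true, if_neg hne] at hx1 hx2
    rw [E.sg_abv, map_sub, map_neg, E.σδ, neg_neg] at hx2
    obtain ⟨t, ht⟩ := E.tr x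
    have h3 : abv (.inl W) (algebraMap K L t - 2 * E.δ) < η := by
      rw [← ht, show x + E.σ x - 2 * E.δ = (x - E.δ) + (E.σ x - E.δ) by ring]
      exact (na_add (fna W) _ _).trans_lt (max_lt hx1 hx2)
    have h4 : abv (.inl W) (algebraMap K L t + 2 * E.δ) ≤ max η (abv (.inl W) (2 * E.δ)) := by
      rw [show algebraMap K L t + 2 * E.δ = (algebraMap K L t - 2 * E.δ) + 2 * (2 * E.δ) by ring]
      refine (na_add (fna W) _ _).trans (max_le_max h3.le ?_)
      rw [map_mul]
      have := na_nat (fna W) 2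
      push_cast at this
      nlinarith
    have h5 : abv (.inl W) (algebraMap K L ((t / 2) ^ 2 - c)) < M := by
      have e : algebraMap K L ((t / 2) ^ 2 - c) = (algebraMap K L t - 2 * E.δ) * (algebraMap K L t + 2 * E.δ) / 4 := by
        rw [map_sub, map_pow, map_div₀, map_ofNat, ← E.sq]; ring
      rw [e, map_div₀, div_lt_iff₀ (by simp), map_mul]
      refine lt_of_le_of_lt ?_ hηM
      exact mul_le_mul h3.le h4 (AbsoluteValue.nonneg _ _) hη.le
    have h6 := abv_lt_of_io (K := K) W _ (by positivity) _ h5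
    refine ⟨(t / 2) / c, ?_⟩
    have e : (c : K) * (t / 2 / c) ^ 2 - 1 = ((t / 2) ^ 2 - c) / c := by
      have := c.ne_zero
      field_simp
    rw [e, map_div₀, div_lt_iff₀ hc0]
    exact h6

end places
end QF


namespace QF
open NumberField IsDedekindDomain HeightOneSpectrum

section
variable {K L : Type*} [Field K] [NumberField K] [Field L] [NumberField L] [Algebra K L]
variable {c : Kˣ} (E : QE K L c)
include E

open Classical in
theorem QE.fund (W : FP L) : (if E.sg W = W then eR K W * fR K W else
    eR K W * fR K W + eR K (E.sg W) * fR K (E.sg W)) = 2 := by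
  have := (dn K W).isMaximal
  have h := Ideal.sum_ramification_inertia (R := 𝓞 K) (𝓞 L) K L (p := (dn K W).asIdeal) (dn K W).ne_bot
  rw [E.fr] at h
  have hfin : IsDedekindDomain.primesOverFinset (dn K W).asIdeal (𝓞 L) = {W.asIdeal, (E.sg W).asIdeal} := by
    ext Q
    rw [IsDedekindDomain.mem_primesOverFinset_iff (dn K W).ne_bot]
    simp only [Finset.mem_insert, Finset.mem_singleton]
    constructor
    · rintro ⟨h1, h2⟩
      have h0 : Q ≠ ⊥ := Ideal.ne_bot_of_liesOver_of_ne_bot (dn K W).ne_bot Q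
      have h3 : dn K W = dn K (⟨Q, h1, h0⟩ : FP L) := HeightOneSpectrum.ext h2.over
      rcases E.fiber h3 with h4 | h4
      · left; exact congrArg HeightOneSpectrum.asIdeal h4
      · right; exact congrArg HeightOneSpectrum.asIdeal h4
    · rintro (rfl | rfl)
      · exact ⟨W.isPrime, dn_lo W⟩
      · refine ⟨(E.sg W).isPrime, ?_⟩
        rw [← E.dn_sg W]
        exact dn_lo _
  rw [hfin] at h
  have e1 : eR K (E.sg W) * fR K (E.sg W) = Ideal.ramificationIdx' (dn K W).asIdeal (E.sg W).asIdeal *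
      Ideal.inertiaDeg' (dn K W).asIdeal (E.sg W).asIdeal := by
    rw [← E.dn_sg W]; rfl
  split_ifs with hs
  · rw [hs, Finset.pair_eq_singleton, Finset.sum_singleton] at h
    exact h
  · rw [Finset.sum_pair (fun h => hs (HeightOneSpectrum.ext h.symm)), ← e1] at h
    exact h

theorem QE.ef (W : FP L) (h : E.sg W = W) : eR K W * fR K W = 2 := by
  have := E.fund W
  rwa [if_pos h] at this

theorem QE.ef1 (W : FP L) (h : E.sg W ≠ W) : eR K W = 1 ∧ fR K W = 1 := by
  have := E.fund W
  rw [if_neg h] at this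
  have h1 := Nat.mul_pos (eR_pos (K := K) W) (fR_pos (K := K) W)
  have h2 := Nat.mul_pos (eR_pos (K := K) (E.sg W)) (fR_pos (K := K) (E.sg W))
  have : eR K W * fR K W = 1 := by omega
  exact mul_eq_one.1 this

theorem QE.abv_io2 (W : FP L) (h : E.sg W = W) (a : K) :
    abv (.inl W) (algebraMap K L a) = abv (.inl (dn K W)) a ^ 2 := by
  rw [abv_io (K := K), E.ef W h]

theorem QE.sym (W : FP L) (h : E.sg W = W) (x : L) : abv (.inl W) (E.σ x) = abv (.inl W) x := by
  rw [← E.sg_abv, h]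

theorem QE.abv_N (W : FP L) (h : E.sg W = W) (x : Lˣ) :
    abv (.inl (dn K W)) (E.N x : K) = abv (.inl W) (x : L) := by
  have h1 := E.abv_io2 W h (E.N x)
  rw [E.hN, map_mul, E.sym W h, ← _root_.sq] at h1
  exact ((pow_left_inj₀ (AbsoluteValue.nonneg _ _) (AbsoluteValue.nonneg _ _) two_ne_zero).1 h1).symm

theorem QE.loc_h2 (W : FP L) (h : E.sg W = W) {b : Lˣ} (hb : b ∈ P (.inl W)) :
    E.N b ∈ P (.inl (dn K W)) := by
  intro ε hε
  obtain ⟨y, hy⟩ := hb (min 1 (ε ^ 2)) (by positivity)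
  have hy0 : y ≠ 0 := by
    rintro rfl
    have := hy.trans_le (min_le_left _ _)
    simp at this
  set x : L := b * y ^ 2 with hx
  refine ⟨E.N (Units.mk0 y hy0), ?_⟩
  apply abv_lt_of_io (K := K) W ε hε
  rw [E.ef W h]
  have e : algebraMap K L ((E.N b : K) * (E.N (Units.mk0 y hy0) : K) ^ 2 - 1) = (x - 1) * E.σ x + E.σ (x - 1) := by
    rw [map_sub, map_mul, map_pow, E.hN, E.hN, hx]
    simp only [map_sub, map_mul, map_pow, map_one, Units.val_mk0]
    ring
  rw [e]
  have h1 : abv (.inl W) x ≤ 1 := by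
    have := na_near_one (fna W) (hy.trans_le (min_le_left _ _))
    exact this.le
  refine (na_add (fna W) _ _).trans_lt (max_lt ?_ ?_)
  · rw [map_mul, E.sym W h]
    have := AbsoluteValue.nonneg (abv (.inl W)) (x - 1)
    have h2 := hy.trans_le (min_le_right _ _)
    nlinarith
  · rw [E.sym W h]
    exact hy.trans_le (min_le_right _ _)

theorem QE.loc_h3 (W : FP L) (h : E.sg W = W) {b : Lˣ} (hb : E.N b ∈ P (.inl (dn K W))) :
    ∃ a, ∃ q ∈ P (.inl W), b = io K L a * q := by
  obtain ⟨ε0, hε0, H⟩ := hens (K := L) (.inl W)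
  have h2 : 0 < abv (.inl W) (2 : L) := by simp
  have hm : 0 < ε0 * abv (.inl W) (2 : L) := by positivity
  obtain ⟨η, hη, Hη⟩ := abv_io_lt (K := K) W _ hm
  obtain ⟨y, hy⟩ := hb (min 1 η) (by positivity)
  have hy0 : y ≠ 0 := by
    rintro rfl
    have := hy.trans_le (min_le_left _ _)
    simp at this
  set Y := Units.mk0 y hy0 with hY
  set x : Lˣ := b * io K L Y with hx
  have hNx : ((E.N x : Kˣ) : K) = E.N b * y ^ 2 := by
    rw [hx, map_mul, E.N_io]; simp [hY]
  rw [← hNx] at hy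
  have hs := Hη _ (hy.trans_le (min_le_right _ _))
  -- choose t
  have ht : ∃ t : L, t ≠ 0 ∧ abv (.inl W) 2 * abv (.inl W) t ≤ abv (.inl W) (t + x * E.σ t) := by
    by_contra hcon
    push Not at hcon
    have e1 := hcon 1 one_ne_zero
    have e2 := hcon E.δ E.δ0
    rw [E.σδ, show E.δ + x * -E.δ = E.δ * (1 - x) by ring, map_mul, mul_comm] at e2
    rw [map_one, map_one, mul_one, mul_one] at e1
    have e3 := lt_of_mul_lt_mul_right e2 (AbsoluteValue.nonneg _ _)
    have e4 := na_add (fna W) (1 + (x : L)) (1 - x)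
    rw [show 1 + (x : L) + (1 - x) = 2 by ring] at e4
    have := e4.trans_lt (max_lt e1 e3)
    exact lt_irrefl _ this
  obtain ⟨t, ht0, ht⟩ := ht
  have htp : 0 < abv (.inl W) t := by simpa using ht0
  have hz0 : t + x * E.σ t ≠ 0 := by
    intro h0
    rw [h0, map_zero] at ht
    have : 0 < abv (.inl W) 2 * abv (.inl W) t := by positivity
    linarith
  set z : Lˣ := Units.mk0 _ hz0 with hz
  have hzz : (z : L) = t + x * E.σ t := rfl
  have key : (x : L) * E.σ z = z + (algebraMap K L (E.N x) - 1) * t := by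
    rw [hzz, map_add, map_mul, E.σσ, E.hN]; ring
  have hq : ((x * E.τ z * z⁻¹ : Lˣ) : L) - 1 = (algebraMap K L (E.N x) - 1) * t / z := by
    have := z.ne_zero
    rw [Units.val_mul, Units.val_mul, E.τ_coe, key]
    rw [Units.val_inv_eq_inv_val]
    field_simp
    ring
  have hqP : x * E.τ z * z⁻¹ ∈ P (.inl W) := by
    apply H
    rw [hq, map_div₀, map_mul, div_lt_iff₀ (by simp)]
    rw [map_sub, map_one] at hs
    calc _ < ε0 * abv (.inl W) 2 * abv (.inl W) t := by gcongr
      _ = ε0 * (abv (.inl W) 2 * abv (.inl W) t) := by ring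
      _ ≤ _ := by rw [hzz]; gcongr
  refine ⟨Y⁻¹ * (E.N z)⁻¹, z ^ 2 * (x * E.τ z * z⁻¹), mul_mem (sq_mem_locSq _ z) hqP, ?_⟩
  rw [map_mul, map_inv, map_inv, E.io_N]
  have : x * (io K L Y)⁻¹ = b := by rw [hx, mul_inv_cancel_right]
  rw [← this]
  generalize io K L Y = A
  generalize E.τ z = B
  rw [mul_inv, pow_two]
  calc x * A⁻¹ = x * A⁻¹ * ((z⁻¹ * z) * (B⁻¹ * B) * (z * z⁻¹)) := by simp
    _ = _ := by
      simp only [mul_assoc, mul_comm, mul_left_comm]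

theorem QE.loc_h5 (W : FP L) (h : E.sg W = W) {a : Kˣ} (ha : io K L a ∈ P (.inl W)) :
    a ∈ P (.inl (dn K W)) ∨ a * c ∈ P (.inl (dn K W)) := by
  obtain ⟨ε0, hε0, H⟩ := hens (K := K) (.inl (dn K W))
  have h2 : 0 < abv (.inl W) (4 : L) := by simp
  set m := min 1 (ε0 ^ 2) with hmm
  have hm : 0 < m := by positivity
  have hm1 : m ≤ 1 := min_le_left _ _
  have h41 : abv (.inl W) (4 : L) ≤ 1 := by exact_mod_cast na_nat (fna W) 4
  obtain ⟨y, hy⟩ := ha (m * abv (.inl W) (4 : L)) (by positivity)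
  obtain ⟨p, q, rfl⟩ := E.span y
  set A : L := algebraMap K L a with hA
  set p' : L := algebraMap K L p
  set q' : L := algebraMap K L q
  change abv (.inl W) (A * (p' + q' * E.δ) ^ 2 - 1) < _ at hy
  have hy' := hy
  rw [← E.sym W h] at hy'
  have eσ : E.σ (A * (p' + q' * E.δ) ^ 2 - 1) = A * (p' - q' * E.δ) ^ 2 - 1 := by
    simp only [A, p', q', map_sub, map_mul, map_pow, map_add, AlgEquiv.commutes, E.σδ, map_one]; ring
  rw [eσ] at hy'
  have h3 : abv (.inl W) (A * p' * (q' * E.δ)) < m := by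
    have e1 : (A * (p' + q' * E.δ) ^ 2 - 1) - (A * (p' - q' * E.δ) ^ 2 - 1) = 4 * (A * p' * (q' * E.δ)) := by ring
    have e2 := (na_sub (fna W) (A * (p' + q' * E.δ) ^ 2 - 1) (A * (p' - q' * E.δ) ^ 2 - 1)).trans_lt (max_lt hy hy')
    rw [e1, map_mul, mul_comm] at e2
    exact lt_of_mul_lt_mul_right e2 h2.le
  have h3' : abv (.inl W) (2 * (A * p' * (q' * E.δ))) < m := by
    rw [map_mul]
    have h21 : abv (.inl W) (2 : L) ≤ 1 := by exact_mod_cast na_nat (fna W) 2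
    have := AbsoluteValue.nonneg (abv (.inl W)) (A * p' * (q' * E.δ))
    nlinarith
  have hyy : abv (.inl W) (A * (p' + q' * E.δ) ^ 2 - 1) < m := by nlinarith
  have fin : ∀ (b : Kˣ) (r : K), abv (.inl W) (algebraMap K L (b * r ^ 2 - 1)) < m → b ∈ P (.inl (dn K W)) := by
    intro b r hr
    have hr1 : abv (.inl (dn K W)) (b * r ^ 2 - 1) < min 1 ε0 := by
      apply abv_lt_of_io (K := K) W _ (by positivity)
      rw [E.ef W h]
      refine hr.trans_le (le_of_eq ?_)
      rw [hmm]
      rcases le_total 1 ε0 with h | h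
      · rw [min_eq_left h, min_eq_left (by nlinarith)]; norm_num
      · rw [min_eq_right h, min_eq_right (by nlinarith)]
    have hr0 : r ≠ 0 := by
      rintro rfl
      have := hr1.trans_le (min_le_left _ _)
      simp at this
    have h5 : b * (Units.mk0 r hr0) ^ 2 ∈ P (.inl (dn K W)) := by
      apply H
      exact hr1.trans_le (min_le_right _ _)
    exact (Subgroup.mul_mem_cancel_right _ (sq_mem_locSq _ _)).1 h5
  have h4 : abv (.inl W) (A * (q' * E.δ) ^ 2) < m ∨ abv (.inl W) (A * p' ^ 2) < m := by
    by_contra hcon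
    push Not at hcon
    obtain ⟨e1, e2⟩ := hcon
    have : abv (.inl W) (A * (q' * E.δ) ^ 2) * abv (.inl W) (A * p' ^ 2) = abv (.inl W) (A * p' * (q' * E.δ)) ^ 2 := by
      rw [← map_mul (abv (.inl W)), ← map_pow (abv (.inl W))]; congr 1; ring
    have h0 := AbsoluteValue.nonneg (abv (.inl W)) (A * p' * (q' * E.δ))
    nlinarith
  rcases h4 with h4 | h4
  · left
    apply fin a p
    have e : algebraMap K L (a * p ^ 2 - 1) = (A * (p' + q' * E.δ) ^ 2 - 1) - (2 * (A * p' * (q' * E.δ)) + A * (q' * E.δ) ^ 2) := by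
      simp only [map_sub, map_mul, map_pow, map_one]; ring
    rw [e]
    exact (na_sub (fna W) _ _).trans_lt (max_lt hyy ((na_add (fna W) _ _).trans_lt (max_lt h3' h4)))
  · right
    apply fin (a * c) q
    have e : algebraMap K L ((a * c : Kˣ) * q ^ 2 - 1) = (A * (p' + q' * E.δ) ^ 2 - 1) - (2 * (A * p' * (q' * E.δ)) + A * p' ^ 2) := by
      simp only [map_sub, map_mul, map_pow, map_one, Units.val_mul]; rw [← E.sq]; ring
    rw [e]
    exact (na_sub (fna W) _ _).trans_lt (max_lt hyy ((na_add (fna W) _ _).trans_lt (max_lt h3' h4)))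

theorem QE.io_c (W : FP L) : io K L c ∈ P (.inl W) := by
  rw [← E.d_sq]; exact sq_mem_locSq _ _

theorem QE.locN_eq (w : Pl K) : E.N.range ⊔ P w = Nw w c := by
  rw [E.range_N, sup_comm]; rfl

theorem QE.loc_index (W : FP L) (h : E.sg W = W) : (Nw (.inl (dn K W)) c).index = 2 := by
  haveI : (P (.inl (dn K W))).FiniteIndex := ⟨P_index_ne_zero _⟩
  haveI : (P (.inl W)).FiniteIndex := ⟨P_index_ne_zero _⟩
  have hc : c ∉ P (.inl (dn K W)) := fun hc => (E.split_iff W).1 hc h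
  have key := index_lemma (io K L) E.N (P (.inl (dn K W))) (P (.inl W))
    (fun a => by rw [E.N_io]; exact sq_mem_locSq _ _) (fun b hb => E.loc_h2 W h hb)
    (fun b hb => E.loc_h3 W h hb) (fun a ha => P_io W ha) (by
      rw [Subgroup.relIndex_eq_two_iff]
      refine ⟨c, E.io_c W, fun b hb => ?_⟩
      rcases E.loc_h5 W h hb with h5 | h5
      · right
        refine ⟨h5, fun h6 => hc ((Subgroup.mul_mem_cancel_left _ h5).1 h6)⟩
      · left
        refine ⟨h5, fun h6 => hc ((Subgroup.mul_mem_cancel_left _ h6).1 h5)⟩)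
  rw [E.locN_eq, P_index_fin, P_index_fin] at key
  have h2 : ((Ideal.absNorm W.asIdeal ^ e2 W : ℕ) : ℝ) = ((Ideal.absNorm (dn K W).asIdeal ^ e2 (dn K W)) ^ 2 : ℕ) := by
    have h3 := E.abv_io2 W h 2
    rw [map_ofNat, abv_two, abv_two] at h3
    push_cast
    have h4 := congrArg (·⁻¹) h3
    simpa [nv, zpow_neg] using h4
  have h2' : Ideal.absNorm W.asIdeal ^ e2 W = (Ideal.absNorm (dn K W).asIdeal ^ e2 (dn K W)) ^ 2 := by exact_mod_cast h2
  rw [h2'] at key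
  have hp : 0 < (Ideal.absNorm (dn K W).asIdeal ^ e2 (dn K W)) ^ 2 := by
    have := absNorm_gt (dn K W)
    have : 0 < Ideal.absNorm (dn K W).asIdeal := by exact_mod_cast (zero_lt_one.trans this)
    positivity
  generalize Ideal.absNorm (dn K W).asIdeal ^ e2 (dn K W) = X at *
  have : (Nw (.inl (dn K W)) c).index * (8 * X ^ 2) = 2 * (8 * X ^ 2) := by linarith
  exact Nat.eq_of_mul_eq_mul_right (by positivity) this

end

variable {K : Type*} [Field K] [NumberField K]

theorem P_of_sq {w : Pl K} {c : Kˣ} (h : IsSquare (c : K)) : c ∈ P w := by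
  obtain ⟨r, hr⟩ := h
  have h0 : r ≠ 0 := by rintro rfl; exact c.ne_zero (by rw [hr]; simp)
  have : c = (Units.mk0 r h0) ^ 2 := by ext; rw [hr]; simp [sq]
  rw [this]; exact sq_mem_locSq _ _

theorem Nw_real (s : K →+* ℝ) {c : Kˣ} (hc : c ∉ P (.inr s)) : Nw (.inr s) c = P (.inr s) := by
  apply sup_eq_left.2
  rintro u ⟨y, z, hu⟩
  have hc' : ¬ 0 < s c := fun h => hc ((mem_locSq_real s c).2 h)
  refine (mem_locSq_real s u).2 ?_
  have h0 : s u ≠ 0 := by simp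
  rw [hu] at h0 ⊢
  simp only [map_sub, map_pow, map_mul] at h0 ⊢
  have : 0 ≤ s y ^ 2 - s c * s z ^ 2 := by nlinarith [sq_nonneg (s y), sq_nonneg (s z)]
  exact lt_of_le_of_ne this (Ne.symm h0)

theorem Nw_index (w : Pl K) {c : Kˣ} (hc : c ∉ P w) : (Nw w c).index = 2 := by
  rcases w with w | s
  · obtain ⟨L, _, _, _, ⟨E⟩⟩ := exists_QE c (fun h => hc (P_of_sq h))
    obtain ⟨W, rfl⟩ := exists_up L w
    apply E.loc_index
    by_contra h
    exact hc ((E.split_iff W).2 h)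
  · rw [Nw_real s hc, P_index_real]

theorem Nw_top {w : Pl K} {c : Kˣ} (hc : c ∈ P w) : Nw w c = ⊤ := locN_top (hens w) hc

theorem P_le_Nw (w : Pl K) (c : Kˣ) : P w ≤ Nw w c := le_sup_left

theorem Nw_comm {w : Pl K} {c e : Kˣ} : e ∈ Nw w c ↔ c ∈ Nw w e := locN_comm (hens w)

theorem Nw_nondeg {w : Pl K} {c : Kˣ} (h : ∀ e, e ∈ Nw w c) : c ∈ P w := by
  by_contra hc
  have := Nw_index w hc
  rw [(eq_top_iff.2 fun x _ => h x : Nw w c = ⊤), Subgroup.index_top] at this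
  omega

theorem Nw_mul_iff {w : Pl K} {c a b : Kˣ} (ha : a ∉ Nw w c) (hb : b ∉ Nw w c) : a * b ∈ Nw w c := by
  have hc : c ∉ P w := fun h => ha (by rw [Nw_top h]; trivial)
  rw [Subgroup.mul_mem_iff_of_index_two (Nw_index w hc)]
  tauto

end QF


namespace QF
open NumberField IsDedekindDomain HeightOneSpectrum

section adq
variable {K : Type*} [Field K] [NumberField K]

/-- adequate finite sets of primes -/
structure Adq (S : Set (FP K)) : Prop where
  fin : S.Finite
  dy : ∀ v ∉ S, abv (.inl v) (2 : K) = 1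
  cl : ∀ q : FP K, q ∉ S → ∃ κ : Kˣ, (ord q κ).toAdd = 1 ∧ ∀ v ∉ S, v ≠ q → ord v κ = 1

theorem Adq.mono {S T : Set (FP K)} (h : Adq S) (hST : S ⊆ T) (hT : T.Finite) : Adq T where
  fin := hT
  dy := fun v hv => h.dy v (fun h' => hv (hST h'))
  cl := fun q hq => by
    obtain ⟨κ, h1, h2⟩ := h.cl q (fun h' => hq (hST h'))
    exact ⟨κ, h1, fun v hv => h2 v (fun h' => hv (hST h'))⟩

theorem dyadic_finite : {v : FP K | abv (.inl v) (2 : K) ≠ 1}.Finite := by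
  refine (ord_finite (Units.mk0 (2 : K) two_ne_zero)).subset fun v hv => ?_
  intro h
  exact hv ((fabv_eq_one_iff v _).2 h)

theorem exists_adq {F : Set (FP K)} (hF : F.Finite) : ∃ S, F ⊆ S ∧ Adq S := by
  obtain ⟨S, hS, h⟩ := exists_Scl K
  refine ⟨F ∪ S ∪ {v : FP K | abv (.inl v) (2 : K) ≠ 1}, fun x hx => Or.inl (Or.inl hx),
    (hF.union hS).union dyadic_finite, fun v hv => ?_, fun q hq => ?_⟩
  · by_contra h
    exact hv (Or.inr h)
  · obtain ⟨κ, h1, h2⟩ := h q (fun h' => hq (Or.inl (Or.inr h')))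
    exact ⟨κ, h1, fun v hv => h2 v (fun h' => hv (Or.inl (Or.inr h')))⟩

theorem exists_adq_unit {F : Set (FP K)} (hF : F.Finite) (X : Set Kˣ) (hX : X.Finite) :
    ∃ S, F ⊆ S ∧ Adq S ∧ ∀ x ∈ X, x ∈ US S := by
  obtain ⟨S, h1, h2⟩ := exists_adq (hF.union (hX.biUnion fun x _ => ord_finite x))
  refine ⟨S, fun x hx => h1 (Or.inl hx), h2, fun x hx => mem_US.2 fun v hv => ?_⟩
  by_contra h
  exact hv (h1 (Or.inr (Set.mem_biUnion hx h)))

theorem Adq.exists_ord {S : Set (FP K)} (h : Adq S) (n : FP K → ℤ) (hn : {v | v ∉ S ∧ n v ≠ 0}.Finite) :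
    ∃ κ : Kˣ, ∀ v ∉ S, (ord v κ).toAdd = n v := by
  classical
  choose! k h1 h2 using h.cl
  refine ⟨∏ q ∈ hn.toFinset, k q ^ n q, fun v hv => ?_⟩
  rw [map_prod, toAdd_prod]
  by_cases hv2 : n v = 0
  · rw [hv2]
    apply Finset.sum_eq_zero
    intro q hq
    simp only [Set.Finite.mem_toFinset, Set.mem_ofPred_eq] at hq
    have hne : v ≠ q := by rintro rfl; exact hq.2 hv2
    rw [map_zpow, h2 q hq.1 v hv hne]; simp
  · rw [Finset.sum_eq_single v]
    · rw [map_zpow, toAdd_zpow, h1 v hv]; simp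
    · intro q hq hqv
      simp only [Set.Finite.mem_toFinset, Set.mem_ofPred_eq] at hq
      rw [map_zpow, h2 q hq.1 v hv hqv.symm]; simp
    · intro hmem
      exact absurd (by simpa using ⟨hv, hv2⟩) hmem

/-- places of S, together with the real ones -/
def Sg (S : Set (FP K)) : Set (Pl K) := Sum.inl '' S ∪ Set.range Sum.inr

theorem inl_mem_Sg {S : Set (FP K)} {v : FP K} : (Sum.inl v : Pl K) ∈ Sg S ↔ v ∈ S := by simp [Sg]
theorem inr_mem_Sg {S : Set (FP K)} {s : K →+* ℝ} : (Sum.inr s : Pl K) ∈ Sg S := by simp [Sg]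

theorem emb_finite : Finite (K →+* ℝ) := by
  refine Finite.of_injective (fun s : K →+* ℝ => (Complex.ofRealHom.comp s : K →+* ℂ)) fun s t h => ?_
  ext x
  have := RingHom.congr_fun h x
  simpa using this

theorem Sg_finite {S : Set (FP K)} (h : S.Finite) : (Sg S).Finite := by
  haveI := emb_finite (K := K)
  exact (h.image _).union (Set.finite_range _)

theorem Sg_mono {S T : Set (FP K)} (h : S ⊆ T) : Sg S ⊆ Sg T :=
  Set.union_subset_union_left _ (Set.image_mono h)

theorem US_sq_mem {S : Set (FP K)} {b : Kˣ} (h : b ^ 2 ∈ US S) : b ∈ US S := by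
  rw [mem_US] at h ⊢
  intro v hv
  have := h v hv
  rw [map_pow, ← toAdd_eq_zero, toAdd_pow] at this
  rw [← toAdd_eq_zero]
  simpa using this

end adq

section
variable {K L : Type*} [Field K] [NumberField K] [Field L] [NumberField L] [Algebra K L]
variable {c : Kˣ} (E : QE K L c)
include E

theorem QE.unram (W : FP L) (h2 : abv (.inl (dn K W)) (2 : K) = 1) (hc : ord (dn K W) c = 1) : eR K W = 1 := by
  by_cases h : E.sg W = W
  swap
  · exact (E.ef1 W h).1
  have h2' : abv (.inl W) (2 : L) = 1 := by
    have := abv_io (K := K) W 2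
    rw [h2, one_pow, map_ofNat] at this
    exact this
  have hδ : abv (.inl W) E.δ = 1 := by
    have h1 := E.abv_io2 W h c
    rw [(fabv_eq_one_iff _ _).2 hc, ← E.sq, map_pow] at h1
    exact (pow_left_inj₀ (AbsoluteValue.nonneg _ _) zero_le_one two_ne_zero).1 h1
  obtain ⟨x, hx⟩ := exists_unif W
  obtain ⟨a, b, hab⟩ := E.span x
  have hs := E.sym W h x
  have ha : abv (.inl W) (algebraMap K L a) ≤ abv (.inl W) (x : L) := by
    have e := na_add (fna W) (x : L) (E.σ x)
    rw [hs, max_self, hab] at e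
    simp only [map_add, map_mul, AlgEquiv.commutes, E.σδ] at e
    rw [show algebraMap K L a + algebraMap K L b * E.δ + (algebraMap K L a + algebraMap K L b * -E.δ) = 2 * algebraMap K L a by ring, map_mul, h2', one_mul] at e
    rwa [hab]
  have hb : abv (.inl W) (algebraMap K L b) ≤ abv (.inl W) (x : L) := by
    have e := na_sub (fna W) (x : L) (E.σ x)
    rw [hs, max_self, hab] at e
    simp only [map_add, map_mul, AlgEquiv.commutes, E.σδ] at e
    rw [show algebraMap K L a + algebraMap K L b * E.δ - (algebraMap K L a + algebraMap K L b * -E.δ) = 2 * (algebraMap K L b * E.δ) by ring, map_mul, h2', one_mul, map_mul, hδ, mul_one] at e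
    rwa [hab]
  have hm : abv (.inl W) (x : L) ≤ max (abv (.inl W) (algebraMap K L a)) (abv (.inl W) (algebraMap K L b)) := by
    have e := na_add (fna W) (algebraMap K L a) (algebraMap K L b * E.δ)
    rwa [map_mul, hδ, mul_one, ← hab] at e
  have key : ∀ y : K, abv (.inl W) (algebraMap K L y) = abv (.inl W) (x : L) → eR K W = 1 := by
    intro y hy
    have hy0 : y ≠ 0 := by
      rintro rfl
      rw [map_zero, map_zero] at hy
      have : 0 < abv (.inl W) (x : L) := by simp
      linarith
    have h3 : abv (.inl W) ((x⁻¹ * io K L (Units.mk0 y hy0) : Lˣ) : L) = 1 := by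
      have e : ((x⁻¹ * io K L (Units.mk0 y hy0) : Lˣ) : L) = (x : L)⁻¹ * algebraMap K L y := by simp
      rw [e, map_mul, hy, map_inv₀]
      exact inv_mul_cancel₀ (by simp)
    rw [fabv_eq_one_iff, ← toAdd_eq_zero, map_mul, toAdd_mul, map_inv, toAdd_inv, hx, ord_io] at h3
    have h4 : (eR K W : ℤ) * (ord (dn K W) (Units.mk0 y hy0)).toAdd = 1 := by linarith
    have := Int.eq_one_or_neg_one_of_mul_eq_one h4
    omega
  rcases le_max_iff.1 hm with h3 | h3
  · exact key a (le_antisymm ha h3)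
  · exact key b (le_antisymm hb h3)

variable {S : Set (FP K)}

omit E in
theorem io_US {a : Kˣ} (ha : a ∈ US S) : io K L a ∈ US (dn K (L := L) ⁻¹' S) := by
  rw [mem_US] at ha ⊢
  intro W hW
  rw [← toAdd_eq_zero, ord_io, ha _ hW]; simp

theorem QE.ord_N (W : FP L) (b : Lˣ) : eR K W * (ord (dn K W) (E.N b)).toAdd = (ord W b).toAdd + (ord (E.sg W) b).toAdd := by
  rw [← ord_io, E.io_N, map_mul, toAdd_mul, E.sg_ord]

theorem QE.sg_mem (W : FP L) : E.sg W ∈ (dn K (L := L) ⁻¹' S) ↔ W ∈ (dn K (L := L) ⁻¹' S) := by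
  simp only [Set.mem_preimage, E.dn_sg]

theorem QE.N_US {b : Lˣ} (hb : b ∈ US (dn K (L := L) ⁻¹' S)) : E.N b ∈ US S := by
  rw [mem_US] at hb ⊢
  intro w hw
  obtain ⟨W, rfl⟩ := exists_up L w
  have h1 := hb W hw
  have h2 := hb (E.sg W) (fun h => hw ((E.sg_mem W).1 h))
  have h3 := E.ord_N W b
  rw [h1, h2] at h3
  have h4 := eR_pos (K := K) W
  rw [← toAdd_eq_zero]
  rcases mul_eq_zero.1 (h3.trans (by simp)) with h5 | h5
  · omega
  · exact h5

theorem QE.G1_h3 (hS : Adq S) (hc : c ∈ US S) {b : Lˣ} (hb : b ∈ US (dn K (L := L) ⁻¹' S))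
    {y : Kˣ} (hy : y ∈ US S) (hN : E.N b = y ^ 2) :
    ∃ a ∈ US S, ∃ t ∈ US (dn K (L := L) ⁻¹' S), b = io K L a * t ^ 2 := by
  have hN1 : E.N (b * (io K L y)⁻¹) = 1 := by
    rw [map_mul, map_inv, E.N_io, hN, mul_inv_cancel]
  obtain ⟨z, hz⟩ := E.h90 hN1
  have hbU : b * (io K L y)⁻¹ ∈ US (dn K (L := L) ⁻¹' S) := mul_mem hb (inv_mem (io_US hy))
  have hzs : ∀ W, dn K W ∉ S → ord W z = ord (E.sg W) z := by
    intro W hW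
    have := mem_US.1 hbU W hW
    rw [hz, map_mul, map_inv, mul_inv_eq_one] at this
    rw [this, E.sg_ord]
  choose up hup using exists_up (K := K) L
  obtain ⟨κ, hκ⟩ := hS.exists_ord (fun w => (ord (up w) z).toAdd) (by
    have h1 : (up ⁻¹' {W : FP L | ord W z ≠ 1}).Finite := (ord_finite z).preimage (by
      intro w _ w' _ h
      rw [← hup w, ← hup w', h])
    refine h1.subset ?_
    rintro w ⟨_, h2⟩ h3
    exact h2 (by simpa using h3))
  set t := z * (io K L κ)⁻¹ with ht
  have htU : t ∈ US (dn K (L := L) ⁻¹' S) := by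
    rw [mem_US]
    intro W hW
    have hW' : dn K W ∉ S := hW
    rw [ht, map_mul, map_inv, mul_inv_eq_one]
    apply Multiplicative.toAdd.injective
    have hun := E.unram W (hS.dy _ hW) (mem_US.1 hc _ hW)
    rw [ord_io, hun, Nat.cast_one, one_mul, hκ _ hW]
    rcases E.fiber (hup (dn K W)) with h | h
    · rw [← h]
    · have e := hzs W hW'
      have h' : E.sg W = up (dn K W) := by rw [h, E.dn_sg, hup, E.sgsg]
      rw [e, h']
  refine ⟨y * (E.N t)⁻¹, mul_mem hy (inv_mem (E.N_US htU)), t, htU, ?_⟩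
  rw [map_mul, map_inv, E.io_N]
  have e1 : t * (E.τ t)⁻¹ = z * (E.τ z)⁻¹ := by
    rw [ht, map_mul, map_inv, E.τ_io]
    rw [mul_inv, inv_inv]
    calc _ = z * (E.τ z)⁻¹ * ((io K L κ)⁻¹ * io K L κ) := by simp only [mul_assoc, mul_comm, mul_left_comm]
      _ = _ := by simp
  have hz' : b = io K L y * (t * (E.τ t)⁻¹) := by
    rw [e1, ← hz]; rw [mul_comm b, mul_inv_cancel_left]
  rw [hz', mul_inv, pow_two]
  calc _ = io K L y * (t * (E.τ t)⁻¹) * (t⁻¹ * t) := by simp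
    _ = _ := by simp only [mul_assoc, mul_comm, mul_left_comm]

theorem QE.G1 (hS : Adq S) (hSL : (dn K (L := L) ⁻¹' S).Finite) (hc : c ∈ US S) :
    ((US (dn K (L := L) ⁻¹' S)).map E.N).relIndex (US S) *
      2 ^ ((dn K (L := L) ⁻¹' S).ncard + Fintype.card (InfinitePlace L)) * 2 =
      (2 ^ (S.ncard + Fintype.card (InfinitePlace K))) ^ 2 := by
  set A := US S
  set B := US (dn K (L := L) ⁻¹' S)
  let i : A →* B := ((io K L).comp A.subtype).codRestrict B fun a => io_US a.2
  let N : B →* A := (E.N.comp B.subtype).codRestrict A fun a => E.N_US a.2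
  have hA := US_sq S hS.fin
  have hB := US_sq (dn K (L := L) ⁻¹' S) hSL
  set QA := (sqs A).subgroupOf A
  set QB := (sqs B).subgroupOf B
  have hA' : QA.index = _ := hA
  have hB' : QB.index = _ := hB
  haveI : QA.FiniteIndex := ⟨by rw [hA']; positivity⟩
  haveI : QB.FiniteIndex := ⟨by rw [hB']; positivity⟩
  have hNio : ∀ a : A, N (i a) = a ^ 2 := fun a => Subtype.ext (E.N_io a)
  have h1 : ∀ a : A, N (i a) ∈ QA := fun a => by
    rw [hNio, Subgroup.mem_subgroupOf]; exact ⟨a, a.2, rfl⟩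
  have h4 : QA ≤ QB.comap i := by
    rintro ⟨a, ha⟩ h
    rw [Subgroup.mem_subgroupOf] at h
    obtain ⟨y, hy, hya⟩ := mem_sqs.1 h
    rw [Subgroup.mem_comap, Subgroup.mem_subgroupOf]
    refine mem_sqs.2 ⟨io K L y, io_US hy, ?_⟩
    rw [← map_pow, hya]; rfl
  have key := index_lemma i N QA QB h1 (by
      rintro ⟨b, hb⟩ h
      rw [Subgroup.mem_subgroupOf] at h ⊢
      obtain ⟨y, hy, hyb⟩ := mem_sqs.1 h
      refine mem_sqs.2 ⟨E.N y, E.N_US hy, ?_⟩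
      rw [← map_pow, hyb]; rfl) (by
      rintro ⟨b, hb⟩ h
      rw [Subgroup.mem_subgroupOf] at h
      obtain ⟨y, hy, hyb⟩ := mem_sqs.1 h
      obtain ⟨a, ha, t, ht, e⟩ := E.G1_h3 hS hc hb hy hyb.symm
      refine ⟨⟨a, ha⟩, ⟨t ^ 2, pow_mem ht 2⟩, ?_, Subtype.ext e⟩
      rw [Subgroup.mem_subgroupOf]
      exact mem_sqs.2 ⟨t, ht, rfl⟩) h4 (by
      rw [Subgroup.relIndex_eq_two_iff]
      refine ⟨⟨c, hc⟩, ?_, ?_⟩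
      · rw [Subgroup.mem_comap, Subgroup.mem_subgroupOf]
        refine mem_sqs.2 ⟨E.d, ?_, E.d_sq⟩
        apply US_sq_mem
        rw [E.d_sq]; exact io_US hc
      · rintro ⟨b, hb⟩ h
        rw [Subgroup.mem_comap, Subgroup.mem_subgroupOf] at h
        obtain ⟨y, hy, hyb⟩ := mem_sqs.1 h
        replace hyb : y ^ 2 = io K L b := hyb
        have hcc : ¬ (b * c ∈ sqs A ∧ b ∈ sqs A) := by
          rintro ⟨h5, h6⟩
          obtain ⟨y1, -, h5⟩ := mem_sqs.1 h5
          obtain ⟨y2, -, h6⟩ := mem_sqs.1 h6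
          apply E.c_nsq (y1 * y2⁻¹)
          rw [mul_pow, inv_pow, h5, h6, mul_comm b, mul_inv_cancel_right]
        have hor : b * c ∈ sqs A ∨ b ∈ sqs A := by
          rcases E.sq_K hyb with ⟨b', h5, -⟩ | ⟨b', h5, -⟩
          · right
            refine mem_sqs.2 ⟨b', ?_, h5.symm⟩
            apply US_sq_mem; rw [← h5]; exact hb
          · left
            refine mem_sqs.2 ⟨c * b', mul_mem hc ?_, ?_⟩
            · apply US_sq_mem
              have : b' ^ 2 = c⁻¹ * b := by rw [h5, inv_mul_cancel_left]
              rw [this]; exact mul_mem (inv_mem hc) hb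
            · rw [h5, mul_pow, pow_two c, mul_assoc, mul_comm]
        rw [Subgroup.mem_subgroupOf, Subgroup.mem_subgroupOf]
        change Xor' (b * c ∈ sqs A) (b ∈ sqs A)
        unfold Xor'
        tauto)
  rw [hA', hB'] at key
  have e : N.range ⊔ QA = (B.map E.N).subgroupOf A := by
    have h5 : QA ≤ N.range := by
      rintro ⟨a, ha⟩ h
      rw [Subgroup.mem_subgroupOf] at h
      obtain ⟨y, hy, hya⟩ := mem_sqs.1 h
      refine ⟨i ⟨y, hy⟩, ?_⟩
      rw [hNio]
      exact Subtype.ext hya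
    rw [sup_eq_left.2 h5]
    ext ⟨a, ha⟩
    rw [Subgroup.mem_subgroupOf]
    constructor
    · rintro ⟨⟨b, hb⟩, h⟩
      exact ⟨b, hb, congrArg Subtype.val h⟩
    · rintro ⟨b, hb, h⟩
      exact ⟨⟨b, hb⟩, Subtype.ext h⟩
  rw [e] at key
  exact key

end
end QF


namespace QF
open NumberField IsDedekindDomain HeightOneSpectrum

theorem ncard_fib {α β : Type*} (f : α → β) (S : Finset β) (hf : ∀ b, (f ⁻¹' {b}).Finite) :
    (f ⁻¹' (S : Set β)).Finite ∧ (f ⁻¹' (S : Set β)).ncard = ∑ b ∈ S, (f ⁻¹' {b}).ncard := by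
  classical
  induction S using Finset.induction_on with
  | empty => simp
  | insert b S hb ih =>
    have e : f ⁻¹' ((insert b S : Finset β) : Set β) = f ⁻¹' {b} ∪ f ⁻¹' (S : Set β) := by
      ext x; simp
    have hd : Disjoint (f ⁻¹' {b}) (f ⁻¹' (S : Set β)) := by
      rw [Set.disjoint_left]
      intro x hx hx2
      simp only [Set.mem_preimage, Set.mem_singleton_iff, Finset.mem_coe] at hx hx2
      exact hb (hx ▸ hx2)
    rw [e, Set.ncard_union_eq hd (hf b) ih.1, Finset.sum_insert hb, ih.2]
    exact ⟨(hf b).union ih.1, rfl⟩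

open Classical in
theorem sum_two {β : Type*} (S : Finset β) (Q : β → Prop) (k : ℕ) (f : β → ℕ) 
    (h1 : ∀ b ∈ S, Q b → f b = 2) (h2 : ∀ b ∈ S, ¬ Q b → f b = k) :
    ∑ b ∈ S, f b = 2 * (S.filter Q).card + k * (S.filter fun b => ¬ Q b).card := by
  rw [← Finset.sum_filter_add_sum_filter_not S Q, Finset.sum_congr rfl (g := fun _ => 2),
    Finset.sum_congr (s₁ := S.filter fun b => ¬ Q b) rfl (g := fun _ => k)]
  · simp [mul_comm]
  · intro b hb; rw [Finset.mem_filter] at hb; exact h2 b hb.1 hb.2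
  · intro b hb; rw [Finset.mem_filter] at hb; exact h1 b hb.1 hb.2

theorem card_emb (K : Type*) [Field K] [NumberField K] : Nat.card (K →+* ℝ) = InfinitePlace.nrRealPlaces K := by
  classical
  rw [← InfinitePlace.card_real_embeddings, ← Nat.card_eq_fintype_card]
  refine (Nat.card_congr (Equiv.ofBijective (fun φ : { φ : K →+* ℂ // ComplexEmbedding.IsReal φ} => ComplexEmbedding.IsReal.embedding φ.2) ⟨?_, ?_⟩)).symm
  · rintro ⟨φ, hφ⟩ ⟨ψ, hψ⟩ h
    apply Subtype.ext
    ext x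
    have h1 := ComplexEmbedding.IsReal.coe_embedding_apply hφ x
    have h2 := ComplexEmbedding.IsReal.coe_embedding_apply hψ x
    have h3 : hφ.embedding = hψ.embedding := h
    change φ x = ψ x
    rw [← h1, ← h2, h3]
  · intro s
    have hr : ComplexEmbedding.IsReal (Complex.ofRealHom.comp s : K →+* ℂ) := by
      rw [ComplexEmbedding.isReal_iff]
      ext x
      simp
    refine ⟨⟨_, hr⟩, ?_⟩
    ext x
    have h1 := ComplexEmbedding.IsReal.coe_embedding_apply hr x
    apply Complex.ofReal_injective
    exact h1

section
variable {K L : Type*} [Field K] [NumberField K] [Field L] [NumberField L] [Algebra K L]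
variable {c : Kˣ} (E : QE K L c)
include E

theorem QE.fib_eq (W : FP L) : dn K (L := L) ⁻¹' {dn K W} = {W, E.sg W} := by
  ext W'
  simp only [Set.mem_preimage, Set.mem_singleton_iff, Set.mem_insert_iff]
  constructor
  · intro h; exact E.fiber h.symm
  · rintro (rfl | rfl)
    · rfl
    · exact E.dn_sg W

theorem QE.fib_fin (w : FP K) : (dn K (L := L) ⁻¹' {w}).Finite := by
  obtain ⟨W, rfl⟩ := exists_up L w
  rw [E.fib_eq]; exact Set.toFinite _

theorem QE.SL_fin {S : Set (FP K)} (h : S.Finite) : (dn K (L := L) ⁻¹' S).Finite := by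
  have := (ncard_fib (dn K (L := L)) h.toFinset E.fib_fin).1
  rwa [h.coe_toFinset] at this

/-- restriction of real embeddings -/
abbrev rs (K : Type*) {L : Type*} [Field K] [Field L] [Algebra K L] (t : L →+* ℝ) : K →+* ℝ := t.comp (algebraMap K L)

omit E in
theorem rs_fin (s : K →+* ℝ) : (rs K (L := L) ⁻¹' {s}).Finite := by
  haveI := emb_finite (K := L)
  exact Set.toFinite _

theorem QE.rs_neg (s : K →+* ℝ) (h : c ∉ P (.inr s)) : (rs K (L := L) ⁻¹' {s}) = ∅ := by
  rw [Set.eq_empty_iff_forall_notMem]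
  intro t ht
  apply h
  refine (mem_locSq_real s c).2 ?_
  have ht' : rs K t = s := ht
  have : s c = t E.δ ^ 2 := by
    rw [← ht', ← map_pow, E.sq]; rfl
  rw [this]
  have h0 : t E.δ ≠ 0 := by simpa using E.δ0
  positivity

theorem QE.rs_ex (s : K →+* ℝ) (h : c ∈ P (.inr s)) : ∃ t : L →+* ℝ, rs K t = s := by
  have hs : 0 < s c := (mem_locSq_real s c).1 h
  letI : Algebra K ℂ := (Complex.ofRealHom.comp s).toAlgebra
  haveI : Module.Finite K L := Module.finite_of_finrank_pos (by rw [E.fr]; norm_num)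
  let φ : L →ₐ[K] ℂ := IsAlgClosed.lift
  have hφ : ∀ a : K, φ (algebraMap K L a) = (s a : ℂ) := fun a => φ.commutes a
  have hδ : φ E.δ ^ 2 = (s c : ℂ) := by rw [← map_pow, E.sq, hφ]
  have hδr : starRingEnd ℂ (φ E.δ) = φ E.δ := by
    have e : (φ E.δ - (Real.sqrt (s c) : ℂ)) * (φ E.δ + (Real.sqrt (s c) : ℂ)) = 0 := by
      have : ((Real.sqrt (s c) : ℂ)) ^ 2 = s c := by
        rw [← Complex.ofReal_pow, Real.sq_sqrt hs.le]
      linear_combination hδ - this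
    rcases mul_eq_zero.1 e with e | e
    · rw [sub_eq_zero.1 e, Complex.conj_ofReal]
    · rw [eq_neg_of_add_eq_zero_left e, map_neg, Complex.conj_ofReal]
  have hr : ComplexEmbedding.IsReal (φ : L →+* ℂ) := by
    rw [ComplexEmbedding.isReal_iff]
    ext x
    obtain ⟨a, b, rfl⟩ := E.span x
    rw [ComplexEmbedding.conjugate_coe_eq]
    simp only [RingHom.coe_coe, map_add, map_mul, hφ, hδr, Complex.conj_ofReal]
  refine ⟨hr.embedding, ?_⟩
  ext a
  apply Complex.ofReal_injective
  have := hr.coe_embedding_apply (algebraMap K L a)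
  refine this.trans (hφ a)

theorem QE.rs_pos (s : K →+* ℝ) (h : c ∈ P (.inr s)) : (rs K (L := L) ⁻¹' {s}).ncard = 2 := by
  obtain ⟨t, rfl⟩ := E.rs_ex s h
  have ht0 : t E.δ ≠ 0 := by simpa using E.δ0
  have hne : t ≠ t.comp (E.σ : L →+* L) := by
    intro h
    have := RingHom.congr_fun h E.δ
    simp only [RingHom.comp_apply, RingHom.coe_coe, E.σδ, map_neg] at this
    apply ht0; linarith
  have : (rs K (L := L) ⁻¹' {rs K t}) = {t, t.comp (E.σ : L →+* L)} := by
    ext t'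
    simp only [Set.mem_preimage, Set.mem_singleton_iff, Set.mem_insert_iff]
    constructor
    · intro h
      have hK : ∀ a : K, t' (algebraMap K L a) = t (algebraMap K L a) := fun a => RingHom.congr_fun h a
      have h2 : (t' E.δ - t E.δ) * (t' E.δ + t E.δ) = 0 := by
        have h3 : t' E.δ ^ 2 = t E.δ ^ 2 := by rw [← map_pow, ← map_pow, E.sq, hK]
        linear_combination h3
      rcases mul_eq_zero.1 h2 with h2 | h2
      · left
        ext x
        obtain ⟨a, b, rfl⟩ := E.span x
        simp only [map_add, map_mul, hK, sub_eq_zero.1 h2]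
      · right
        ext x
        obtain ⟨a, b, rfl⟩ := E.span x
        simp only [RingHom.comp_apply, RingHom.coe_coe, map_add, map_mul, hK, E.σδ, map_neg, AlgEquiv.commutes,
          eq_neg_of_add_eq_zero_left h2]
    · rintro (rfl | rfl)
      · rfl
      · ext a; simp
  rw [this, Set.ncard_pair hne]

omit E in
theorem card_inf (K : Type*) [Field K] [NumberField K] :
    2 * Fintype.card (InfinitePlace K) = Module.finrank ℚ K + Nat.card (K →+* ℝ) := by
  rw [card_emb, InfinitePlace.card_eq_nrRealPlaces_add_nrComplexPlaces, ← InfinitePlace.card_add_two_mul_card_eq_rank]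
  ring

theorem QE.card_inf : Fintype.card (InfinitePlace L) + {s : K →+* ℝ | c ∉ P (.inr s)}.ncard =
    2 * Fintype.card (InfinitePlace K) := by
  classical
  haveI := emb_finite (K := K)
  haveI := Fintype.ofFinite (K →+* ℝ)
  have h1 := QF.card_inf K
  have h2 := QF.card_inf L
  have h3 : Module.finrank ℚ L = Module.finrank ℚ K * 2 := by
    rw [← E.fr, Module.finrank_mul_finrank]
  have h4 := (ncard_fib (rs K (L := L)) Finset.univ rs_fin).2
  rw [sum_two Finset.univ (fun s => c ∈ P (.inr s)) 0 _ (fun b _ hb => E.rs_pos b hb) (fun b _ hb => by rw [E.rs_neg b hb]; simp)] at h4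
  rw [Finset.coe_univ, Set.preimage_univ, Set.ncard_univ] at h4
  have h5 : {s : K →+* ℝ | c ∉ P (.inr s)}.ncard = (Finset.univ.filter fun s : K →+* ℝ => ¬ c ∈ P (.inr s)).card := by
    rw [← Set.ncard_coe_finset]; congr 1; ext; simp
  have h6 := Finset.card_filter_add_card_filter_not (s := (Finset.univ : Finset (K →+* ℝ))) (fun s => c ∈ P (.inr s))
  rw [Finset.card_univ, ← Nat.card_eq_fintype_card] at h6
  omega

theorem QE.card_fin {S : Set (FP K)} (hS : S.Finite) : (dn K (L := L) ⁻¹' S).ncard + {v ∈ S | c ∉ P (.inl v)}.ncard =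
    2 * S.ncard := by
  classical
  have h4 := (ncard_fib (dn K (L := L)) hS.toFinset E.fib_fin).2
  rw [sum_two hS.toFinset (fun s => c ∈ P (.inl s)) 1 _ (fun b _ hb => by
    obtain ⟨W, rfl⟩ := exists_up L b
    rw [E.fib_eq, Set.ncard_pair ((E.split_iff W).1 hb).symm]) (fun b _ hb => by 
    obtain ⟨W, rfl⟩ := exists_up L b
    have : E.sg W = W := by_contra fun h => hb ((E.split_iff W).2 h)
    rw [E.fib_eq, this]; simp)] at h4
  rw [hS.coe_toFinset] at h4
  have h5 : {v ∈ S | c ∉ P (.inl v)}.ncard = (hS.toFinset.filter fun s => ¬ c ∈ P (.inl s)).card := by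
    rw [← Set.ncard_coe_finset]; congr 1; ext; simp
  have h6 := Finset.card_filter_add_card_filter_not (s := hS.toFinset) (fun s => c ∈ P (.inl s))
  rw [← Set.ncard_eq_toFinset_card S hS] at h6
  omega

end

section
variable {K : Type*} [Field K] [NumberField K]

/-- size parameter -/
noncomputable def sz (S : Set (FP K)) : ℕ := S.ncard + Fintype.card (InfinitePlace K)

/-- non-split places in S -/
def Sn (S : Set (FP K)) (c : Kˣ) : Set (Pl K) := {w ∈ Sg S | c ∉ P w}

theorem Sn_fin {S : Set (FP K)} (hS : S.Finite) (c : Kˣ) : (Sn S c).Finite := (Sg_finite hS).subset fun _ h => h.1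

theorem Sn_card {S : Set (FP K)} (hS : S.Finite) (c : Kˣ) : (Sn S c).ncard = {v ∈ S | c ∉ P (.inl v)}.ncard + {s : K →+* ℝ | c ∉ P (.inr s)}.ncard := by
  haveI := emb_finite (K := K)
  have e : Sn S c = Sum.inl '' {v ∈ S | c ∉ P (.inl v)} ∪ Sum.inr '' {s : K →+* ℝ | c ∉ P (.inr s)} := by
    ext (w | w) <;> simp [Sn, Sg]
  rw [e, Set.ncard_union_eq ?_ ((hS.subset fun _ h => h.1).image _) (Set.toFinite _), Set.ncard_image_of_injective _ Sum.inl_injective, Set.ncard_image_of_injective _ Sum.inr_injective]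
  · rw [Set.disjoint_left]
    rintro _ ⟨a, -, rfl⟩ ⟨b, -, h⟩
    exact Sum.inr_ne_inl h

theorem QE.G1' {L : Type*} [Field L] [NumberField L] [Algebra K L] {c : Kˣ} (E : QE K L c) {S : Set (FP K)}
    (hS : Adq S) (hc : c ∈ US S) :
    ((US (dn K (L := L) ⁻¹' S)).map E.N).relIndex (US S) * 2 = 2 ^ (Sn S c).ncard := by
  have h1 := E.G1 hS (E.SL_fin hS.fin) hc
  have h2 := E.card_inf
  have h3 := E.card_fin hS.fin
  have h4 := Sn_card hS.fin c
  set a := (dn K (L := L) ⁻¹' S).ncard + Fintype.card (InfinitePlace L) with ha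
  set b := S.ncard + Fintype.card (InfinitePlace K) with hb
  have h5 : a + (Sn S c).ncard = 2 * b := by omega
  rw [← pow_mul, mul_comm b, ← h5, pow_add 2 a] at h1
  have h6 : 0 < 2 ^ a := by positivity
  apply Nat.eq_of_mul_eq_mul_left h6
  linarith

end
end QF


namespace QF
open NumberField IsDedekindDomain HeightOneSpectrum

section
variable {K : Type*} [Field K] [NumberField K]

/-- intersection of local conditions -/
def IX (X : Set (Pl K)) (H : Pl K → Subgroup Kˣ) : Subgroup Kˣ := ⨅ w ∈ X, H w

theorem mem_IX {X : Set (Pl K)} {H : Pl K → Subgroup Kˣ} {x : Kˣ} : x ∈ IX X H ↔ ∀ w ∈ X, x ∈ H w := by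
  simp [IX, Subgroup.mem_iInf]

theorem IX_insert (X : Set (Pl K)) (a : Pl K) (H : Pl K → Subgroup Kˣ) : IX (insert a X) H = H a ⊓ IX X H := by
  ext x; simp [mem_IX, Subgroup.mem_inf]

theorem IX_sup {X : Set (Pl K)} (hX : X.Finite) {a : Pl K} (ha : a ∉ X) {H : Pl K → Subgroup Kˣ}
    (hH : ∀ w, P w ≤ H w) : IX X H ⊔ H a = ⊤ := by
  classical
  rw [eq_top_iff]
  intro x _
  obtain ⟨y, hy⟩ := wa_sq (insert a X) (hX.insert a) (fun w => if w = a then x else 1)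
  have h1 : x⁻¹ * y ∈ P a := by simpa using hy a (by simp)
  have h2 : y ∈ IX X H := mem_IX.2 fun w hw => hH w (by
    have := hy w (by simp [hw])
    rw [if_neg (by rintro rfl; exact ha hw)] at this
    simpa using this)
  have e : x = y * (x⁻¹ * y)⁻¹ := by simp
  rw [e]
  exact mul_mem (Subgroup.mem_sup_left h2) (Subgroup.mem_sup_right (inv_mem (hH a h1)))

theorem IX_index (X : Finset (Pl K)) {H : Pl K → Subgroup Kˣ}
    (hH : ∀ w, P w ≤ H w) : (IX (X : Set (Pl K)) H).index = ∏ w ∈ X, (H w).index := by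
  classical
  induction X using Finset.induction_on with
  | empty => simp [IX]
  | insert a X ha ih =>
    rw [Finset.coe_insert, IX_insert, Finset.prod_insert ha, ← ih,
      ← Subgroup.relIndex_mul_index (inf_le_right : H a ⊓ IX (X : Set (Pl K)) H ≤ _), Subgroup.inf_relIndex_right]
    congr 1
    have := Subgroup.relIndex_sup_right (IX (X : Set (Pl K)) H) (H a)
    rw [IX_sup X.finite_toSet (by simpa using ha) hH, Subgroup.relIndex_top_right] at this
    exact this.symm

/-- elements that are local norms at all places of S -/
noncomputable def NS (S : Set (FP K)) (c : Kˣ) : Subgroup Kˣ := IX (Sg S) (fun w => Nw w c)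

theorem mem_NS {S : Set (FP K)} {c x : Kˣ} : x ∈ NS S c ↔ ∀ w ∈ Sg S, x ∈ Nw w c := mem_IX

theorem NS_index {S : Set (FP K)} (hS : S.Finite) (c : Kˣ) : (NS S c).index = 2 ^ (Sn S c).ncard := by
  classical
  have hf := Sg_finite hS
  have h1 : ((Sn_fin hS c).toFinset) ⊆ hf.toFinset := by
    intro w hw
    simp only [Set.Finite.mem_toFinset] at hw ⊢
    exact hw.1
  have := IX_index hf.toFinset (fun w => P_le_Nw w c)
  rw [hf.coe_toFinset] at this
  rw [NS, this, ← Finset.prod_subset h1, Set.ncard_eq_toFinset_card _ (Sn_fin hS c)]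
  · apply Finset.prod_eq_pow_card
    intro w hw
    simp only [Set.Finite.mem_toFinset] at hw
    exact Nw_index w hw.2
  · intro w hw hw2
    simp only [Set.Finite.mem_toFinset] at hw hw2
    rw [Nw_top, Subgroup.index_top]
    by_contra h
    exact hw2 ⟨hw, h⟩

theorem NS_ext {S T : Set (FP K)} {c : Kˣ} (hST : S ⊆ T) (h : ∀ v ∈ T, v ∉ S → c ∈ P (.inl v)) : NS T c = NS S c := by
  ext x
  rw [mem_NS, mem_NS]
  constructor
  · exact fun hx w hw => hx w (Sg_mono hST hw)
  · intro hx w hw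
    by_cases hw2 : w ∈ Sg S
    · exact hx w hw2
    · rcases w with v | s
      · rw [Nw_top]
        · trivial
        · exact h v (inl_mem_Sg.1 hw) (fun h => hw2 (inl_mem_Sg.2 h))
      · exact absurd inr_mem_Sg hw2

theorem sq_mem_P (w : Pl K) (x : Kˣ) : x ^ 2 ∈ P w := sq_mem_locSq _ _

theorem sq_mem_Nw (w : Pl K) (c x : Kˣ) : x ^ 2 ∈ Nw w c := P_le_Nw w c (sq_mem_P w x)

theorem QE.map_le {L : Type*} [Field L] [NumberField L] [Algebra K L] {c : Kˣ} (E : QE K L c) (S : Set (FP K)) :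
    (US (dn K (L := L) ⁻¹' S)).map E.N ≤ NS S c ⊓ US S := by
  rintro _ ⟨b, hb, rfl⟩
  refine ⟨mem_NS.2 fun w _ => nrm_le_locN _ c ?_, E.N_US hb⟩
  rw [← E.range_N]
  exact ⟨b, rfl⟩

theorem F1 {S : Set (FP K)} {c : Kˣ} (hc : ¬ IsSquare (c : K)) (hS : Adq S) (hcS : c ∈ US S) :
    US S ⊔ NS S c ≠ ⊤ := by
  intro h
  obtain ⟨L, _, _, _, ⟨E⟩⟩ := exists_QE c hc
  have h1 := E.G1' hS hcS
  have h2 : (NS S c).relIndex (US S) = 2 ^ (Sn S c).ncard := by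
    rw [← Subgroup.relIndex_sup_right, h, Subgroup.relIndex_top_right, NS_index hS.fin]
  have h3 : (NS S c).relIndex (US S) ∣ ((US (dn K (L := L) ⁻¹' S)).map E.N).relIndex (US S) :=
    Subgroup.relIndex_dvd_of_le_left _ ((E.map_le S).trans inf_le_left)
  rw [h2] at h3
  have h4 : 0 < 2 ^ (Sn S c).ncard := by positivity
  have := Nat.le_of_dvd (by omega) h3
  omega

theorem odd_unit {v : FP K} (h2 : abv (.inl v) (2 : K) = 1) {c : Kˣ} (hc : ord v c = 1) (hcP : c ∉ P (.inl v)) {e : Kˣ} :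
    e ∈ Nw (.inl v) c ↔ Even (ord v e).toAdd := by
  have hns : ¬ IsSquare (c : K) := by
    rintro ⟨y, hy⟩
    have hy0 : y ≠ 0 := by rintro rfl; simp at hy
    apply hcP
    have : c = (Units.mk0 y hy0) ^ 2 := by ext; simp [hy, pow_two]
    rw [this]; exact sq_mem_P _ _
  obtain ⟨L, _, _, _, ⟨E⟩⟩ := exists_QE c hns
  obtain ⟨W, rfl⟩ := exists_up L v
  have hsg : E.sg W = W := by
    by_contra h
    exact hcP ((E.split_iff W).2 h)
  have hn : ∀ e ∈ nrm c, Even (ord (dn K W) e).toAdd := by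
    intro e he
    rw [← E.range_N] at he
    obtain ⟨b, rfl⟩ := he
    have := E.ord_N W b
    rw [E.unram W h2 hc, hsg] at this
    exact ⟨(ord W b).toAdd, by simpa using this⟩
  have hN : ∀ e ∈ Nw (.inl (dn K W)) c, Even (ord (dn K W) e).toAdd := by
    intro e he
    obtain ⟨p, hp, n, hn', rfl⟩ := mem_locN_iff.1 he
    rw [map_mul, toAdd_mul]
    exact (ord_even_of_P _ hp).add (hn n hn')
  refine ⟨hN e, fun he => ?_⟩
  by_contra h
  obtain ⟨π, hπ⟩ := exists_unif (dn K W)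
  have h1 : π ∉ Nw (.inl (dn K W)) c := fun h => by
    have := hN _ h
    rw [hπ] at this
    exact absurd this (by decide)
  have h3 := hN _ (Nw_mul_iff h h1)
  rw [map_mul, toAdd_mul, hπ] at h3
  rw [Int.even_add] at h3
  exact absurd (h3.1 he) (by decide)

theorem odd_even {v : FP K} (h2 : abv (.inl v) (2 : K) = 1) {c e : Kˣ} (hc : Even (ord v c).toAdd)
    (he : Even (ord v e).toAdd) : e ∈ Nw (.inl v) c := by
  by_cases hcP : c ∈ P (.inl v)
  · rw [Nw_top hcP]; trivial
  obtain ⟨y, hy⟩ := exists_unit_of_even v hc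
  have := locN_mul (hens (.inl v)) c (sq_mem_P (.inl v) y)
  change e ∈ locN _ c
  rw [← this]
  refine (odd_unit h2 hy fun h => hcP ?_).2 he
  have := mul_mem h (inv_mem (sq_mem_P (.inl v) y))
  simpa using this

/-- norms locally outside S -/
noncomputable def MS (S : Set (FP K)) (c : Kˣ) : Subgroup Kˣ := ⨅ v ∈ Sᶜ, Nw (.inl v) c

theorem mem_MS {S : Set (FP K)} {c x : Kˣ} : x ∈ MS S c ↔ ∀ v ∉ S, x ∈ Nw (.inl v) c := by
  simp [MS, Subgroup.mem_iInf]

theorem MS_adj {S : Set (FP K)} {c : Kˣ} (hS : Adq S) (hcS : c ∈ US S) {e : Kˣ} (he : e ∈ MS S c) :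
    ∃ (κ : Kˣ) (F : Set (FP K)), F.Finite ∧ (∀ v ∈ F, c ∈ P (.inl v)) ∧ e * κ ^ 2 ∈ US (S ∪ F) := by
  classical
  obtain ⟨κ, hκ⟩ := hS.exists_ord (fun v => if c ∈ P (.inl v) then 0 else -((ord v e).toAdd / 2)) (by
    apply (ord_finite e).subset
    rintro v ⟨-, hv⟩ h
    apply hv
    simp [h])
  refine ⟨κ, {v | ord v (e * κ ^ 2) ≠ 1 ∧ c ∈ P (.inl v)}, (ord_finite _).subset fun v hv => hv.1, fun v hv => hv.2, ?_⟩
  rw [mem_US]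
  intro v hv
  simp only [Set.mem_union, not_or, Set.mem_ofPred_eq, not_and] at hv
  by_contra h
  have hc := hv.2 h
  apply h
  have := hκ v hv.1
  rw [if_neg hc] at this
  have h3 := (odd_unit (hS.dy v hv.1) (mem_US.1 hcS v hv.1) hc).1 (mem_MS.1 he v hv.1)
  apply Multiplicative.toAdd.injective
  rw [map_mul, map_pow, toAdd_mul, toAdd_pow, this, toAdd_one]
  obtain ⟨k, hk⟩ := h3
  simp only [nsmul_eq_mul, Nat.cast_ofNat]
  omega

theorem MS_ne {S : Set (FP K)} {c : Kˣ} (hc : ¬ IsSquare (c : K)) (hS : Adq S) (hcS : c ∈ US S) :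
    MS S c ⊔ NS S c ≠ ⊤ := by
  intro h
  have hfi : (NS S c).index ≠ 0 := by rw [NS_index hS.fin]; positivity
  have : (NS S c).FiniteIndex := ⟨hfi⟩
  have hfin : Finite (Kˣ ⧸ NS S c) := Subgroup.finite_quotient_of_finiteIndex
  have key : ∀ q : Kˣ ⧸ NS S c, ∃ (x : Kˣ) (F : Set (FP K)), F.Finite ∧ (∀ v ∈ F, c ∈ P (.inl v)) ∧ 
      x ∈ US (S ∪ F) ∧ q = (x : Kˣ ⧸ NS S c) := by
    intro q
    induction q using QuotientGroup.induction_on with | _ x => ?_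
    have hx : x ∈ MS S c ⊔ NS S c := by rw [h]; trivial
    obtain ⟨e, he, n, hn, rfl⟩ := Subgroup.mem_sup.1 hx
    obtain ⟨κ, F, hF, hcF, hU⟩ := MS_adj hS hcS he
    refine ⟨e * κ ^ 2, F, hF, hcF, hU, ?_⟩
    rw [QuotientGroup.eq]
    have e1 : (e * n)⁻¹ * (e * κ ^ 2) = n⁻¹ * κ ^ 2 := by group
    rw [e1]
    exact mul_mem (inv_mem hn) (mem_NS.2 fun w _ => sq_mem_Nw w c κ)
  choose x F hF hcF hU hq using key
  set T := S ∪ ⋃ q, F q with hT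
  have hTf : T.Finite := hS.fin.union (Set.finite_iUnion hF)
  have hTa : Adq T := hS.mono Set.subset_union_left hTf
  have hNT : NS T c = NS S c := by
    apply NS_ext Set.subset_union_left
    rintro v (hv | hv) hv2
    · exact absurd hv hv2
    · obtain ⟨q, hq⟩ := Set.mem_iUnion.1 hv
      exact hcF q v hq
  apply F1 hc hTa (US_mono Set.subset_union_left hcS)
  rw [eq_top_iff, hNT]
  intro y _
  have h1 := hq (y : Kˣ ⧸ NS S c)
  rw [eq_comm, QuotientGroup.eq] at h1
  have e1 : y = x (y : Kˣ ⧸ NS S c) * ((x (y : Kˣ ⧸ NS S c))⁻¹ * y) := by group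
  rw [e1]
  refine mul_mem (Subgroup.mem_sup_left (US_mono ?_ (hU _))) (Subgroup.mem_sup_right h1)
  exact Set.union_subset_union_right _ (Set.subset_iUnion F _)

theorem GS {c : Kˣ} (hc : ¬ IsSquare (c : K)) {F : Set (FP K)} (hF : F.Finite) : ∃ v ∉ F, c ∉ P (.inl v) := by
  by_contra! h
  obtain ⟨S, hFS, hS, hcS⟩ := exists_adq_unit hF {c} (Set.finite_singleton c)
  apply MS_ne hc hS (hcS c rfl)
  rw [eq_top_iff]
  intro x _
  apply Subgroup.mem_sup_left
  rw [mem_MS]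
  intro v hv
  rw [Nw_top (h v fun h => hv (hFS h))]
  trivial

end
end QF


namespace QF
open NumberField IsDedekindDomain HeightOneSpectrum

section
variable {K : Type*} [Field K] [NumberField K]

theorem e2_zero {v : FP K} (h : abv (.inl v) (2 : K) = 1) : e2 v = 0 := by
  by_contra h0
  have h1 := abv_two v
  rw [h] at h1
  have h2 : (1 : ℝ) < nv v := by exact_mod_cast absNorm_gt v
  have h3 : nv v ^ (-(e2 v : ℤ)) < 1 := zpow_lt_one_of_neg₀ h2 (by omega)
  linarith

theorem P_relIndex_odd {v : FP K} (h : abv (.inl v) (2 : K) = 1) : (P (.inl v)).relIndex (Un v) = 2 := by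
  rw [P_relIndex_Un, e2_zero h]; simp

theorem prod_dyadic {S : Set (FP K)} (hS : Adq S) :
    ∏ v ∈ hS.fin.toFinset, Ideal.absNorm v.asIdeal ^ e2 v = 2 ^ Module.finrank ℚ K := by
  have h := FinitePlace.prod_eq_inv_abs_norm (K := K) (x := 2) (by norm_num)
  have h1 : ∏ᶠ w : FinitePlace K, w (2 : K) = ∏ᶠ v : FP K, abv (.inl v) (2 : K) := by
    rw [← finprod_comp_equiv (FinitePlace.equivHeightOneSpectrum (K := K)).symm]
    apply finprod_congr
    intro v
    rw [FinitePlace.equivHeightOneSpectrum_symm_apply]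
    exact FinitePlace.norm_embedding v 2
  rw [h1, finprod_eq_prod_of_mulSupport_subset (s := hS.fin.toFinset)] at h
  · have h2 : (Algebra.norm ℚ) (2 : K) = 2 ^ Module.finrank ℚ K := by
      have := Algebra.norm_algebraMap (S := K) (2 : ℚ)
      simpa using this
    rw [h2] at h
    have h3 : ∏ v ∈ hS.fin.toFinset, abv (.inl v) (2 : K) = (∏ v ∈ hS.fin.toFinset, (nv v) ^ e2 v)⁻¹ := by
      rw [← Finset.prod_inv_distrib]
      apply Finset.prod_congr rfl
      intro v _
      rw [abv_two]; simp
    rw [h3] at h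
    have h4 := inv_injective (h.trans (by push_cast; rw [abs_of_pos (by positivity)] : _ = ((2 : ℝ) ^ Module.finrank ℚ K)⁻¹))
    exact_mod_cast h4
  · intro v hv
    simp only [Function.mem_mulSupport] at hv
    simp only [Set.Finite.coe_toFinset]
    by_contra h
    exact hv (hS.dy v h)

theorem PS_index {S : Set (FP K)} (hS : Adq S) : (IX (Sg S) P).index = 2 ^ (2 * sz S) := by
  classical
  have hf := Sg_finite hS.fin
  have := IX_index hf.toFinset (fun w => le_refl (P w))
  rw [hf.coe_toFinset] at this
  have hfe := emb_finite (K := K)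
  have := Fintype.ofFinite (K →+* ℝ)
  have he : hf.toFinset = hS.fin.toFinset.disjSum Finset.univ := by
    ext w
    rcases w with v | s
    · simp [inl_mem_Sg]
    · simp [inr_mem_Sg]
  rw [‹(IX (Sg S) P).index = _›, he, Finset.prod_disjSum]
  simp only [P_index_fin, P_index_real, Finset.prod_mul_distrib, Finset.prod_const, prod_dyadic hS]
  rw [Finset.card_univ, ← Nat.card_eq_fintype_card, ← Set.ncard_eq_toFinset_card S hS.fin]
  have h4 : (4 : ℕ) = 2 ^ 2 := rfl
  rw [h4, ← pow_mul, ← pow_add, ← pow_add, sz]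
  congr 1
  have := card_inf K
  omega

theorem sup_of_relIndex {G : Type*} [CommGroup G] {U D H : Subgroup G} (hU : U ≤ D) (hH : H ≤ D) (h0 : H.relIndex D ≠ 0)
    (h : H.relIndex D ≤ H.relIndex U) : D ≤ U ⊔ H := by
  rw [← Subgroup.relIndex_eq_one]
  have h1 := Subgroup.relIndex_mul_relIndex H (U ⊔ H) D le_sup_right (sup_le hU hH)
  rw [Subgroup.relIndex_sup_right] at h1
  have h2 : H.relIndex U ≠ 0 := fun h => h0 (by rw [← h1, h, zero_mul])
  have h3 : (U ⊔ H).relIndex D ≠ 0 := fun h => h0 (by rw [← h1, h, mul_zero])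
  nlinarith [Nat.pos_of_ne_zero h2, Nat.pos_of_ne_zero h3]

theorem not_sq_of {c : Kˣ} {w : Pl K} (h : c ∉ P w) : ¬ IsSquare (c : K) := by
  rintro ⟨y, hy⟩
  have hy0 : y ≠ 0 := by rintro rfl; simp at hy
  apply h
  have : c = (Units.mk0 y hy0) ^ 2 := by ext; simp [hy, pow_two]
  rw [this]; exact sq_mem_P _ _

theorem isSquare_units {c : Kˣ} (h : IsSquare (c : K)) : ∃ y : Kˣ, c = y ^ 2 := by
  obtain ⟨y, hy⟩ := h
  have hy0 : y ≠ 0 := by rintro rfl; simp at hy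
  exact ⟨Units.mk0 y hy0, by ext; simp [hy, pow_two]⟩

theorem sqs_c {S : Set (FP K)} (hS : S.Finite) {c : Kˣ} (hc : ¬ IsSquare (c : K)) (hcS : c ∈ US S) :
    2 * (sqs (US S) ⊔ Subgroup.zpowers c).relIndex (US S) = 2 ^ sz S := by
  have h1 : (sqs (US S)).relIndex (Subgroup.zpowers c) = 2 := by
    rw [Subgroup.relIndex_eq_two_iff]
    have hcn : c ∉ sqs (US S) := by
      intro h
      obtain ⟨y, -, hy⟩ := mem_sqs.1 h
      exact hc ⟨y, by rw [← hy]; simp [pow_two]⟩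
    have hc2 : c * c ∈ sqs (US S) := mem_sqs.2 ⟨c, hcS, by rw [pow_two]⟩
    have hz : ∀ n : ℤ, (c * c) ^ n ∈ sqs (US S) := fun n => zpow_mem hc2 n
    refine ⟨c, Subgroup.mem_zpowers c, ?_⟩
    rintro b ⟨n, rfl⟩
    dsimp only
    rcases Int.even_or_odd' n with ⟨k, rfl | rfl⟩
    · have e : c ^ (2 * k) = (c * c) ^ k := by rw [zpow_mul, zpow_ofNat, pow_two]
      rw [e]
      exact Or.inr ⟨hz k, fun h => hcn ((Subgroup.mul_mem_cancel_left _ (hz k)).1 h)⟩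
    · have e : c ^ (2 * k + 1) = (c * c) ^ k * c := by rw [zpow_add, zpow_mul, zpow_ofNat, pow_two, zpow_one]
      rw [e]
      refine Or.inl ⟨?_, fun h => hcn ((Subgroup.mul_mem_cancel_left _ (hz k)).1 h)⟩
      rw [mul_assoc]
      exact mul_mem (hz k) hc2
  have h2 := Subgroup.relIndex_mul_relIndex (sqs (US S)) (sqs (US S) ⊔ Subgroup.zpowers c) (US S) le_sup_left
    (sup_le (sqs_le _) (by simpa using hcS))
  rw [US_sq S hS, Subgroup.relIndex_sup_left, h1] at h2
  exact h2

theorem G3_Q {S : Set (FP K)} (hS : Adq S) {c : Kˣ} (hc : ¬ IsSquare (c : K)) (hcS : c ∈ US S) (k : ℕ) (hk : k + 1 ≤ sz S) :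
    ∃ Q : Set (FP K), Q.Finite ∧ Q.ncard = k ∧ (∀ q ∈ Q, q ∉ S ∧ c ∈ P (.inl q)) ∧
      (IX (Sum.inl '' Q) P).relIndex (US S) = 2 ^ k := by
  induction k with
  | zero => exact ⟨∅, Set.finite_empty, by simp, by simp, by simp [IX]⟩
  | succ k ih =>
    obtain ⟨Q, hQ, hQk, hQc, hQi⟩ := ih (by omega)
    have h1 := sqs_c hS.fin hc hcS
    have h2 : ¬ (IX (Sum.inl '' Q) P ⊓ US S ≤ sqs (US S) ⊔ Subgroup.zpowers c) := by
      intro h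
      have h3 := Subgroup.relIndex_dvd_of_le_left (US S) h
      rw [Subgroup.inf_relIndex_right, hQi] at h3
      have h4 := Nat.le_of_dvd (by positivity) h3
      have h5 : 2 ^ (k + 2) ≤ 2 ^ sz S := Nat.pow_le_pow_right (by norm_num) (by omega)
      have h6 : 2 ^ (k + 2) = 4 * 2 ^ k := by ring
      have : 0 < 2 ^ k := by positivity
      omega
    obtain ⟨u, hu, hun⟩ := SetLike.not_le_iff_exists.1 h2
    obtain ⟨L, _, _, _, ⟨E⟩⟩ := exists_QE c hc
    have huL : ¬ IsSquare ((io K L u : Lˣ) : L) := by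
      intro h
      obtain ⟨y, hy⟩ := isSquare_units h
      rcases E.sq_K hy.symm with ⟨b, hb, -⟩ | ⟨b, hb, -⟩
      · apply hun
        apply Subgroup.mem_sup_left
        exact mem_sqs.2 ⟨b, US_sq_mem (hb ▸ hu.2), hb.symm⟩
      · apply hun
        have hb2 : b ^ 2 ∈ US S := by
          have := mul_mem (inv_mem hcS) hu.2
          rw [hb] at this
          simpa using this
        rw [hb]
        exact mul_mem (Subgroup.mem_sup_right (Subgroup.mem_zpowers c)) (Subgroup.mem_sup_left (mem_sqs.2 ⟨b, US_sq_mem hb2, rfl⟩))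
    obtain ⟨W, hW, hWu⟩ := GS huL (E.SL_fin (hS.fin.union hQ))
    have hWS : dn K W ∉ S := fun h => hW (Or.inl h)
    have hWQ : dn K W ∉ Q := fun h => hW (Or.inr h)
    have huP : u ∉ P (.inl (dn K W)) := fun h => hWu (P_io W h)
    have hodd := hS.dy _ hWS
    have h2U := P_relIndex_odd hodd
    have huU : u ∈ Un (dn K W) := mem_US.1 hu.2 _ hWS
    have hcU : c ∈ Un (dn K W) := mem_US.1 hcS _ hWS
    have hcP : c ∈ P (.inl (dn K W)) := by
      by_contra hcP
      have huc : u * c ∈ P (.inl (dn K W)) := by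
        obtain ⟨a, ha, hab⟩ := Subgroup.relIndex_eq_two_iff.1 h2U
        have e1 : c * a ∈ P (.inl (dn K W)) := by
          rcases hab c hcU with h | h
          · exact h.1
          · exact absurd h.1 hcP
        have e2 : u * a ∈ P (.inl (dn K W)) := by
          rcases hab u huU with h | h
          · exact h.1
          · exact absurd h.1 huP
        have e3 : u * c = (u * a) * (c * a) * ((a⁻¹) ^ 2) := by
          rw [inv_pow, eq_mul_inv_iff_mul_eq, pow_two]
          simp only [mul_assoc, mul_comm, mul_left_comm]
        rw [e3]
        exact mul_mem (mul_mem e2 e1) (sq_mem_P _ _)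
      have := mul_mem (P_io W huc) (inv_mem (E.io_c W))
      rw [map_mul, mul_inv_cancel_right] at this
      exact hWu this
    refine ⟨insert (dn K W) Q, hQ.insert _, by rw [Set.ncard_insert_of_notMem hWQ hQ, hQk], ?_, ?_⟩
    · rintro q (rfl | hq)
      · exact ⟨hWS, hcP⟩
      · exact hQc q hq
    · rw [Set.image_insert_eq, IX_insert, ← Subgroup.relIndex_inf_mul_relIndex, hQi, pow_succ, mul_comm]
      congr 1
      have hle : IX (Sum.inl '' Q) P ⊓ US S ≤ Un (dn K W) := fun x hx => mem_US.1 hx.2 _ hWS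
      have h3 := Subgroup.relIndex_le_of_le_right hle (H := P (.inl (dn K W))) (by rw [h2U]; norm_num)
      have h4 : (P (.inl (dn K W))).relIndex (IX (Sum.inl '' Q) P ⊓ US S) ≠ 1 := by
        intro h
        rw [Subgroup.relIndex_eq_one] at h
        exact huP (h hu)
      have h5 : (P (.inl (dn K W))).relIndex (IX (Sum.inl '' Q) P ⊓ US S) ≠ 0 := by
        exact mt (Subgroup.relIndex_eq_zero_of_le_right hle) (by rw [h2U]; norm_num)
      omega

theorem IX_relIndex_le {Q : Set (FP K)} (hQ : Q.Finite) (hodd : ∀ q ∈ Q, abv (.inl q) (2 : K) = 1) (D : Subgroup Kˣ) (hD : ∀ q ∈ Q, D ≤ Un q) :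
    (IX (Sum.inl '' Q) P).relIndex D ≠ 0 ∧ (IX (Sum.inl '' Q) P).relIndex D ≤ 2 ^ Q.ncard := by
  induction Q, hQ using Set.Finite.induction_on with
  | empty => simp [IX]
  | @insert a Q ha hQ ih =>
    have ih := ih (fun q hq => hodd q (Or.inr hq)) (fun q hq => hD q (Or.inr hq))
    have h2U := P_relIndex_odd (hodd a (Or.inl rfl))
    rw [Set.image_insert_eq, IX_insert, ← Subgroup.relIndex_inf_mul_relIndex, Set.ncard_insert_of_notMem ha hQ, pow_succ, mul_comm]
    have hle : IX (Sum.inl '' Q) P ⊓ D ≤ Un a := inf_le_right.trans (hD a (Or.inl rfl))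
    have h3 := Subgroup.relIndex_le_of_le_right hle (H := P (.inl a)) (by rw [h2U]; norm_num)
    have h5 : (P (.inl a)).relIndex (IX (Sum.inl '' Q) P ⊓ D) ≠ 0 := by
      exact mt (Subgroup.relIndex_eq_zero_of_le_right hle) (by rw [h2U]; norm_num)
    rw [h2U] at h3
    exact ⟨mul_ne_zero ih.1 h5, Nat.mul_le_mul ih.2 h3⟩

theorem sz_pos (S : Set (FP K)) : 1 ≤ sz S := by
  have : 0 < Fintype.card (InfinitePlace K) := Fintype.card_pos
  rw [sz]; omega

theorem G3 {S : Set (FP K)} (hS : Adq S) {c : Kˣ} (hc : ¬ IsSquare (c : K)) (hcS : c ∈ US S) :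
    ∃ T, S ⊆ T ∧ Adq T ∧ (∀ q ∈ T, q ∉ S → c ∈ P (.inl q)) ∧ (US T ⊔ NS S c).index = 2 := by
  classical
  have hs1 := sz_pos S
  obtain ⟨Q, hQ, hQk, hQc, hQi⟩ := G3_Q hS hc hcS (sz S - 1) (by omega)
  have hdis : Disjoint S Q := by
    rw [Set.disjoint_left]
    exact fun v hv hv2 => (hQc v hv2).1 hv
  have hT : Adq (S ∪ Q) := hS.mono Set.subset_union_left (hS.fin.union hQ)
  have hTP : ∀ q ∈ S ∪ Q, q ∉ S → c ∈ P (.inl q) := by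
    rintro q (h | h) h2
    · exact absurd h h2
    · exact (hQc q h).2
  refine ⟨S ∪ Q, Set.subset_union_left, hT, hTP, ?_⟩
  set J := IX (Sum.inl '' Q) P with hJ
  -- step 1
  have hD : ∀ x : Kˣ, (∀ q ∈ Q, x ∈ Un q) → x ∈ US S ⊔ J := by
    set D : Subgroup Kˣ := ⨅ q ∈ Q, Un q with hDdef
    have hmD : ∀ x, x ∈ D ↔ ∀ q ∈ Q, x ∈ Un q := by
      intro x; simp [hDdef, Subgroup.mem_iInf]
    have hUD : US S ≤ D := fun x hx => (hmD x).2 fun q hq => mem_US.1 hx q (hQc q hq).1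
    have h1 := IX_relIndex_le hQ (fun q hq => hS.dy q (hQc q hq).1) D (fun q hq x hx => (hmD x).1 hx q hq)
    have h2 : (J ⊓ D).relIndex D = J.relIndex D := Subgroup.inf_relIndex_right _ _
    have h3 : (J ⊓ D).relIndex (US S) = J.relIndex (US S) := by
      rw [← Subgroup.inf_relIndex_right, inf_assoc, inf_eq_right.2 hUD, Subgroup.inf_relIndex_right]
    have := sup_of_relIndex hUD (inf_le_right : J ⊓ D ≤ D) (by rw [h2]; exact h1.1) (by
      rw [h2, h3, hQi, ← hQk]; exact h1.2)
    intro x hx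
    exact (sup_le_sup_left inf_le_left _ : US S ⊔ (J ⊓ D) ≤ US S ⊔ J) (this ((hmD x).2 hx))
  have htop : US (S ∪ Q) ⊔ J = ⊤ := by
    rw [eq_top_iff]
    intro x _
    obtain ⟨κ, hκ⟩ := hS.exists_ord (fun v => if v ∈ Q then (ord v x).toAdd else 0) (by
      apply hQ.subset
      rintro v ⟨-, hv⟩
      by_contra h
      exact hv (if_neg h))
    have hκU : κ ∈ US (S ∪ Q) := by
      rw [mem_US]
      intro v hv
      simp only [Set.mem_union, not_or] at hv
      have := hκ v hv.1
      rw [if_neg hv.2] at this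
      exact Multiplicative.toAdd.injective this
    have h1 : κ⁻¹ * x ∈ US S ⊔ J := by
      apply hD
      intro q hq
      change ord q (κ⁻¹ * x) = 1
      have := hκ q (hQc q hq).1
      rw [if_pos hq] at this
      have := Multiplicative.toAdd.injective this
      rw [map_mul, map_inv, this]; simp
    have e : x = κ * (κ⁻¹ * x) := by group
    rw [e]
    exact mul_mem (Subgroup.mem_sup_left hκU) ((sup_le_sup_right (US_mono Set.subset_union_left) _ : US S ⊔ J ≤ US (S ∪ Q) ⊔ J) h1)
  -- claim A
  have hA : IX (Sg S) P ⊓ US (S ∪ Q) = sqs (US (S ∪ Q)) := by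
    apply le_antisymm
    · intro b hb
      by_cases hbs : IsSquare (b : K)
      · obtain ⟨y, rfl⟩ := isSquare_units hbs
        exact mem_sqs.2 ⟨y, US_sq_mem hb.2, rfl⟩
      · exfalso
        apply F1 hbs hT hb.2
        rw [eq_top_iff, ← htop]
        apply sup_le_sup_left
        intro x hx
        rw [mem_NS]
        intro w hw
        by_cases hwS : w ∈ Sg S
        · rw [Nw_top (mem_IX.1 hb.1 w hwS)]; trivial
        · rcases w with v | s
          · apply P_le_Nw
            have hv : v ∈ Q := (inl_mem_Sg.1 hw).resolve_left (fun h => hwS (inl_mem_Sg.2 h))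
            exact mem_IX.1 hx _ ⟨v, hv, rfl⟩
          · exact absurd inr_mem_Sg hwS
    · intro b hb
      obtain ⟨y, hy, rfl⟩ := mem_sqs.1 hb
      exact ⟨mem_IX.2 fun w _ => sq_mem_P w y, pow_mem hy 2⟩
  have hB : (IX (Sg S) P).relIndex (US (S ∪ Q)) = 2 ^ (2 * sz S - 1) := by
    rw [← Subgroup.inf_relIndex_right, hA, US_sq _ hT.fin, Set.ncard_union_eq hdis hS.fin hQ, hQk]
    congr 1
    simp only [sz] at *
    omega
  have hC : (US (S ∪ Q) ⊔ IX (Sg S) P).index = 2 := by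
    have := Subgroup.relIndex_mul_index (le_sup_right : IX (Sg S) P ≤ US (S ∪ Q) ⊔ IX (Sg S) P)
    rw [Subgroup.relIndex_sup_right, hB, PS_index hS] at this
    have e : 2 ^ (2 * sz S) = 2 ^ (2 * sz S - 1) * 2 := by rw [← pow_succ]; congr 1; omega
    rw [e] at this
    exact Nat.eq_of_mul_eq_mul_left (by positivity) this
  have hD : US (S ∪ Q) ⊔ IX (Sg S) P ≤ US (S ∪ Q) ⊔ NS S c :=
    sup_le_sup_left (fun x hx => mem_NS.2 fun w hw => P_le_Nw w c (mem_IX.1 hx w hw)) _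
  have hE := Subgroup.index_dvd_of_le hD
  rw [hC] at hE
  rcases (Nat.dvd_prime Nat.prime_two).1 hE with h | h
  · exfalso
    rw [Subgroup.index_eq_one] at h
    apply F1 hc hT (US_mono Set.subset_union_left hcS)
    rw [NS_ext Set.subset_union_left hTP, h]
  · exact h

theorem nrm_sq (y : Kˣ) : nrm (y ^ 2) = ⊤ := by
  have := nrm_mul_sq (1 : Kˣ) y
  rw [one_mul] at this
  rw [this, nrm_one]

theorem O1 {c e : Kˣ} (h : ∀ w, e ∈ Nw w c) : e ∈ nrm c := by
  by_cases hc : IsSquare (c : K)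
  · obtain ⟨y, rfl⟩ := isSquare_units hc
    rw [nrm_sq]; trivial
  obtain ⟨S, -, hS, hU⟩ := exists_adq_unit (Set.finite_empty (α := FP K)) {c, e} (by simp)
  obtain ⟨T, hST, hT, hTP, hi⟩ := G3 hS hc (hU c (by simp))
  have hcT := US_mono hST (hU c (by simp))
  obtain ⟨L, _, _, _, ⟨E⟩⟩ := exists_QE c hc
  rw [← NS_ext hST hTP] at hi
  have h1 := Subgroup.relIndex_mul_index (le_sup_right : NS T c ≤ US T ⊔ NS T c)
  rw [Subgroup.relIndex_sup_right, hi, NS_index hT.fin, ← E.G1' hT hcT] at h1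
  have h2 := Nat.eq_of_mul_eq_mul_right (by norm_num) h1
  have h3 := Subgroup.relIndex_mul_relIndex _ _ _ (E.map_le T) inf_le_right
  rw [Subgroup.inf_relIndex_right, h2] at h3
  have h4 : ((US (dn K (L := L) ⁻¹' T)).map E.N).relIndex (US T) ≠ 0 := by
    intro h
    have := E.G1' hT hcT
    rw [h, zero_mul] at this
    have h' : 0 < 2 ^ (Sn T c).ncard := by positivity
    omega
  have h5 : ((US (dn K (L := L) ⁻¹' T)).map E.N).relIndex (NS T c ⊓ US T) = 1 :=
    Nat.eq_of_mul_eq_mul_right (Nat.pos_of_ne_zero h4) (by rw [h3, one_mul])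
  rw [Subgroup.relIndex_eq_one] at h5
  have h6 := h5 ⟨mem_NS.2 fun w _ => h w, US_mono hST (hU e (by simp))⟩
  obtain ⟨b, -, rfl⟩ := h6
  rw [← E.range_N]
  exact ⟨b, rfl⟩

/-- the reciprocity subgroup -/
noncomputable def RS (S : Set (FP K)) (c : Kˣ) : Subgroup Kˣ := MS S c ⊔ NS S c

theorem RS_index {S : Set (FP K)} (hS : Adq S) {c : Kˣ} (hc : ¬ IsSquare (c : K)) (hcS : c ∈ US S) : (RS S c).index = 2 := by
  obtain ⟨T, hST, hT, hTP, hi⟩ := G3 hS hc hcS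
  have h1 : US T ≤ MS S c := by
    intro x hx
    rw [mem_MS]
    intro v hv
    by_cases hcP : c ∈ P (.inl v)
    · rw [Nw_top hcP]; trivial
    · rw [odd_unit (hS.dy v hv) (mem_US.1 hcS v hv) hcP]
      have hvT : v ∉ T := fun h => hcP (hTP v h hv)
      rw [mem_US.1 hx v hvT]
      simp
  have h2 := Subgroup.index_dvd_of_le (sup_le_sup_right h1 (NS S c))
  rw [hi] at h2
  rcases (Nat.dvd_prime Nat.prime_two).1 h2 with h | h
  · exfalso
    rw [Subgroup.index_eq_one] at h
    exact MS_ne hc hS hcS h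
  · exact h

end
end QF


namespace QF
open NumberField IsDedekindDomain HeightOneSpectrum

section
variable {K : Type*} [Field K] [NumberField K]

open Classical in
/-- Hilbert symbol -/
noncomputable def hs (w : Pl K) (c e : Kˣ) : ℤˣ := if e ∈ Nw w c then 1 else -1

theorem hs_one_iff {w : Pl K} {c e : Kˣ} : hs w c e = 1 ↔ e ∈ Nw w c := by
  unfold hs; split_ifs with h <;> simp [h]

theorem hs_neg_iff {w : Pl K} {c e : Kˣ} : hs w c e = -1 ↔ e ∉ Nw w c := by
  unfold hs; split_ifs with h <;> simp [h]

theorem hs_comm (w : Pl K) (c e : Kˣ) : hs w c e = hs w e c := by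
  classical
  exact if_congr Nw_comm rfl rfl

theorem hs_mul (w : Pl K) (c a b : Kˣ) : hs w c (a * b) = hs w c a * hs w c b := by
  by_cases ha : a ∈ Nw w c <;> by_cases hb : b ∈ Nw w c
  · rw [hs_one_iff.2 ha, hs_one_iff.2 hb, hs_one_iff.2 (mul_mem ha hb)]; rfl
  · rw [hs_one_iff.2 ha, hs_neg_iff.2 hb, hs_neg_iff.2 fun h => hb ((Subgroup.mul_mem_cancel_left _ ha).1 h)]; rfl
  · rw [hs_neg_iff.2 ha, hs_one_iff.2 hb, hs_neg_iff.2 fun h => ha ((Subgroup.mul_mem_cancel_right _ hb).1 h)]; rfl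
  · rw [hs_neg_iff.2 ha, hs_neg_iff.2 hb, hs_one_iff.2 (Nw_mul_iff ha hb)]; rfl

theorem hs_mul' (w : Pl K) (c a b : Kˣ) : hs w (a * b) c = hs w a c * hs w b c := by
  rw [hs_comm, hs_mul, hs_comm w c a, hs_comm w c b]

theorem hs_P {w : Pl K} {c : Kˣ} (h : c ∈ P w) (e : Kˣ) : hs w c e = 1 := by
  rw [hs_one_iff, Nw_top h]; trivial

theorem hs_P' {w : Pl K} {c : Kˣ} (h : c ∈ P w) (e : Kˣ) : hs w e c = 1 := by
  rw [hs_comm, hs_P h]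

theorem hs_nrm {w : Pl K} {c e : Kˣ} (h : e ∈ nrm c) : hs w c e = 1 := hs_one_iff.2 (nrm_le_locN _ c h)

theorem hs_self (w : Pl K) (c : Kˣ) : hs w c c = hs w c (-1) := by
  have h : hs w c (-c) = 1 := hs_nrm (neg_self_mem_nrm c)
  have e : -c = (-1) * c := by simp
  rw [e, hs_mul] at h
  rw [eq_comm]
  calc hs w c (-1) = hs w c (-1) * hs w c c * hs w c c := by rw [mul_assoc, Int.units_mul_self, mul_one]
    _ = hs w c c := by rw [h, one_mul]

theorem hs_inv (w : Pl K) (c e : Kˣ) : hs w c e⁻¹ = hs w c e := by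
  have : hs w c (e⁻¹ * e⁻¹) = 1 := by
    rw [← pow_two]; exact hs_P' (sq_mem_P w _) c
  have e1 : e⁻¹ = e⁻¹ * e⁻¹ * e := by group
  rw [e1, hs_mul, this, one_mul]

theorem hs_congr {w : Pl K} {c e e' : Kˣ} (h : e⁻¹ * e' ∈ P w) : hs w c e' = hs w c e := by
  have e1 : e' = e * (e⁻¹ * e') := by group
  rw [e1, hs_mul, hs_P' h, mul_one]

theorem hs_sum (w : Pl K) {a b s : Kˣ} (h : (a : K) + b = s) : hs w a b = hs w s (-(a * b)) := by
  have hs0 : (s : K) ≠ 0 := s.ne_zero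
  have h1 : hs w (a * s) (b * s) = 1 := by
    apply hs_nrm
    rw [mem_nrm]
    refine ⟨s, 1, ?_⟩
    push_cast
    rw [← h]; ring
  rw [hs_mul, hs_mul', hs_mul', hs_self, hs_comm w a s] at h1
  have h2 : hs w s (-(a * b)) = hs w s a * hs w s b * hs w s (-1) := by
    rw [← hs_mul, ← hs_mul]; congr 1; simp
  rw [h2]
  have h3 := Int.units_mul_self (hs w s a * hs w s b * hs w s (-1))
  calc hs w a b = hs w a b * ((hs w s a * hs w s b * hs w s (-1)) * (hs w s a * hs w s b * hs w s (-1))) := by rw [h3, mul_one]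
    _ = (hs w a b * hs w s b * (hs w s a * hs w s (-1))) * (hs w s a * hs w s b * hs w s (-1)) := by
      simp only [mul_assoc, mul_comm, mul_left_comm]
    _ = _ := by rw [h1, one_mul]

/-- ramified places -/
def Ram (c e : Kˣ) : Set (Pl K) := {w | e ∉ Nw w c}

theorem mem_Ram {c e : Kˣ} {w : Pl K} : w ∈ Ram c e ↔ hs w c e = -1 := hs_neg_iff.symm

theorem Ram_eq {c e c' e' : Kˣ} (h : ∀ w, hs w c e = hs w c' e') : Ram c e = Ram c' e' := by
  ext w; rw [mem_Ram, mem_Ram, h]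

theorem Ram_unit {S : Set (FP K)} (hS : Adq S) {c e : Kˣ} (hc : c ∈ US S) (he : e ∈ US S) : Ram c e ⊆ Sg S := by
  intro w hw
  rcases w with v | s
  · rw [inl_mem_Sg]
    by_contra hv
    apply hw
    apply odd_even (hS.dy v hv)
    · rw [mem_US.1 hc v hv]; simp
    · rw [mem_US.1 he v hv]; simp
  · exact inr_mem_Sg

theorem Ram_finite (c e : Kˣ) : (Ram c e).Finite := by
  obtain ⟨S, -, hS, hU⟩ := exists_adq_unit (Set.finite_empty (α := FP K)) {c, e} (by simp)
  exact (Sg_finite hS.fin).subset (Ram_unit hS (hU c (by simp)) (hU e (by simp)))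

/-- values of the pure ternary form -/
def Dv (c e d : K) : Prop := ∃ u v t : K, d = c * u ^ 2 + e * v ^ 2 - c * e * t ^ 2

omit [NumberField K] in
theorem Dv_sq [CharZero K] {s e : K} (hs : s ≠ 0) (he : e ≠ 0) (d : K) : Dv (s ^ 2) e d :=
  ⟨0, (d / e + 1) / 2, (d / e - 1) / (2 * s), by field_simp; ring⟩

omit [NumberField K] in
theorem Dv_nrm [CharZero K] {c y z : K} (hc : c ≠ 0) (he : y ^ 2 - c * z ^ 2 ≠ 0) (d : K) : Dv c (y ^ 2 - c * z ^ 2) d := by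
  refine ⟨(d / c + 1) / 2, -c * ((d / c - 1) / 2) * z / (y ^ 2 - c * z ^ 2), ((d / c - 1) / 2) * y / (y ^ 2 - c * z ^ 2), ?_⟩
  have : ∀ k : K, d = c * ((d / c + 1) / 2) ^ 2 - c * ((d / c - 1) / 2) ^ 2 := by
    intro k; field_simp; ring
  field_simp
  ring

omit [NumberField K] in
theorem splitK [CharZero K] {c d e y1 y2 z1 z2 : K} (hc : c ≠ 0) (he : e ≠ 0) 
    (h1 : e = y1 ^ 2 + d * y2 ^ 2 - c * (z1 ^ 2 + d * z2 ^ 2)) (h2 : y1 * y2 = c * (z1 * z2)) : Dv c e d := by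
  by_cases hk : y2 ^ 2 - c * z2 ^ 2 = 0
  · by_cases hz : z2 = 0
    · subst hz
      have hy : y2 = 0 := by simpa using hk
      subst hy
      have : e = y1 ^ 2 - c * z1 ^ 2 := by rw [h1]; ring
      rw [this]
      exact Dv_nrm hc (this ▸ he) d
    · have hcs : c = (y2 / z2) ^ 2 := by field_simp; linear_combination -hk
      rw [hcs]
      refine Dv_sq ?_ he d
      intro h
      rw [h] at hcs
      exact hc (by simpa using hcs)
  · refine ⟨(y1 * z2 - z1 * y2) / (y2 ^ 2 - c * z2 ^ 2), y2 / (y2 ^ 2 - c * z2 ^ 2), z2 / (y2 ^ 2 - c * z2 ^ 2), ?_⟩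
    have key : d * (y2 ^ 2 - c * z2 ^ 2) ^ 2 = c * (y1 * z2 - z1 * y2) ^ 2 + e * y2 ^ 2 - c * e * z2 ^ 2 := by
      rw [h1]
      linear_combination (-(y1 * y2) + c * (z1 * z2)) * h2
    field_simp
    linear_combination key

theorem splitL {L : Type*} [Field L] [Algebra K L] {d : Kˣ} (E : QE K L d) {c e : Kˣ} (h : io K L e ∈ nrm (io K L c)) :
    Dv (c : K) e d := by
  obtain ⟨y, z, hyz⟩ := mem_nrm.1 h
  obtain ⟨y1, y2, rfl⟩ := E.span y
  obtain ⟨z1, z2, rfl⟩ := E.span z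
  have hA : algebraMap K L (e - (y1 ^ 2 + d * y2 ^ 2 - c * (z1 ^ 2 + d * z2 ^ 2))) = 
      algebraMap K L (2 * (y1 * y2 - c * (z1 * z2))) * E.δ := by
    have h1 : ((io K L e : Lˣ) : L) = algebraMap K L e := rfl
    have h2 : ((io K L c : Lˣ) : L) = algebraMap K L c := rfl
    rw [h1, h2] at hyz
    simp only [map_sub, map_mul, map_add, map_pow, map_ofNat]
    rw [hyz, ← E.sq]; ring
  have hB : y1 * y2 - c * (z1 * z2) = 0 := by
    by_contra h0
    apply E.nonsq
    set p := e - (y1 ^ 2 + d * y2 ^ 2 - c * (z1 ^ 2 + d * z2 ^ 2))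
    have h20 : (2 * (y1 * y2 - c * (z1 * z2)) : K) ≠ 0 := mul_ne_zero (by norm_num) h0
    refine ⟨p / (2 * (y1 * y2 - c * (z1 * z2))), ?_⟩
    apply (algebraMap K L).injective
    have h3 : algebraMap K L (2 * (y1 * y2 - c * (z1 * z2))) ≠ 0 := (map_ne_zero (algebraMap K L)).2 h20
    rw [map_mul, map_div₀, hA, mul_div_cancel_left₀ _ h3, ← E.sq, pow_two]
  rw [hB] at hA
  simp only [mul_zero, map_zero, zero_mul, map_eq_zero] at hA
  exact splitK c.ne_zero e.ne_zero (sub_eq_zero.1 hA) (sub_eq_zero.1 hB)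

theorem io_nrm {K L : Type*} [Field K] [Field L] [Algebra K L] {c e : Kˣ} (h : e ∈ nrm c) : io K L e ∈ nrm (io K L c) := by
  obtain ⟨y, z, hyz⟩ := mem_nrm.1 h
  refine mem_nrm.2 ⟨algebraMap K L y, algebraMap K L z, ?_⟩
  change algebraMap K L e = _ - algebraMap K L c * _
  rw [hyz]; simp

variable {L : Type*} [Field L] [NumberField L] [Algebra K L]

theorem Nw_io (W : FP L) {c e : Kˣ} (h : e ∈ Nw (.inl (dn K W)) c) : io K L e ∈ Nw (.inl W) (io K L c) := by
  obtain ⟨p, hp, n, hn, rfl⟩ := mem_locN_iff.1 h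
  rw [map_mul]
  exact mul_mem (locSq_le_locN _ _ (P_io W hp)) (nrm_le_locN _ _ (io_nrm hn))

theorem Nw_ior (t : L →+* ℝ) {c e : Kˣ} (h : e ∈ Nw (.inr (rs K t)) c) : io K L e ∈ Nw (.inr t) (io K L c) := by
  obtain ⟨p, hp, n, hn, rfl⟩ := mem_locN_iff.1 h
  rw [map_mul]
  refine mul_mem (locSq_le_locN _ _ ?_) (nrm_le_locN _ _ (io_nrm hn))
  exact (mem_locSq_real t _).2 ((mem_locSq_real (rs K t) p).1 hp)

theorem QE.loc_split {d : Kˣ} (E : QE K L d) (W : FP L) (hd : d ∉ P (.inl (dn K W))) (c e : Kˣ) :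
    io K L e ∈ Nw (.inl W) (io K L c) := by
  have hcd : ∀ e : Kˣ, hs (.inl (dn K W)) (c * d) e = 1 → io K L e ∈ Nw (.inl W) (io K L c) := by
    intro e he
    have := Nw_io W (hs_one_iff.1 he)
    rw [map_mul] at this
    change _ ∈ locN _ _ at this
    rwa [locN_mul (hens (.inl W)) _ (E.io_c W)] at this
  have hc : ∀ e : Kˣ, hs (.inl (dn K W)) c e = 1 → io K L e ∈ Nw (.inl W) (io K L c) := 
    fun e he => Nw_io W (hs_one_iff.1 he)
  set w : Pl K := .inl (dn K W)
  rcases Int.units_eq_one_or (hs w c e) with h1 | h1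
  · exact hc e h1
  rcases Int.units_eq_one_or (hs w (c * d) e) with h2 | h2
  · exact hcd e h2
  have : ∃ f, f ∉ Nw w d := by
    by_contra! h
    exact hd (Nw_nondeg h)
  obtain ⟨f, hf⟩ := this
  rw [← hs_neg_iff] at hf
  have hm : hs w (c * d) f = - hs w c f := by rw [hs_mul', hf]; simp
  have e1 : e = f * (f⁻¹ * e) := by group
  rw [e1, map_mul]
  rcases Int.units_eq_one_or (hs w c f) with h3 | h3
  · refine mul_mem (hc f h3) (hcd _ ?_)
    rw [hs_mul, hs_inv, hm, h3, h2]; rfl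
  · refine mul_mem (hcd f (by rw [hm, h3]; rfl)) (hc _ ?_)
    rw [hs_mul, hs_inv, h3, h1]; rfl

theorem D_of {c e d : Kˣ} (h : ∀ w ∈ Ram c e, d ∉ P w) : Dv (c : K) e d := by
  by_cases hd : IsSquare (d : K)
  · have : e ∈ nrm c := by
      apply O1
      intro w
      by_contra hw
      exact not_sq_of (h w hw) hd
    obtain ⟨y, z, hyz⟩ := mem_nrm.1 this
    rw [hyz]
    exact Dv_nrm c.ne_zero (hyz ▸ e.ne_zero) d
  obtain ⟨L, _, _, _, ⟨E⟩⟩ := exists_QE d hd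
  apply splitL E
  apply O1
  rintro (W | t)
  · by_cases hW : d ∈ P (.inl (dn K W))
    · apply Nw_io W
      by_contra h2
      exact h _ h2 hW
    · exact E.loc_split W hW c e
  · apply Nw_ior t
    by_contra h2
    apply h _ h2
    rw [mem_locSq_real]
    change 0 < t (algebraMap K L d)
    rw [← E.sq, map_pow]
    have : t E.δ ≠ 0 := by
      rw [map_ne_zero]
      intro h0
      have := E.sq
      rw [h0] at this
      exact d.ne_zero ((map_eq_zero (algebraMap K L)).1 (by simpa using this.symm))
    positivity

theorem D_form {c e d : Kˣ} (h : Dv (c : K) e d) : (∃ u : Kˣ, d = c * u ^ 2) ∨ (∃ u : Kˣ, c = u ^ 2) ∨ (∃ n ∈ nrm c, d = e * n) ∨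
    ∃ u n : Kˣ, n ∈ nrm c ∧ ((c * u ^ 2 : Kˣ) : K) + (e * n : Kˣ) = d := by
  obtain ⟨u, v, t, hd⟩ := h
  by_cases hn : v ^ 2 - c * t ^ 2 = 0
  · by_cases ht : t = 0
    · subst ht
      have hv : v = 0 := by simpa using hn
      subst hv
      have hu : u ≠ 0 := by rintro rfl; simp at hd
      exact Or.inl ⟨Units.mk0 u hu, by ext; simp [hd]⟩
    · have hcs : (c : K) = (v / t) ^ 2 := by field_simp; linear_combination -hn
      have hv : v / t ≠ 0 := by intro h; rw [h] at hcs; simp at hcs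
      exact Or.inr (Or.inl ⟨Units.mk0 _ hv, by ext; simp [hcs]⟩)
  · have hnn : Units.mk0 _ hn ∈ nrm c := mem_nrm.2 ⟨v, t, rfl⟩
    by_cases hu : u = 0
    · subst hu
      refine Or.inr (Or.inr (Or.inl ⟨Units.mk0 _ hn, hnn, ?_⟩))
      ext; simp [hd]; ring
    · refine Or.inr (Or.inr (Or.inr ⟨Units.mk0 u hu, Units.mk0 _ hn, hnn, ?_⟩))
      simp [hd]; ring

theorem hs_form (w : Pl K) {c e d u n : Kˣ} (hn : n ∈ nrm c) (h : ((c * u ^ 2 : Kˣ) : K) + (e * n : Kˣ) = d) : 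
    hs w c e = hs w d (-((c * u ^ 2) * (e * n))) := by
  rw [← hs_sum w h, hs_mul, hs_mul', hs_mul', hs_P (sq_mem_P w u), hs_P (sq_mem_P w u), hs_nrm hn]
  simp

theorem of_D {c e d : Kˣ} (h : Dv (c : K) e d) (w : Pl K) (hd : d ∈ P w) : w ∉ Ram c e := by
  rw [mem_Ram]
  suffices hs w c e = 1 by rw [this]; decide
  rcases D_form h with ⟨u, hu⟩ | ⟨u, hu⟩ | ⟨n, hn, hd2⟩ | ⟨u, n, hn, hd2⟩
  · have : hs w (c * u ^ 2) e = 1 := hs_P (hu ▸ hd) e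
    rwa [hs_mul', hs_P (sq_mem_P w u), mul_one] at this
  · rw [hu]; exact hs_P (sq_mem_P w u) e
  · have : hs w c (e * n) = 1 := hs_P' (hd2 ▸ hd) c
    rwa [hs_mul, hs_nrm hn, mul_one] at this
  · rw [hs_form w hn hd2, hs_P hd]

theorem D_iff {c e d : Kˣ} : Dv (c : K) e d ↔ ∀ w ∈ Ram c e, d ∉ P w :=
  ⟨fun h w hw hd => of_D h w hd hw, D_of⟩

end
end QF


namespace QF
open NumberField IsDedekindDomain HeightOneSpectrum

section
variable {K : Type*} [Field K] [NumberField K]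

/-- a place is bad when it is the only ramified place of some symbol -/
def Bad (w : Pl K) : Prop := ∃ c e : Kˣ, Ram c e = {w}

theorem Bad.all {w : Pl K} (h : Bad w) {d : Kˣ} (hd : d ∉ P w) : ∃ e', Ram d e' = {w} := by
  obtain ⟨c, e, hr⟩ := h
  have hD : Dv (c : K) e d := D_of (by
    intro w' hw'
    rw [hr] at hw'
    rw [Set.mem_singleton_iff.1 hw']
    exact hd)
  rcases D_form hD with ⟨u, hu⟩ | ⟨u, hu⟩ | ⟨n, hn, hd2⟩ | ⟨u, n, hn, hd2⟩
  · refine ⟨e, ?_⟩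
    rw [← hr]
    apply Ram_eq
    intro w
    rw [hu, hs_mul', hs_P (sq_mem_P w u), mul_one]
  · exfalso
    have : w ∈ Ram c e := by rw [hr]; rfl
    rw [mem_Ram, hu, hs_P (sq_mem_P w u)] at this
    exact absurd this (by decide)
  · refine ⟨c, ?_⟩
    rw [← hr]
    apply Ram_eq
    intro w
    rw [hd2, hs_mul', hs_comm w n c, hs_nrm hn, mul_one, hs_comm]
  · refine ⟨-((c * u ^ 2) * (e * n)), ?_⟩
    rw [← hr, eq_comm]
    apply Ram_eq
    intro w
    exact hs_form w hn hd2

theorem hs_eq_iff {w : Pl K} {c x y : Kˣ} : (x ∉ Nw w c ↔ y ∉ Nw w c) ↔ hs w c x = hs w c y := by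
  rw [← hs_neg_iff, ← hs_neg_iff]
  rcases Int.units_eq_one_or (hs w c x) with h1 | h1 <;> rcases Int.units_eq_one_or (hs w c y) with h2 | h2 <;>
    rw [h1, h2] <;> decide

theorem RS_ram {S : Set (FP K)} {c x : Kˣ} : x ∈ RS S c ↔ ∃ e, Ram c e = {w ∈ Sg S | x ∉ Nw w c} := by
  constructor
  · intro h
    obtain ⟨m, hm, n, hn, rfl⟩ := Subgroup.mem_sup.1 h
    refine ⟨m, ?_⟩
    ext w
    rw [Set.mem_ofPred_eq, Ram, Set.mem_ofPred_eq]
    by_cases hw : w ∈ Sg S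
    · have : hs w c (m * n) = hs w c m := by rw [hs_mul, hs_one_iff.2 (mem_NS.1 hn w hw), mul_one]
      rw [hs_eq_iff.2 this]
      simp [hw]
    · rcases w with v | s
      · have := mem_MS.1 hm v (fun h => hw (inl_mem_Sg.2 h))
        simp [hw, this]
      · exact absurd inr_mem_Sg hw
  · rintro ⟨e, he⟩
    have h1 : ∀ w, w ∈ Ram c e ↔ w ∈ Sg S ∧ x ∉ Nw w c := fun w => by rw [he]; rfl
    have h2 : e ∈ MS S c := by
      rw [mem_MS]
      intro v hv
      by_contra h
      exact hv (inl_mem_Sg.1 ((h1 (.inl v)).1 h).1)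
    have h3 : e⁻¹ * x ∈ NS S c := by
      rw [mem_NS]
      intro w hw
      have := hs_eq_iff.1 (show e ∉ Nw w c ↔ x ∉ Nw w c by
        have := h1 w
        simp only [hw, true_and] at this
        exact this)
      rw [← hs_one_iff, hs_mul, hs_inv, this, Int.units_mul_self]
    have e1 : x = e * (e⁻¹ * x) := by group
    rw [e1]
    exact mul_mem (Subgroup.mem_sup_left h2) (Subgroup.mem_sup_right h3)

theorem units_mul_iff (p q : ℤˣ) : p * q = 1 ↔ (p = 1 ↔ q = 1) := by
  rcases Int.units_eq_one_or p with h1 | h1 <;> rcases Int.units_eq_one_or q with h2 | h2 <;>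
    rw [h1, h2] <;> decide

open Classical in
theorem chi_ind {S : Set (FP K)} (hS : Adq S) {c : Kˣ} (hc : ¬ IsSquare (c : K)) (hcS : c ∈ US S) (A : Finset (Pl K))
    (hA : (A : Set (Pl K)) ⊆ Sg S) (x : Kˣ) (hx : ∀ w ∈ Sg S, w ∉ A → x ∈ Nw w c) :
    x ∈ RS S c ↔ ∏ w ∈ A.filter (fun w => ¬ Bad w), hs w c x = 1 := by
  induction A using Finset.induction_on generalizing x with
  | empty => 
    simp only [Finset.filter_empty, Finset.prod_empty, iff_true]
    exact Subgroup.mem_sup_right (mem_NS.2 fun w hw => hx w hw (by simp))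
  | insert a A ha ih =>
    have haS : a ∈ Sg S := hA (by simp)
    have hAS : (A : Set (Pl K)) ⊆ Sg S := fun w hw => hA (by simp at hw ⊢; exact Or.inr hw)
    obtain ⟨g, hg⟩ := wa_sq (Sg S) (Sg_finite hS.fin) (fun w => if w = a then x else 1)
    have hga : hs a c g = hs a c x := by
      have := hg a haS
      rw [if_pos rfl] at this
      exact hs_congr this
    have hgw : ∀ w ∈ Sg S, w ≠ a → hs w c g = 1 := by
      intro w hw hwa
      have := hg w hw
      rw [if_neg hwa] at this
      rw [hs_congr this]
      exact hs_P' (one_mem _) c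
    have hy := ih hAS (g⁻¹ * x) (by
      intro w hw hwA
      rw [← hs_one_iff, hs_mul, hs_inv]
      by_cases hwa : w = a
      · subst hwa
        rw [hga, Int.units_mul_self]
      · rw [hgw w hw hwa, one_mul, hs_one_iff]
        exact hx w hw (by simp [hwA, hwa]))
    have hp : ∏ w ∈ A.filter (fun w => ¬ Bad w), hs w c (g⁻¹ * x) = ∏ w ∈ A.filter (fun w => ¬ Bad w), hs w c x := by
      apply Finset.prod_congr rfl
      intro w hw
      have hwA := (Finset.mem_filter.1 hw).1
      rw [hs_mul, hs_inv, hgw w (hAS hwA) (by rintro rfl; exact ha hwA), one_mul]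
    rw [hp] at hy
    have hgR : g ∈ RS S c ↔ (¬ Bad a → hs a c x = 1) := by
      rcases Int.units_eq_one_or (hs a c x) with h1 | h1
      · simp only [h1, implies_true, iff_true]
        refine Subgroup.mem_sup_right (mem_NS.2 fun w hw => hs_one_iff.1 ?_)
        by_cases hwa : w = a
        · subst hwa; rw [hga, h1]
        · exact hgw w hw hwa
      · have hset : {w ∈ Sg S | g ∉ Nw w c} = {a} := by
          ext w
          rw [Set.mem_ofPred_eq, Set.mem_singleton_iff]
          constructor
          · rintro ⟨h2, h3⟩
            by_contra hwa
            exact h3 (hs_one_iff.1 (hgw w h2 hwa))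
          · rintro rfl
            exact ⟨haS, hs_neg_iff.1 (hga.trans h1)⟩
        have hcP : c ∉ P a := by
          intro h
          rw [hs_P h] at h1
          exact absurd h1 (by decide)
        rw [RS_ram, hset]
        have h2 : ¬ hs a c x = 1 := by rw [h1]; decide
        simp only [h2, imp_false, not_not]
        exact ⟨fun ⟨e, he⟩ => ⟨c, e, he⟩, fun h => h.all hcP⟩
    have e1 : x = g * (g⁻¹ * x) := by group
    have hmul := Subgroup.mul_mem_iff_of_index_two (RS_index hS hc hcS) (a := g) (b := g⁻¹ * x)
    rw [← e1] at hmul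
    rw [hmul, hgR, hy, Finset.filter_insert]
    by_cases hb : Bad a
    · simp [hb]
    · rw [if_pos hb, Finset.prod_insert (by simp [ha]), units_mul_iff]
      simp [hb]

/-- good places of S -/
noncomputable def GX {S : Set (FP K)} (hS : Adq S) : Finset (Pl K) := by
  classical exact (Sg_finite hS.fin).toFinset.filter (fun w => ¬ Bad w)

theorem mem_GX {S : Set (FP K)} (hS : Adq S) {w : Pl K} : w ∈ GX hS ↔ w ∈ Sg S ∧ ¬ Bad w := by
  simp [GX]

theorem chi {S : Set (FP K)} (hS : Adq S) {c : Kˣ} (hc : ¬ IsSquare (c : K)) (hcS : c ∈ US S) (x : Kˣ) :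
    x ∈ RS S c ↔ ∏ w ∈ GX hS, hs w c x = 1 :=
  chi_ind hS hc hcS (Sg_finite hS.fin).toFinset (by simp) x (fun w hw h => absurd (by simpa using hw) h)

theorem O3_T1 {S : Set (FP K)} (hS : Adq S) {c : Kˣ} (hcS : c ∈ US S) (h : ∀ w ∈ GX hS, c ∈ P w) : c ∈ sqs (US S) := by
  by_cases hc : IsSquare (c : K)
  · obtain ⟨y, rfl⟩ := isSquare_units hc
    exact mem_sqs.2 ⟨y, US_sq_mem hcS, rfl⟩
  · exfalso
    have h1 := RS_index hS hc hcS
    have h2 : RS S c = ⊤ := by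
      rw [eq_top_iff]
      intro x _
      rw [chi hS hc hcS]
      exact Finset.prod_eq_one fun w hw => hs_P (h w hw) x
    rw [h2, Subgroup.index_top] at h1
    omega

theorem O3_T2 {S : Set (FP K)} (hS : Adq S) {c e : Kˣ} (hcS : c ∈ US S) (heS : e ∈ US S) : ∏ w ∈ GX hS, hs w c e = 1 := by
  by_cases hc : IsSquare (c : K)
  · obtain ⟨y, rfl⟩ := isSquare_units hc
    exact Finset.prod_eq_one fun w hw => hs_P (sq_mem_P w y) e
  · rw [← chi hS hc hcS]
    apply Subgroup.mem_sup_left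
    rw [mem_MS]
    intro v hv
    by_contra h
    exact hv (inl_mem_Sg.1 (Ram_unit hS hcS heS h))

/-- product of symbols as bilinear map -/
noncomputable def BX (X : Finset (Pl K)) : Kˣ →* (Kˣ →* ℤˣ) :=
  MonoidHom.mk' (fun x => MonoidHom.mk' (fun y => ∏ w ∈ X, hs w x y) (by
    intro a b; simp only [hs_mul, Finset.prod_mul_distrib])) (by
    intro a b; ext y; simp [hs_mul', Finset.prod_mul_distrib])

theorem BX_apply (X : Finset (Pl K)) (x y : Kˣ) : BX X x y = ∏ w ∈ X, hs w x y := rfl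

theorem card_hom_le (G : Type*) [CommGroup G] [Finite G] : Nat.card (G →* ℤˣ) ≤ Nat.card G := by
  have h := CommGroup.card_monoidHom_of_hasEnoughRootsOfUnity G ℂ
  rw [← h]
  have : Finite (G →* ℂˣ) := Nat.finite_of_card_ne_zero (by rw [h]; exact Nat.card_pos.ne')
  apply Nat.card_le_card_of_injective (fun χ : G →* ℤˣ => (Units.map (Int.castRingHom ℂ).toMonoidHom).comp χ)
  intro a b hab
  ext x
  have := congrArg (fun f => ((f x : ℂˣ) : ℂ)) hab
  simpa using this

theorem P_index_ge (w : Pl K) : 2 ≤ (P w).index := by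
  rcases w with v | s
  · rw [P_index_fin]
    have := absNorm_gt v
    have : 0 < Ideal.absNorm v.asIdeal ^ e2 v := Nat.pow_pos (lt_trans Nat.zero_lt_one (by exact_mod_cast absNorm_gt v))
    omega
  · rw [P_index_real]

theorem BX_nondeg (X : Finset (Pl K)) {u : Kˣ} (h : ∀ x, BX X u x = 1) : ∀ w ∈ X, u ∈ P w := by
  classical
  intro w hw
  apply Nw_nondeg
  intro e
  obtain ⟨g, hg⟩ := wa_sq X X.finite_toSet (fun w' => if w' = w then e else 1)
  have h1 := h g
  rw [BX_apply, Finset.prod_eq_single_of_mem w hw] at h1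
  · have := hg w (by simpa using hw)
    rw [if_pos rfl] at this
    rw [← hs_one_iff, ← hs_congr this, h1]
  · intro w' hw' hne
    have := hg w' (by simpa using hw')
    rw [if_neg hne] at this
    rw [hs_congr this]
    exact hs_P' (one_mem _) u

theorem O3_count {S : Set (FP K)} (hS : Adq S) : 2 ^ (2 * sz S) ≤ (IX (GX hS : Set (Pl K)) P).index := by
  set X := GX hS
  set PG := IX (X : Set (Pl K)) P with hPG
  set V : Subgroup Kˣ := ⨅ u ∈ US S, (BX X u).ker with hV
  have hmV : ∀ x, x ∈ V ↔ ∀ u ∈ US S, BX X u x = 1 := by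
    intro x; simp [hV, Subgroup.mem_iInf, MonoidHom.mem_ker]
  have hPV : PG ≤ V := by
    intro x hx
    rw [hmV]
    intro u _
    rw [BX_apply]
    exact Finset.prod_eq_one fun w hw => hs_P' (mem_IX.1 hx w hw) u
  have hUV : US S ≤ V := by
    intro x hx
    rw [hmV]
    intro u hu
    exact O3_T2 hS hu hx
  have hPG0 : PG.index ≠ 0 := by
    rw [hPG, IX_index X (fun w => le_refl _), Finset.prod_ne_zero_iff]
    intro w _
    exact P_index_ne_zero w
  have hV0 : V.index ≠ 0 := fun h => hPG0 (Nat.eq_zero_of_zero_dvd (h ▸ Subgroup.index_dvd_of_le hPV))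
  have : V.FiniteIndex := ⟨hV0⟩
  have : Finite (Kˣ ⧸ V) := Subgroup.finite_quotient_of_finiteIndex
  let Ψ : US S →* (Kˣ →* ℤˣ) := (BX X).comp (US S).subtype
  have hker : Ψ.ker = (sqs (US S)).subgroupOf (US S) := by
    ext u
    rw [MonoidHom.mem_ker, Subgroup.mem_subgroupOf]
    constructor
    · intro h
      exact O3_T1 hS u.2 (BX_nondeg X fun x => by
        have := DFunLike.congr_fun h x
        exact this)
    · intro h
      obtain ⟨y, hy, hyu⟩ := mem_sqs.1 h
      ext x
      change ((BX X (u : Kˣ) x : ℤˣ) : ℤ) = 1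
      rw [BX_apply, ← hyu, Finset.prod_eq_one fun w hw => hs_P (sq_mem_P w y) x]
      rfl
  have hcard : 2 ^ sz S ≤ V.index := by
    rw [sz, ← US_sq S hS.fin]
    have h1 : (sqs (US S)).relIndex (US S) = Nat.card Ψ.range := by
      rw [← Subgroup.index_ker, hker]; rfl
    rw [h1]
    refine le_trans ?_ (card_hom_le (Kˣ ⧸ V))
    have hr : ∀ χ ∈ Ψ.range, V ≤ χ.ker := by
      rintro _ ⟨u, rfl⟩ x hx
      exact (hmV x).1 hx u u.2
    have hfin : Finite (Kˣ ⧸ V →* ℤˣ) := by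
      apply Finite.of_injective (fun f : Kˣ ⧸ V →* ℤˣ => (f : Kˣ ⧸ V → ℤˣ)) DFunLike.coe_injective
    apply Nat.card_le_card_of_injective (fun χ : Ψ.range => QuotientGroup.lift V χ.1 (hr χ.1 χ.2))
    intro a b hab
    apply Subtype.ext
    ext x
    have := DFunLike.congr_fun hab (x : Kˣ ⧸ V)
    exact congrArg Units.val (by simpa using this)
  have h1 := Subgroup.relIndex_mul_index (le_sup_right : PG ≤ US S ⊔ PG)
  have h2 : PG.relIndex (US S) = 2 ^ sz S := by
    rw [← Subgroup.inf_relIndex_right, sz, ← US_sq S hS.fin]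
    congr 1
    apply le_antisymm
    · intro x hx
      exact O3_T1 hS hx.2 fun w hw => mem_IX.1 hx.1 w hw
    · intro x hx
      obtain ⟨y, hy, rfl⟩ := mem_sqs.1 hx
      exact ⟨mem_IX.2 fun w _ => sq_mem_P w y, pow_mem hy 2⟩
  rw [Subgroup.relIndex_sup_right, h2] at h1
  have h3 : V.index ∣ (US S ⊔ PG).index := Subgroup.index_dvd_of_le (sup_le hUV hPV)
  have h4 : (US S ⊔ PG).index ≠ 0 := fun h => hPG0 (by rw [← h1, h, mul_zero])
  have h5 := Nat.le_of_dvd (Nat.pos_of_ne_zero h4) h3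
  rw [← h1, two_mul, pow_add]
  exact Nat.mul_le_mul_left _ (hcard.trans h5)

theorem O3 (w : Pl K) : ¬ Bad w := by
  intro hw
  have hS : ∃ S, Adq S ∧ w ∈ Sg S := by
    rcases w with v | s
    · obtain ⟨S, hF, hS⟩ := exists_adq (Set.finite_singleton v)
      exact ⟨S, hS, inl_mem_Sg.2 (hF rfl)⟩
    · obtain ⟨S, hF, hS⟩ := exists_adq (Set.finite_empty (α := FP K))
      exact ⟨S, hS, inr_mem_Sg⟩
  classical
  obtain ⟨S, hS, hwS⟩ := hS
  have h1 := O3_count hS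
  have hwX : w ∉ GX hS := fun h => ((mem_GX hS).1 h).2 hw
  have h2 : IX (Sg S) P ≤ IX ((insert w (GX hS) : Finset (Pl K)) : Set (Pl K)) P := by
    intro x hx
    rw [mem_IX]
    intro w' hw'
    apply mem_IX.1 hx
    rcases Finset.mem_insert.1 hw' with rfl | h
    · exact hwS
    · exact ((mem_GX hS).1 h).1
  have h3 := Subgroup.index_dvd_of_le h2
  rw [PS_index hS, IX_index _ (fun w => le_refl _), Finset.prod_insert hwX, ← IX_index _ (fun w => le_refl _)] at h3
  have h4 := Nat.le_of_dvd (by positivity) h3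
  have h5 := P_index_ge w
  have h6 : 0 < 2 ^ (2 * sz S) := by positivity
  nlinarith

theorem O2 {c : Kˣ} {v p : Pl K} (hv : c ∉ P v) (hp : c ∉ P p) (hne : v ≠ p) : ∃ e, Ram c e = {v, p} := by
  classical
  let F : Set (FP K) := Sum.inl ⁻¹' {v, p}
  have hF : F.Finite := Set.Finite.preimage Sum.inl_injective.injOn (by simp)
  obtain ⟨S, hFS, hS, hcS⟩ := exists_adq_unit hF {c} (Set.finite_singleton c)
  have hcS := hcS c rfl
  have hc := not_sq_of hv
  have hSg : ∀ w, w = v ∨ w = p → w ∈ Sg S := by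
    intro w hw
    rcases w with w | s
    · exact inl_mem_Sg.2 (hFS (by simpa [F] using hw))
    · exact inr_mem_Sg
  have hg : ∀ a : Pl K, a ∈ Sg S → c ∉ P a → ∃ g, g ∉ RS S c ∧ ∀ w ∈ Sg S, (g ∉ Nw w c ↔ w = a) := by
    intro a ha hca
    have : ∃ f, f ∉ Nw a c := by
      by_contra! h
      exact hca (Nw_nondeg h)
    obtain ⟨f, hf⟩ := this
    obtain ⟨g, hg⟩ := wa_sq (Sg S) (Sg_finite hS.fin) (fun w => if w = a then f else 1)
    have h1 : ∀ w ∈ Sg S, (g ∉ Nw w c ↔ w = a) := by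
      intro w hw
      have := hg w hw
      by_cases hwa : w = a
      · subst hwa
        rw [if_pos rfl] at this
        rw [← hs_neg_iff, hs_congr this, hs_neg_iff]
        simpa using hf
      · rw [if_neg hwa] at this
        have h2 : hs w c g = 1 := by rw [hs_congr this]; exact hs_P' (one_mem _) c
        simp [hwa, hs_one_iff.1 h2]
    refine ⟨g, fun h => ?_, h1⟩
    obtain ⟨e, he⟩ := RS_ram.1 h
    apply O3 a
    refine ⟨c, e, he.trans ?_⟩
    ext w
    rw [Set.mem_ofPred_eq, Set.mem_singleton_iff]
    constructor
    · rintro ⟨h2, h3⟩; exact (h1 w h2).1 h3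
    · rintro rfl; exact ⟨ha, (h1 w ha).2 rfl⟩
  obtain ⟨g1, hg1, hg1'⟩ := hg v (hSg v (Or.inl rfl)) hv
  obtain ⟨g2, hg2, hg2'⟩ := hg p (hSg p (Or.inr rfl)) hp
  have hm : g1 * g2 ∈ RS S c := (Subgroup.mul_mem_iff_of_index_two (RS_index hS hc hcS)).2 (by simp [hg1, hg2])
  obtain ⟨e, he⟩ := RS_ram.1 hm
  refine ⟨e, he.trans ?_⟩
  ext w
  rw [Set.mem_ofPred_eq, Set.mem_insert_iff, Set.mem_singleton_iff]
  constructor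
  · rintro ⟨h1, h2⟩
    by_contra! h3
    apply h2
    have a1 := (hg1' w h1).not.2 h3.1
    have a2 := (hg2' w h1).not.2 h3.2
    rw [not_not] at a1 a2
    exact mul_mem a1 a2
  · intro h
    have hw := hSg w h
    refine ⟨hw, ?_⟩
    rw [← hs_neg_iff, hs_mul]
    rcases h with rfl | rfl
    · rw [hs_neg_iff.2 ((hg1' w hw).2 rfl), hs_one_iff.2 (not_not.1 ((hg2' w hw).not.2 hne))]; rfl
    · rw [hs_neg_iff.2 ((hg2' w hw).2 rfl), hs_one_iff.2 (not_not.1 ((hg1' w hw).not.2 hne.symm))]; rfl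

end
end QF


namespace QF
open NumberField IsDedekindDomain HeightOneSpectrum

section
variable {K : Type*} [Field K] [NumberField K]

theorem cont_sq {K : Type*} [Field K] (v : AbsoluteValue K ℝ) (x0 : K) {ε : ℝ} (hε : 0 < ε) :
    ∃ δ > 0, ∀ x, v (x - x0) < δ → v (x ^ 2 - x0 ^ 2) < ε := by
  have h0 := v.nonneg x0
  refine ⟨min 1 (ε / (1 + 2 * v x0)), lt_min one_pos (by positivity), ?_⟩
  intro x hx
  have h1 := lt_of_lt_of_le hx (min_le_left _ _)
  have h2 := lt_of_lt_of_le hx (min_le_right _ _)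
  rw [lt_div_iff₀ (by positivity)] at h2
  have e : x ^ 2 - x0 ^ 2 = (x - x0) * ((x - x0) + 2 * x0) := by ring
  rw [e, map_mul]
  have h3 : v ((x - x0) + 2 * x0) ≤ 1 + 2 * v x0 := by
    refine (v.add_le _ _).trans (add_le_add h1.le ?_)
    rw [map_mul]
    have : v (2 : K) ≤ 2 := by
      have := v.add_le 1 1
      rw [map_one] at this
      norm_num at this
      exact this
    nlinarith
  exact lt_of_le_of_lt (mul_le_mul_of_nonneg_left h3 (v.nonneg _)) h2

theorem sqApprox (F : Set (Pl K)) (hF : F.Finite) (Q : Pl K → Kˣ) (hQ : ∀ w ∈ F, Q w ∈ P w) (ε : Pl K → ℝ) (hε : ∀ w ∈ F, 0 < ε w) :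
    ∃ y : K, ∀ w ∈ F, abv w (y ^ 2 - Q w) < ε w := by
  have key : ∀ w, ∃ (s : K) (δ : ℝ), w ∈ F → (0 < δ ∧ ∀ x, abv w (x - s) < δ → abv w (x ^ 2 - Q w) < ε w) := by
    intro w
    by_cases hw : w ∈ F
    · obtain ⟨s, hs⟩ := exists_sq_near (hQ w hw) (half_pos (hε w hw))
      obtain ⟨δ, hδ, h⟩ := cont_sq (abv w) s (half_pos (hε w hw))
      refine ⟨s, δ, fun _ => ⟨hδ, fun x hx => ?_⟩⟩
      have e : x ^ 2 - (Q w : K) = (x ^ 2 - s ^ 2) + (s ^ 2 - Q w) := by ring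
      rw [e]
      exact lt_of_le_of_lt ((abv w).add_le _ _) (by linarith [h x hx])
    · exact ⟨0, 0, fun h => absurd h hw⟩
  choose s δ h using key
  obtain ⟨x, hx⟩ := wa F hF s δ (fun w hw => (h w hw).1)
  exact ⟨x, fun w hw => (h w hw).2 x (hx w hw)⟩

theorem nrmApprox (c : Kˣ) (F : Set (Pl K)) (hF : F.Finite) (Q : Pl K → Kˣ) (hQ : ∀ w ∈ F, Q w ∈ Nw w c) (ε : Pl K → ℝ) (hε : ∀ w ∈ F, 0 < ε w) :
    ∃ y z : K, ∀ w ∈ F, abv w (y ^ 2 - c * z ^ 2 - Q w) < ε w := by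
  have key : ∀ w, ∃ (y z : K) (δ : ℝ), w ∈ F → (0 < δ ∧ ∀ y' z', abv w (y' - y) < δ → abv w (z' - z) < δ → 
      abv w (y' ^ 2 - c * z' ^ 2 - Q w) < ε w) := by
    intro w
    by_cases hw : w ∈ F
    · obtain ⟨p, hp, n, hn, hpn⟩ := mem_locN_iff.1 (hQ w hw)
      obtain ⟨y0, z0, hyz⟩ := mem_nrm.1 hn
      have hn0 : 0 < abv w (n : K) := (abv w).pos n.ne_zero
      have hc0 : 0 < abv w (c : K) := (abv w).pos c.ne_zero
      have hε' := hε w hw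
      obtain ⟨s, hs⟩ := exists_sq_near hp (show 0 < ε w / 3 / abv w (n : K) by positivity)
      obtain ⟨δ1, hδ1, h1⟩ := cont_sq (abv w) (s * y0) (show 0 < ε w / 3 by positivity)
      obtain ⟨δ2, hδ2, h2⟩ := cont_sq (abv w) (s * z0) (show 0 < ε w / 3 / abv w (c : K) by positivity)
      refine ⟨s * y0, s * z0, min δ1 δ2, fun _ => ⟨lt_min hδ1 hδ2, fun y' z' hy hz => ?_⟩⟩
      have a1 := h1 y' (hy.trans_le (min_le_left _ _))
      have a2 := h2 z' (hz.trans_le (min_le_right _ _))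
      rw [lt_div_iff₀ hc0] at a2
      rw [lt_div_iff₀ hn0] at hs
      have e : y' ^ 2 - c * z' ^ 2 - (Q w : K) = ((y' ^ 2 - (s * y0) ^ 2) - (z' ^ 2 - (s * z0) ^ 2) * c) + (s ^ 2 - p) * n := by
        rw [← hpn]; push_cast
        linear_combination (-s ^ 2) * hyz
      rw [e]
      have b1 := (abv w).add_le ((y' ^ 2 - (s * y0) ^ 2) - (z' ^ 2 - (s * z0) ^ 2) * c) ((s ^ 2 - p) * n)
      have b2 := (abv w).add_le (y' ^ 2 - (s * y0) ^ 2) (-((z' ^ 2 - (s * z0) ^ 2) * c))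
      rw [← sub_eq_add_neg, map_neg_eq_map] at b2
      rw [map_mul] at b1 b2
      linarith
    · exact ⟨0, 0, 0, fun h => absurd h hw⟩
  choose y z δ h using key
  obtain ⟨y', hy⟩ := wa F hF y δ (fun w hw => (h w hw).1)
  obtain ⟨z', hz⟩ := wa F hF z δ (fun w hw => (h w hw).1)
  exact ⟨y', z', fun w hw => (h w hw).2 _ _ (hy w hw) (hz w hw)⟩

theorem WAnrm (c : Kˣ) (F : Set (Pl K)) (hF : F.Finite) (hne : F.Nonempty) (Q : Pl K → Kˣ) (hQ : ∀ w ∈ F, Q w ∈ Nw w c) :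
    ∃ n ∈ nrm c, ∀ w ∈ F, (Q w)⁻¹ * n ∈ P w := by
  choose ε hε H using fun w : Pl K => (hens w).near (Q w)
  obtain ⟨y, z, h⟩ := nrmApprox c F hF Q hQ ε (fun w _ => hε w)
  obtain ⟨w0, hw0⟩ := hne
  obtain ⟨h0, -⟩ := H w0 _ (h w0 hw0)
  refine ⟨Units.mk0 _ h0, mem_nrm.2 ⟨y, z, rfl⟩, fun w hw => (H w _ (h w hw)).2⟩

/-- isotropy of a diagonal form -/
def Iso {K : Type*} [Field K] {m : ℕ} (a : Fin m → K) : Prop := ∃ x : Fin m → K, x ≠ 0 ∧ ∑ i, a i * x i ^ 2 = 0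

/-- local isotropy -/
def IsoW {m : ℕ} (w : Pl K) (a : Fin m → Kˣ) : Prop :=
  ∃ a' : Fin m → Kˣ, (∀ i, (a i)⁻¹ * a' i ∈ P w) ∧ Iso (fun i => (a' i : K))

theorem IsoW.congr {m : ℕ} {w : Pl K} {a b : Fin m → Kˣ} (h : ∀ i, (a i)⁻¹ * b i ∈ P w) (ha : IsoW w a) : IsoW w b := by
  obtain ⟨a', ha', hi⟩ := ha
  refine ⟨a', fun i => ?_, hi⟩
  have e : (b i)⁻¹ * a' i = ((a i)⁻¹ * b i)⁻¹ * ((a i)⁻¹ * a' i) := by group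
  rw [e]
  exact mul_mem (inv_mem (h i)) (ha' i)

theorem Iso.isoW {m : ℕ} {a : Fin m → Kˣ} (h : Iso (fun i => (a i : K))) (w : Pl K) : IsoW w a :=
  ⟨a, fun i => by simp [one_mem], h⟩

theorem nrm_of_sq {c : Kˣ} {y : K} (h : (c : K) = y ^ 2) : nrm c = ⊤ := by
  obtain ⟨z, rfl⟩ := isSquare_units ⟨y, by rw [h, pow_two]⟩
  exact nrm_sq z

theorem iso3_nrm {a b c : Kˣ} {x y z : K} (h0 : ¬ (x = 0 ∧ y = 0 ∧ z = 0)) (h : (a : K) * x ^ 2 + b * y ^ 2 + c * z ^ 2 = 0) :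
    -(a * c) ∈ nrm (-(a * b)) := by
  by_cases hz : z = 0
  · subst hz
    have hy : y ≠ 0 := by
      rintro rfl
      have : (a : K) * x ^ 2 = 0 := by linear_combination h
      simp at this
      exact h0 ⟨this, rfl, rfl⟩
    rw [nrm_of_sq (y := a * x / y)]
    · trivial
    · push_cast
      field_simp
      linear_combination -h
  · rw [mem_nrm]
    refine ⟨a * x / z, y / z, ?_⟩
    push_cast
    field_simp
    linear_combination -h

/-- the three invariants of a quaternary form -/
def Q4 (a : Fin 4 → K) : Prop := Dv (-(a 0 * a 1)) (-(a 0 * a 2)) (a 0 * a 1 * a 2 * a 3)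

theorem iso4_iff {a : Fin 4 → Kˣ} : Iso (fun i => (a i : K)) ↔ Dv (((-(a 0 * a 1) : Kˣ)) : K) ((-(a 0 * a 2) : Kˣ) : K) ((a 0 * a 1 * a 2 * a 3 : Kˣ) : K) := by
  constructor
  · rintro ⟨x, hx, h⟩
    simp only [Fin.sum_univ_four] at h
    by_cases h3 : x 3 = 0
    · apply D_of
      have hn : -(a 0 * a 2) ∈ nrm (-(a 0 * a 1)) := by
        apply iso3_nrm (x := x 0) (y := x 1) (z := x 2)
        · rintro ⟨h0, h1, h2⟩
          apply hx
          ext i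
          fin_cases i <;> simp [h0, h1, h2, h3]
        · rw [h3] at h; linear_combination h
      intro w hw
      exact absurd (nrm_le_locN _ _ hn) hw
    · refine ⟨a 2 * (x 2 / x 3), a 1 * (x 1 / x 3), x 0 / x 3, ?_⟩
      push_cast
      field_simp
      linear_combination h
  · rintro ⟨u, v, t, h⟩
    refine ⟨![t, v / a 1, u / a 2, 1], fun h0 => ?_, ?_⟩
    · have := congrFun h0 3
      simp at this
    · simp only [Fin.sum_univ_four]
      push_cast at h
      have h0 := (a 0).ne_zero
      have h1 := (a 1).ne_zero
      have h2 := (a 2).ne_zero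
      simp
      field_simp
      apply mul_left_cancel₀ h0
      linear_combination h

/-- local anisotropy of quaternary forms -/
def Bad4 (w : Pl K) (a : Fin 4 → Kˣ) : Prop := a 0 * a 1 * a 2 * a 3 ∈ P w ∧ hs w (-(a 0 * a 1)) (-(a 0 * a 2)) = -1

theorem iso4_bad {a : Fin 4 → Kˣ} : Iso (fun i => (a i : K)) ↔ ∀ w, ¬ Bad4 w a := by
  rw [iso4_iff, D_iff]
  simp only [mem_Ram, Bad4, not_and]
  exact ⟨fun h w h1 h2 => h w h2 h1, fun h w h1 h2 => h w h2 h1⟩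

theorem hs_congr2 {w : Pl K} {c e c' e' : Kˣ} (h : c⁻¹ * c' ∈ P w) (h' : e⁻¹ * e' ∈ P w) : hs w c' e' = hs w c e := by
  rw [hs_congr h', hs_comm, hs_congr h, hs_comm]

theorem P_mulc {w : Pl K} {a b a' b' : Kˣ} (h : a⁻¹ * a' ∈ P w) (h' : b⁻¹ * b' ∈ P w) : (a * b)⁻¹ * (a' * b') ∈ P w := by
  have e : (a * b)⁻¹ * (a' * b') = (a⁻¹ * a') * (b⁻¹ * b') := by
    rw [mul_inv]; simp only [mul_assoc, mul_comm, mul_left_comm]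
  rw [e]; exact mul_mem h h'

theorem P_mem_congr {w : Pl K} {a a' : Kˣ} (h : a⁻¹ * a' ∈ P w) (ha : a ∈ P w) : a' ∈ P w := by
  have := mul_mem ha h
  simpa using this

theorem P_symm {w : Pl K} {a a' : Kˣ} (h : a⁻¹ * a' ∈ P w) : a'⁻¹ * a ∈ P w := by
  have := inv_mem h
  simpa using this

theorem P_negc {w : Pl K} {a a' : Kˣ} (h : a⁻¹ * a' ∈ P w) : (-a)⁻¹ * (-a') ∈ P w := by
  simpa [inv_neg] using h

theorem Bad4.congr {w : Pl K} {a b : Fin 4 → Kˣ} (h : ∀ i, (a i)⁻¹ * b i ∈ P w) (ha : Bad4 w a) : Bad4 w b := by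
  refine ⟨P_mem_congr (P_mulc (P_mulc (P_mulc (h 0) (h 1)) (h 2)) (h 3)) ha.1, ?_⟩
  rw [hs_congr2 (P_negc (P_mulc (h 0) (h 1))) (P_negc (P_mulc (h 0) (h 2)))]
  exact ha.2

theorem odd3 {m : ℕ} {v : FP K} (h2 : abv (.inl v) (2 : K) = 1) {a : Fin m → Kˣ} {i j k : Fin m} (hij : i ≠ j) (hik : i ≠ k) (hjk : j ≠ k)
    (h1 : Even ((ord v (a i)).toAdd + (ord v (a j)).toAdd)) (h3 : Even ((ord v (a i)).toAdd + (ord v (a k)).toAdd)) : IsoW (.inl v) a := by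
  have hneg : ∀ x : Kˣ, ord v (-x) = ord v x := by
    intro x
    have : ord v ((-1 : Kˣ) ) = 1 := by
      rw [← fabv_eq_one_iff]; simp
    have e : -x = (-1) * x := by simp
    rw [e, map_mul, this, one_mul]
  have hN : -(a i * a k) ∈ Nw (.inl v) (-(a i * a j)) := by
    apply odd_even h2
    · rw [hneg, map_mul, toAdd_mul]; exact h1
    · rw [hneg, map_mul, toAdd_mul]; exact h3
  obtain ⟨p, hp, n, hn, hpn⟩ := mem_locN_iff.1 hN
  obtain ⟨y, z, hyz⟩ := mem_nrm.1 hn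
  refine ⟨Function.update a k (a k * p⁻¹), fun l => ?_, ?_⟩
  · by_cases hl : l = k
    · subst hl; simpa using hp
    · simp [hl, one_mem]
  · refine ⟨Function.update (Function.update (Pi.single i (y / a i)) j z) k 1, fun h0 => ?_, ?_⟩
    · have := congrFun h0 k
      simp at this
    · have hs : ∀ l ∉ ({i, j, k} : Finset (Fin m)), ((Function.update a k (a k * p⁻¹) l : Kˣ) : K) * 
          (Function.update (Function.update (Pi.single i (y / a i)) j z) k 1 : Fin m → K) l ^ 2 = 0 := by
        intro l hl
        simp only [Finset.mem_insert, Finset.mem_singleton, not_or] at hl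
        simp [hl.1, hl.2.1, hl.2.2]
      rw [← Finset.sum_subset (Finset.subset_univ {i, j, k}) (fun l _ => hs l)]
      rw [Finset.sum_insert (by simp [hij, hik]), Finset.sum_insert (by simp [hjk]), Finset.sum_singleton]
      simp [hij, hik, hjk, hij.symm, hik.symm, hjk.symm]
      have hpn' := congrArg (Units.val) hpn
      push_cast at hpn'
      have h0 := (a i).ne_zero
      have hp0 := p.ne_zero
      push_cast at hyz
      rw [hyz] at hpn'
      field_simp
      linear_combination hpn'

theorem pig5 : ∀ f : Fin 5 → Bool, ∃ i j k : Fin 5, i ≠ j ∧ i ≠ k ∧ j ≠ k ∧ f i = f j ∧ f i = f k := by decide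

theorem odd5 {m : ℕ} (hm : 5 ≤ m) {v : FP K} (h2 : abv (.inl v) (2 : K) = 1) (a : Fin m → Kˣ) : IsoW (.inl v) a := by
  classical
  obtain ⟨i, j, k, h1, h3, h4, h5, h6⟩ := pig5 (fun i => decide (Even (ord v (a (Fin.castLE hm i))).toAdd))
  have inj := Fin.castLE_injective hm
  refine odd3 h2 (inj.ne h1) (inj.ne h3) (inj.ne h4) ?_ ?_
  · rw [Int.even_add]; simpa using h5
  · rw [Int.even_add]; simpa using h6

theorem loc_step {K : Type*} [Field K] [NumberField K] {n : ℕ} {a : Fin (n + 3) → Kˣ} (h : Iso (fun i => (a i : K))) :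
    ∃ t : Kˣ, a 0 * t ∈ nrm (-(a 0 * a 1)) ∧ Iso (fun i => ((Fin.cons t (fun i => a i.succ.succ) : Fin (n + 2) → Kˣ) i : K)) := by
  obtain ⟨x, hx, h⟩ := h
  rw [Fin.sum_univ_succ, Fin.sum_univ_succ] at h
  have h01 : (Fin.succ 0 : Fin (n + 3)) = 1 := rfl
  rw [h01] at h
  by_cases hT : (a 0 : K) * x 0 ^ 2 + a 1 * x 1 ^ 2 = 0
  · by_cases h1 : x 1 = 0
    · have h0 : x 0 = 0 := by simpa [h1] using hT
      refine ⟨a 0, mem_nrm.2 ⟨a 0, 0, by push_cast; ring⟩, Fin.cons 0 (fun i => x i.succ.succ), fun h2 => hx ?_, ?_⟩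
      · ext i
        refine Fin.cases h0 (fun i => Fin.cases h1 (fun i => ?_) i) i
        have := congrFun h2 i.succ
        simpa using this
      · rw [Fin.sum_univ_succ]
        simp only [Fin.cons_zero, Fin.cons_succ]
        rw [h0, h1] at h
        linear_combination h
    · refine ⟨-a 2, ?_, Fin.cons 1 (Pi.single 0 1), fun h2 => ?_, ?_⟩
      · rw [nrm_of_sq (y := a 0 * x 0 / x 1)]
        · trivial
        · push_cast; field_simp; linear_combination -hT
      · have := congrFun h2 0
        simp at this
      · rw [Fin.sum_univ_succ]
        simp only [Fin.cons_zero, Fin.cons_succ]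
        rw [Finset.sum_eq_single 0]
        · simp
        · intro b _ hb
          simp [hb]
        · simp
  · refine ⟨Units.mk0 _ hT, mem_nrm.2 ⟨a 0 * x 0, x 1, by push_cast; simp; ring⟩, Fin.cons 1 (fun i => x i.succ.succ), fun h2 => ?_, ?_⟩
    · have := congrFun h2 0
      simp at this
    · rw [Fin.sum_univ_succ]
      simp only [Fin.cons_zero, Fin.cons_succ, Units.val_mk0]
      linear_combination h

theorem glob_step {n : ℕ} {a : Fin (n + 2) → Kˣ} {t : Kˣ} (ht : a 0 * t ∈ nrm (-(a 0 * a 1)))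
    (h : Iso (fun i => ((Fin.cons t (fun i => a i.succ.succ) : Fin (n + 1) → Kˣ) i : K))) : Iso (fun i => (a i : K)) := by
  obtain ⟨y, z, hyz⟩ := mem_nrm.1 ht
  obtain ⟨x, hx, hs⟩ := h
  rw [Fin.sum_univ_succ] at hs
  simp only [Fin.cons_zero, Fin.cons_succ] at hs
  have h0 := (a 0).ne_zero
  push_cast at hyz
  refine ⟨Fin.cons (x 0 * (y / a 0)) (Fin.cons (x 0 * z) (fun i => x i.succ)), fun h2 => hx ?_, ?_⟩
  · have e0 := congrFun h2 0
    have e1 := congrFun h2 (Fin.succ 0)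
    have hx0 : x 0 = 0 := by
      by_contra hx0
      simp [hx0] at e0 e1
      rw [e0, e1] at hyz
      simp at hyz
    ext i
    refine Fin.cases hx0 (fun i => ?_) i
    have := congrFun h2 i.succ.succ
    simpa using this
  · rw [Fin.sum_univ_succ, Fin.sum_univ_succ]
    simp only [Fin.cons_zero, Fin.cons_succ]
    have h01 : (Fin.succ 0 : Fin (n + 2)) = 1 := rfl
    rw [h01]
    have : (a 0 : K) * (x 0 * (y / a 0)) ^ 2 + a 1 * (x 0 * z) ^ 2 = t * x 0 ^ 2 := by
      field_simp
      linear_combination (-x 0 ^ 2) * hyz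
    linear_combination hs + this

theorem HM {n : ℕ} (a : Fin (n + 4) → Kˣ) (h : ∀ w, IsoW w a) : Iso (fun i => (a i : K)) := by
  induction n with
  | zero =>
    rw [iso4_bad]
    intro w hb
    obtain ⟨a', ha', hi⟩ := h w
    exact iso4_bad.1 hi w (hb.congr ha')
  | succ n ih =>
    obtain ⟨S, -, hS, hU⟩ := exists_adq_unit (Set.finite_empty (α := FP K)) (Set.range a) (Set.finite_range a)
    have hloc : ∀ w, ∃ t : Kˣ, a 0 * t ∈ Nw w (-(a 0 * a 1)) ∧ IsoW w (Fin.cons t (fun i => a i.succ.succ) : Fin (n + 4) → Kˣ) := by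
      intro w
      obtain ⟨a', ha', hi⟩ := h w
      obtain ⟨t, ht, hi2⟩ := loc_step hi
      refine ⟨t, ?_, (hi2.isoW w).congr ?_⟩
      · rw [← hs_one_iff, ← hs_congr2 (P_negc (P_mulc (ha' 0) (ha' 1))) (P_mulc (ha' 0) (by simp [one_mem] : t⁻¹ * t ∈ P w))]
        exact hs_nrm ht
      · intro i
        refine Fin.cases ?_ (fun i => ?_) i
        · simp [one_mem]
        · simp only [Fin.cons_succ]
          exact P_symm (ha' _)
    choose t ht hti using hloc
    -- ensure nonempty
    obtain ⟨v0, -⟩ : ∃ v : FP K, True := by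
      obtain ⟨c, hc⟩ : ∃ c : Kˣ, ¬ IsSquare (c : K) := by
        by_contra! hall
        have h1 := PS_index hS
        have : IX (Sg S) P = ⊤ := by
          rw [eq_top_iff]
          intro x _
          obtain ⟨y, rfl⟩ := isSquare_units (hall x)
          exact mem_IX.2 fun w _ => sq_mem_P w y
        rw [this, Subgroup.index_top] at h1
        have := sz_pos S
        have h3 : 1 < 2 ^ (2 * sz S) := Nat.one_lt_two_pow (by omega)
        omega
      obtain ⟨v, -, -⟩ := GS hc (Set.finite_empty (α := FP K))
      exact ⟨v, trivial⟩
    obtain ⟨nn, hn, hnn⟩ := WAnrm (-(a 0 * a 1)) (insert (.inl v0) (Sg S)) ((Sg_finite hS.fin).insert _) ⟨_, Or.inl rfl⟩ (fun w => a 0 * t w) (fun w _ => ht w)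
    have hat : a 0 * (a 0 * nn) ∈ nrm (-(a 0 * a 1)) := by
      have e : a 0 * (a 0 * nn) = a 0 ^ 2 * nn := by rw [← mul_assoc, pow_two]
      rw [e]; exact mul_mem (sq_mem_nrm _ _) hn
    apply glob_step hat
    apply ih
    intro w
    by_cases hw : w ∈ Sg S
    · refine (hti w).congr ?_
      intro i
      refine Fin.cases ?_ (fun i => ?_) i
      · simp only [Fin.cons_zero]
        have := mul_mem (hnn w (Or.inr hw)) (sq_mem_P w (a 0))
        have e : (t w)⁻¹ * (a 0 * nn) = (a 0 * t w)⁻¹ * nn * a 0 ^ 2 := by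
          rw [mul_inv, pow_two]
          calc (t w)⁻¹ * (a 0 * nn) = ((a 0)⁻¹ * a 0) * ((t w)⁻¹ * (a 0 * nn)) := by simp
            _ = _ := by simp only [mul_assoc, mul_comm, mul_left_comm]
        rw [e]; exact this
      · simp [one_mem]
    · rcases w with v | s
      · have hv : v ∉ S := fun h => hw (inl_mem_Sg.2 h)
        have hu : ∀ i, (ord v (a i)).toAdd = 0 := fun i => by
          rw [mem_US.1 (hU (a i) ⟨i, rfl⟩) v hv]; rfl
        have h12 : (Fin.succ (⟨0, by omega⟩ : Fin (n + 3)) : Fin (n + 4)) ≠ Fin.succ (⟨1, by omega⟩ : Fin (n + 3)) := fun h => by have := congrArg Fin.val h; simp only [Fin.val_succ] at this; omega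
        have h13 : (Fin.succ (⟨0, by omega⟩ : Fin (n + 3)) : Fin (n + 4)) ≠ Fin.succ (⟨2, by omega⟩ : Fin (n + 3)) := fun h => by have := congrArg Fin.val h; simp only [Fin.val_succ] at this; omega
        have h23 : (Fin.succ (⟨1, by omega⟩ : Fin (n + 3)) : Fin (n + 4)) ≠ Fin.succ (⟨2, by omega⟩ : Fin (n + 3)) := fun h => by have := congrArg Fin.val h; simp only [Fin.val_succ] at this; omega
        refine odd3 (hS.dy v hv) h12 h13 h23 ?_ ?_ <;>
        · simp only [Fin.cons_succ, hu]; simp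
      · exact absurd inr_mem_Sg hw

/-- real and dyadic places -/
def RD (K : Type*) [Field K] [NumberField K] : Set (Pl K) := Sg {v : FP K | abv (.inl v) (2 : K) ≠ 1}

theorem RD_finite : (RD K).Finite := Sg_finite dyadic_finite

theorem HM5 {m : ℕ} (hm : 5 ≤ m) (a : Fin m → Kˣ) : Iso (fun i => (a i : K)) ↔ ∀ w ∈ RD K, IsoW w a := by
  refine ⟨fun h w _ => h.isoW w, fun h => ?_⟩
  obtain ⟨n, rfl⟩ := Nat.exists_eq_add_of_le' (show 4 ≤ m by omega)
  apply HM
  intro w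
  by_cases hw : w ∈ RD K
  · exact h w hw
  · rcases w with v | s
    · refine odd5 hm ?_ a
      by_contra h2
      exact hw (inl_mem_Sg.2 h2)
    · exact absurd inr_mem_Sg hw

end
end QF


namespace QF
open NumberField IsDedekindDomain HeightOneSpectrum

section
variable {K : Type*} [Field K] [NumberField K]

theorem exists_finite_place (K : Type*) [Field K] [NumberField K] : Nonempty (FP K) := by
  have hnf : ¬ IsField (𝓞 K) := RingOfIntegers.not_isField K
  obtain ⟨I, h0, h1⟩ := Ring.not_isField_iff_exists_prime.1 hnf
  exact ⟨⟨I, h1, h0⟩⟩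

/-- diophantine predicates -/
def Di {K : Type*} [Field K] {ι : Type} (p : (ι → K) → Prop) : Prop :=
  ∃ (σ : Type) (_ : Finite σ) (f : MvPolynomial (ι ⊕ σ) K),
    ∀ a, p a ↔ ∃ x : σ → K, MvPolynomial.eval (Sum.elim a x) f = 0

/-- polynomial functions -/
def Po {K : Type*} [Field K] {ι : Type} (g : (ι → K) → K) : Prop :=
  ∃ q : MvPolynomial ι K, ∀ a, g a = MvPolynomial.eval a q

end

section
variable {K : Type*} [Field K] {ι κ : Type} {g h : (ι → K) → K} {p q : (ι → K) → Prop}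

theorem Po.const (k : K) : Po (fun _ : ι → K => k) := ⟨MvPolynomial.C k, by simp⟩
theorem Po.coord (i : ι) : Po (fun a : ι → K => a i) := ⟨MvPolynomial.X i, by simp⟩
theorem Po.add (hg : Po g) (hh : Po h) : Po (fun a => g a + h a) := by
  obtain ⟨q, hq⟩ := hg; obtain ⟨r, hr⟩ := hh; exact ⟨q + r, by simp [hq, hr]⟩
theorem Po.sub (hg : Po g) (hh : Po h) : Po (fun a => g a - h a) := by
  obtain ⟨q, hq⟩ := hg; obtain ⟨r, hr⟩ := hh; exact ⟨q - r, by simp [hq, hr]⟩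
theorem Po.mul (hg : Po g) (hh : Po h) : Po (fun a => g a * h a) := by
  obtain ⟨q, hq⟩ := hg; obtain ⟨r, hr⟩ := hh; exact ⟨q * r, by simp [hq, hr]⟩
theorem Po.neg (hg : Po g) : Po (fun a => - g a) := by
  obtain ⟨q, hq⟩ := hg; exact ⟨-q, by simp [hq]⟩
theorem Po.pow (hg : Po g) (n : ℕ) : Po (fun a => g a ^ n) := by
  obtain ⟨q, hq⟩ := hg; exact ⟨q ^ n, by simp [hq]⟩
theorem Po.prod (s : Finset κ) {g : κ → (ι → K) → K} (hg : ∀ j, Po (g j)) : Po (fun a => ∏ j ∈ s, g j a) := by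
  choose q hq using hg
  exact ⟨∏ j ∈ s, q j, by simp [hq]⟩

theorem Di.congr (hp : Di p) (h : ∀ a, q a ↔ p a) : Di q := by
  obtain ⟨σ, i, f, hf⟩ := hp
  exact ⟨σ, i, f, fun a => (h a).trans (hf a)⟩

theorem Di.isDiophantine [Fintype ι] (hp : Di p) : IsDiophantine {a | p a} := by
  obtain ⟨σ, _, f, hf⟩ := hp
  have := Fintype.ofFinite σ
  let e := Fintype.equivFin σ
  refine ⟨Fintype.card σ, MvPolynomial.rename (Sum.map id e) f, fun a => ?_⟩
  simp only [Set.mem_ofPred_eq, hf, MvPolynomial.eval_rename]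
  constructor
  · rintro ⟨x, hx⟩
    refine ⟨x ∘ e.symm, ?_⟩
    rw [← hx]
    congr 1
    congr 1
    ext i; rcases i with i | i <;> simp
  · rintro ⟨x, hx⟩
    refine ⟨x ∘ e, ?_⟩
    rw [← hx]
    congr 1
    congr 1
    ext i; rcases i with i | i <;> simp

theorem Di.eq0 (hg : Po g) : Di (fun a => g a = 0) := by
  obtain ⟨q, hq⟩ := hg
  refine ⟨Empty, inferInstance, MvPolynomial.rename Sum.inl q, fun a => ?_⟩
  simp only [hq, MvPolynomial.eval_rename]
  have : ∀ x : Empty → K, (Sum.elim a x) ∘ Sum.inl = a := fun x => by ext; simp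
  simp [this]

theorem Di.eq (hg : Po g) (hh : Po h) : Di (fun a => g a = h a) :=
  (Di.eq0 (hg.sub hh)).congr fun a => by rw [sub_eq_zero]

theorem Di.comp {p : (κ → K) → Prop} (hp : Di p) {g : (ι → K) → κ → K} (hg : ∀ j, Po (fun a => g a j)) : Di (fun a => p (g a)) := by
  obtain ⟨σ, i, f, hf⟩ := hp
  choose q hq using hg
  refine ⟨σ, i, MvPolynomial.bind₁ (Sum.elim (fun j => MvPolynomial.rename Sum.inl (q j)) (fun s => MvPolynomial.X (Sum.inr s))) f, fun a => ?_⟩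
  refine (hf _).trans ?_
  refine exists_congr fun x => ?_
  rw [← MvPolynomial.coe_aeval_eq_eval, ← MvPolynomial.coe_aeval_eq_eval]
  simp only [RingHom.coe_coe, MvPolynomial.aeval_bind₁]
  have : (Sum.elim (g a) x) = fun i => (MvPolynomial.aeval (Sum.elim a x)) ((Sum.elim (fun j => MvPolynomial.rename Sum.inl (q j)) (fun s => MvPolynomial.X (Sum.inr s)) : κ ⊕ σ → MvPolynomial (ι ⊕ σ) K) i) := by
    ext i
    rcases i with i | i
    · simp [MvPolynomial.aeval_rename, hq, MvPolynomial.aeval_eq_eval]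
    · simp
  rw [this]

theorem Di.ex {p : (ι → K) → (κ → K) → Prop} [Finite κ] (hp : Di (fun b : ι ⊕ κ → K => p (fun i => b (.inl i)) (fun j => b (.inr j)))) :
    Di (fun a => ∃ x, p a x) := by
  obtain ⟨σ, i, f, hf⟩ := hp
  refine ⟨κ ⊕ σ, inferInstance, MvPolynomial.rename (Equiv.sumAssoc ι κ σ) f, fun a => ?_⟩
  simp only [MvPolynomial.eval_rename]
  constructor
  · rintro ⟨x, hx⟩
    obtain ⟨y, hy⟩ := (hf (Sum.elim a x)).1 (by simpa using hx)
    refine ⟨Sum.elim x y, ?_⟩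
    rw [← hy]
    congr 2
    ext i; rcases i with (i | i) | i <;> simp
  · rintro ⟨x, hx⟩
    refine ⟨fun i => x (.inl i), ?_⟩
    have := (hf (Sum.elim a (fun i => x (.inl i)))).2 ⟨fun i => x (.inr i), ?_⟩
    · simpa using this
    · rw [← hx]
      congr 2
      ext i; rcases i with (i | i) | i <;> simp

theorem Di.ne0 (hg : Po g) : Di (fun a => g a ≠ 0) := by
  have : Di (fun a => ∃ y : Fin 1 → K, g a * y 0 = 1) := by
    apply Di.ex (p := fun a y => g a * y 0 = 1)
    apply Di.eq
    · apply Po.mul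
      · obtain ⟨q, hq⟩ := hg
        exact ⟨MvPolynomial.rename Sum.inl q, fun a => by simp only [hq, MvPolynomial.eval_rename]; rfl⟩
      · exact Po.coord _
    · exact Po.const _
  refine this.congr fun a => ⟨fun h => ⟨fun _ => (g a)⁻¹, mul_inv_cancel₀ h⟩, ?_⟩
  rintro ⟨y, hy⟩ h0
  simp [h0] at hy

theorem Di.and0 {k : K} (hk : ¬ IsSquare k) (hp : Di p) (hq : Di q) : Di (fun a => p a ∧ q a) := by
  obtain ⟨σ, _, f, hf⟩ := hp
  obtain ⟨τ, _, g, hg⟩ := hq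
  refine ⟨σ ⊕ τ, inferInstance, MvPolynomial.rename (Sum.map id Sum.inl) f ^ 2 - MvPolynomial.C k * MvPolynomial.rename (Sum.map id Sum.inr) g ^ 2, fun a => ?_⟩
  have key : ∀ y z : K, y ^ 2 - k * z ^ 2 = 0 ↔ y = 0 ∧ z = 0 := by
    intro y z
    constructor
    · intro h
      have hz : z = 0 := by
        by_contra hz
        apply hk
        refine ⟨y / z, ?_⟩
        field_simp
        linear_combination -h
      subst hz
      simpa using h
    · rintro ⟨rfl, rfl⟩; simp
  have e1 : ∀ x : σ ⊕ τ → K, Sum.elim a x ∘ Sum.map id Sum.inl = Sum.elim a (x ∘ Sum.inl) := fun x => by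
    ext i; rcases i with i | i <;> simp
  have e2 : ∀ x : σ ⊕ τ → K, Sum.elim a x ∘ Sum.map id Sum.inr = Sum.elim a (x ∘ Sum.inr) := fun x => by
    ext i; rcases i with i | i <;> simp
  simp only [map_sub, map_mul, map_pow, MvPolynomial.eval_C, key, MvPolynomial.eval_rename, e1, e2, hf, hg]
  constructor
  · rintro ⟨⟨x, hx⟩, ⟨y, hy⟩⟩
    exact ⟨Sum.elim x y, by simpa using hx, by simpa using hy⟩
  · rintro ⟨x, h1, h2⟩
    exact ⟨⟨_, h1⟩, ⟨_, h2⟩⟩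

theorem Di.or (hp : Di p) (hq : Di q) : Di (fun a => p a ∨ q a) := by
  obtain ⟨σ, _, f, hf⟩ := hp
  obtain ⟨τ, _, g, hg⟩ := hq
  refine ⟨σ ⊕ τ, inferInstance, MvPolynomial.rename (Sum.map id Sum.inl) f * MvPolynomial.rename (Sum.map id Sum.inr) g, fun a => ?_⟩
  have e1 : ∀ x : σ ⊕ τ → K, Sum.elim a x ∘ Sum.map id Sum.inl = Sum.elim a (x ∘ Sum.inl) := fun x => by
    ext i; rcases i with i | i <;> simp
  have e2 : ∀ x : σ ⊕ τ → K, Sum.elim a x ∘ Sum.map id Sum.inr = Sum.elim a (x ∘ Sum.inr) := fun x => by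
    ext i; rcases i with i | i <;> simp
  simp only [map_mul, mul_eq_zero, MvPolynomial.eval_rename, e1, e2, hf, hg]
  constructor
  · rintro (⟨x, hx⟩ | ⟨y, hy⟩)
    · exact ⟨Sum.elim x 0, Or.inl (by simpa using hx)⟩
    · exact ⟨Sum.elim 0 y, Or.inr (by simpa using hy)⟩
  · rintro ⟨x, h1 | h2⟩
    exacts [Or.inl ⟨_, h1⟩, Or.inr ⟨_, h2⟩]

theorem Di.false : Di (fun _ : ι → K => False) := (Di.eq0 (Po.const 1)).congr fun a => by simp
theorem Di.true : Di (fun _ : ι → K => True) := (Di.eq0 (Po.const 0)).congr fun a => by simp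

theorem Di.exFin {T : Type*} {s : Set T} (hs : s.Finite) {p : T → (ι → K) → Prop} (hp : ∀ t ∈ s, Di (p t)) : Di (fun a => ∃ t ∈ s, p t a) := by
  induction s, hs using Set.Finite.induction_on with
  | empty => exact Di.false.congr (by simp)
  | @insert b s hb hs ih =>
    refine ((hp b (by simp)).or (ih fun t ht => hp t (by simp [ht]))).congr fun a => by simp

theorem Di.allFin0 {k : K} (hk : ¬ IsSquare k) {T : Type*} {s : Set T} (hs : s.Finite) {p : T → (ι → K) → Prop} (hp : ∀ t ∈ s, Di (p t)) : Di (fun a => ∀ t ∈ s, p t a) := by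
  induction s, hs using Set.Finite.induction_on with
  | empty => exact Di.true.congr (by simp)
  | @insert b s hb hs ih =>
    refine (Di.and0 hk (hp b (by simp)) (ih fun t ht => hp t (by simp [ht]))).congr fun a => by simp
end

end QF


namespace QF
open NumberField IsDedekindDomain HeightOneSpectrum

section
variable {K : Type*} [Field K] [NumberField K] {ι κ : Type} {g h : (ι → K) → K} {p q : (ι → K) → Prop}

theorem exists_not_P (w : Pl K) : ∃ c : Kˣ, c ∉ P w := by
  by_contra hc
  push Not at hc
  have h1 : P w = ⊤ := Subgroup.eq_top_iff' _ |>.2 hc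
  have h2 := P_index_ge w
  rw [h1, Subgroup.index_top] at h2
  omega

theorem exists_nonsq (K : Type*) [Field K] [NumberField K] : ∃ k : K, ¬ IsSquare k := by
  obtain ⟨v⟩ := exists_finite_place K
  obtain ⟨c, hc⟩ := exists_not_P (.inl v : Pl K)
  exact ⟨c, not_sq_of hc⟩

theorem Di.and (hp : Di p) (hq : Di q) : Di (fun a => p a ∧ q a) := by
  obtain ⟨k, hk⟩ := exists_nonsq K
  exact Di.and0 hk hp hq

theorem Di.allFin {T : Type*} {s : Set T} (hs : s.Finite) {p : T → (ι → K) → Prop} (hp : ∀ t ∈ s, Di (p t)) : Di (fun a => ∀ t ∈ s, p t a) := by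
  obtain ⟨k, hk⟩ := exists_nonsq K
  exact Di.allFin0 hk hs hp

theorem Di.all [Finite κ] {p : κ → (ι → K) → Prop} (hp : ∀ t, Di (p t)) : Di (fun a => ∀ t, p t a) :=
  (Di.allFin (Set.finite_univ (α := κ)) (fun t _ => hp t)).congr fun a => by simp

theorem Po.lift (hg : Po g) : Po (fun b : ι ⊕ κ → K => g (fun i => b (.inl i))) := by
  obtain ⟨q, hq⟩ := hg
  exact ⟨MvPolynomial.rename Sum.inl q, fun a => by simp only [hq, MvPolynomial.eval_rename]; rfl⟩

theorem Di.dv {f : (ι → K) → K} (hf : Po f) (hg : Po g) (hh : Po h) : Di (fun a => Dv (f a) (g a) (h a)) := by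
  have : Di (fun a => ∃ x : Fin 3 → K, h a = f a * x 0 ^ 2 + g a * x 1 ^ 2 - f a * g a * x 2 ^ 2) := by
    apply Di.ex (p := fun a x => h a = f a * x 0 ^ 2 + g a * x 1 ^ 2 - f a * g a * x 2 ^ 2)
    exact Di.eq hh.lift (((hf.lift.mul ((Po.coord _).pow 2)).add (hg.lift.mul ((Po.coord _).pow 2))).sub
      ((hf.lift.mul hg.lift).mul ((Po.coord _).pow 2)))
  refine this.congr fun a => ?_
  constructor
  · rintro ⟨u, v, t, e⟩
    exact ⟨![u, v, t], by simpa using e⟩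
  · rintro ⟨x, e⟩
    exact ⟨_, _, _, e⟩

/-- a nonzero value in a set of units -/
def InU (A : Set Kˣ) (t : K) : Prop := ∃ u : Kˣ, (u : K) = t ∧ u ∈ A

theorem inU_coe {A : Set Kˣ} {u : Kˣ} : InU A (u : K) ↔ u ∈ A := by
  constructor
  · rintro ⟨u', h, hu⟩
    rwa [← Units.ext h]
  · exact fun h => ⟨u, rfl, h⟩

theorem Di.notP (w : Pl K) (hg : Po g) : Di (fun a => InU (P w : Set Kˣ)ᶜ (g a)) := by
  obtain ⟨c, hc⟩ := exists_not_P w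
  obtain ⟨p, hpw, hp⟩ : ∃ p : FP K, (Sum.inl p : Pl K) ≠ w ∧ c ∉ P (.inl p) := by
    obtain ⟨p, hp, h⟩ := GS (not_sq_of hc) (F := {v | (Sum.inl v : Pl K) = w})
      (Set.Finite.subset (Set.Finite.preimage Sum.inl_injective.injOn (Set.finite_singleton w)) fun v hv => by simpa using hv)
    exact ⟨p, hp, h⟩
  obtain ⟨e, he⟩ := O2 hc hp (Ne.symm hpw)
  have hA : ∀ u : Kˣ, Dv (c : K) e u ↔ u ∉ P w ∧ u ∉ P (.inl p) := fun u => by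
    rw [D_iff, he]; simp
  classical
  obtain ⟨k, hk⟩ := wa_sq {w, .inl p} (by simp) (fun x => if x = w then 1 else c)
  have hkw : k ∈ P w := by simpa using hk w (by simp)
  have hkp : k ∉ P (.inl p) := fun h => by
    have := hk (.inl p) (by simp)
    rw [if_neg hpw, Subgroup.mul_mem_cancel_right _ h] at this
    exact hp (by simpa using this)
  have main : ∀ u : Kˣ, u ∉ P w ↔ Dv (c : K) e u ∨ Dv (c : K) e (k * u : Kˣ) := by
    intro u
    rw [hA, hA, Subgroup.mul_mem_cancel_left _ hkw]
    constructor
    · intro hu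
      by_cases h : u ∈ P (.inl p)
      · exact Or.inr ⟨hu, by rwa [Subgroup.mul_mem_cancel_right _ h]⟩
      · exact Or.inl ⟨hu, h⟩
    · rintro (h | h)
      exacts [h.1, h.1]
  have hD : Di (fun a => g a ≠ 0 ∧ (Dv (c : K) e (g a) ∨ Dv (c : K) e (k * g a))) :=
    (Di.ne0 hg).and ((Di.dv (Po.const _) (Po.const _) hg).or (Di.dv (Po.const _) (Po.const _) ((Po.const _).mul hg)))
  refine hD.congr fun a => ?_
  constructor
  · rintro ⟨u, hu, h⟩
    have := (main u).1 h
    push_cast at this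
    rw [hu] at this
    exact ⟨hu ▸ u.ne_zero, this⟩
  · rintro ⟨h0, h⟩
    exact ⟨Units.mk0 _ h0, rfl, (main _).2 (by simpa using h)⟩

theorem exists_reps (w : Pl K) : ∃ R : Set Kˣ, R.Finite ∧ ∀ u, ∃ r ∈ R, r⁻¹ * u ∈ P w := by
  have : Finite (Kˣ ⧸ P w) := Nat.finite_of_card_ne_zero (P_index_ne_zero w)
  refine ⟨Set.range (Quotient.out : Kˣ ⧸ P w → Kˣ), Set.finite_range _, fun u => ⟨_, ⟨(u : Kˣ ⧸ P w), rfl⟩, ?_⟩⟩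
  rw [← QuotientGroup.eq]
  exact Quotient.out_eq' _

theorem Di.inP (w : Pl K) (hg : Po g) : Di (fun a => InU (P w : Set Kˣ) (g a)) := by
  obtain ⟨R, hR, hRu⟩ := exists_reps w
  have hD : Di (fun a => g a ≠ 0 ∧ ∀ r ∈ {r ∈ R | r ∉ P w}, InU (P w : Set Kˣ)ᶜ (((r⁻¹ : Kˣ) : K) * g a)) :=
    (Di.ne0 hg).and (Di.allFin (hR.subset fun r hr => hr.1) fun r hr => Di.notP w ((Po.const _).mul hg))
  refine hD.congr fun a => ?_
  have main : ∀ u : Kˣ, u ∈ P w ↔ ∀ r ∈ {r ∈ R | r ∉ P w}, r⁻¹ * u ∉ P w := by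
    intro u
    constructor
    · rintro hu r ⟨_, hr⟩ h
      rw [Subgroup.mul_mem_cancel_right _ hu] at h
      exact hr (by simpa using h)
    · intro h
      obtain ⟨r, hr, hu⟩ := hRu u
      by_cases hrp : r ∈ P w
      · rwa [Subgroup.mul_mem_cancel_left _ (by simpa using hrp)] at hu
      · exact absurd hu (h r ⟨hr, hrp⟩)
  by_cases h0 : g a = 0
  · refine ⟨?_, fun h => absurd h0 h.1⟩
    rintro ⟨u, hu, _⟩
    exact absurd (hu.trans h0) u.ne_zero
  · obtain ⟨u, hu⟩ : ∃ u : Kˣ, (u : K) = g a := ⟨Units.mk0 _ h0, rfl⟩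
    rw [← hu, inU_coe]
    simp only [← Units.val_mul, inU_coe]
    rw [SetLike.mem_coe, main]
    simp

theorem Di.cls [Finite ι] (w : Pl K) {T : Set (ι → Kˣ)} (hT : ∀ b b', (∀ i, (b i)⁻¹ * b' i ∈ P w) → b ∈ T → b' ∈ T) :
    Di (fun a : ι → K => ∃ b ∈ T, ∀ i, a i = b i) := by
  obtain ⟨R, hR, hRu⟩ := exists_reps w
  have hf : {r : ι → Kˣ | r ∈ T ∧ ∀ i, r i ∈ R}.Finite :=
    (Set.Finite.pi' (fun _ : ι => hR)).subset fun r hr => hr.2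
  have hD : Di (fun a : ι → K => ∃ r ∈ {r : ι → Kˣ | r ∈ T ∧ ∀ i, r i ∈ R}, ∀ i, InU (P w : Set Kˣ) ((((r i)⁻¹ : Kˣ) : K) * a i)) :=
    Di.exFin hf fun r _ => Di.all fun i => Di.inP w ((Po.const _).mul (Po.coord _))
  refine hD.congr fun a => ?_
  constructor
  · rintro ⟨b, hb, hab⟩
    choose r hr hrP using fun i => hRu (b i)
    refine ⟨r, ⟨hT b r (fun i => P_symm (hrP i)) hb, hr⟩, fun i => ⟨(r i)⁻¹ * b i, by rw [hab]; simp, hrP i⟩⟩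
  · rintro ⟨r, ⟨hr, _⟩, h⟩
    choose u hu huP using h
    refine ⟨fun i => r i * u i, hT r _ (fun i => by simpa using huP i) hr, fun i => ?_⟩
    simp [hu]

theorem not_iso_iff {m : ℕ} {a : Fin m → K} : (∀ x : Fin m → K, (∑ i, a i * x i ^ 2) = 0 → x = 0) ↔ ¬ Iso a := by
  simp only [Iso]
  push Not
  refine forall_congr' fun x => ?_
  tauto

theorem aniso5 {m : ℕ} (hm : 5 ≤ m) : Di (fun a : Fin m → K => (∀ i, a i ≠ 0) ∧ ¬ Iso a) := by
  have hD : Di (fun a : Fin m → K => ∃ w ∈ RD K, ∃ b ∈ {b : Fin m → Kˣ | ¬ IsoW w b}, ∀ i, a i = b i) :=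
    Di.exFin RD_finite fun w _ => Di.cls w fun b b' h hb hb' => hb (hb'.congr fun i => P_symm (h i))
  refine hD.congr fun a => ?_
  constructor
  · rintro ⟨h0, hi⟩
    obtain ⟨b, rfl⟩ : ∃ b : Fin m → Kˣ, a = fun i => (b i : K) := ⟨fun i => Units.mk0 _ (h0 i), rfl⟩
    rw [HM5 hm] at hi
    push Not at hi
    obtain ⟨w, hw, h⟩ := hi
    exact ⟨w, hw, b, h, fun _ => rfl⟩
  · rintro ⟨w, hw, b, hb, hab⟩
    obtain rfl : a = fun i => (b i : K) := funext hab
    exact ⟨fun i => (b i).ne_zero, fun h => hb ((HM5 hm b).1 h w hw)⟩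
end
end QF


namespace QF
open NumberField IsDedekindDomain HeightOneSpectrum

section
variable {K : Type*} [Field K] [NumberField K]

/-- a nonzero value represented by the pure part -/
def Gd (c e t : K) : Prop := t ≠ 0 ∧ Dv c e t

theorem abv4 {v : FP K} (h2 : abv (.inl v) (2 : K) = 1) : abv (.inl v) (4 : K) = 1 := by
  rw [show (4 : K) = 2 * 2 by norm_num, map_mul, h2, one_mul]

theorem one_add_P {v : FP K} {x : K} (hx : abv (.inl v) x < abv (.inl v) 4) : ∃ h : 1 + x ≠ 0, Units.mk0 (1 + x) h ∈ P (.inl v) := by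
  have h41 : abv (.inl v) (4 : K) ≤ 1 := by exact_mod_cast na_nat (fna v) 4
  have h : 1 + x ≠ 0 := by
    intro h
    have h1 : x = -1 := by linear_combination h
    rw [h1, (abv (.inl v)).map_neg, map_one] at hx
    linarith
  exact ⟨h, na_hens (fna v) (by simpa using hx)⟩

theorem sq_add_sq_P {v : FP K} {f : Kˣ} {s : K} (h : abv (.inl v) (f : K) < abv (.inl v) 4 * abv (.inl v) (s ^ 2)) (h0 : s ^ 2 + (f : K) ≠ 0) :
    Units.mk0 _ h0 ∈ P (.inl v) := by
  have hs : s ≠ 0 := by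
    rintro rfl
    simp at h
    exact absurd h (not_lt.2 ((abv _).nonneg _))
  have hp : 0 < abv (.inl v) (s ^ 2) := (abv _).pos (pow_ne_zero _ hs)
  obtain ⟨h1, h2⟩ := one_add_P (v := v) (x := f / s ^ 2) (by rw [map_div₀, div_lt_iff₀ hp]; exact h)
  have : Units.mk0 _ h0 = Units.mk0 s hs ^ 2 * Units.mk0 _ h1 := by
    ext; push_cast; simp; field_simp
  rw [this]
  exact mul_mem (sq_mem_P _ _) h2

theorem sq_add_cP {v : FP K} {f : Kˣ} {s : K} (h : abv (.inl v) (s ^ 2) < abv (.inl v) 4 * abv (.inl v) (f : K)) :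
    ∃ h0 : s ^ 2 + (f : K) ≠ 0, f⁻¹ * Units.mk0 _ h0 ∈ P (.inl v) := by
  have hp : 0 < abv (.inl v) (f : K) := (abv _).pos f.ne_zero
  obtain ⟨h1, h2⟩ := one_add_P (v := v) (x := s ^ 2 / f) (by rw [map_div₀, div_lt_iff₀ hp]; exact h)
  have e : s ^ 2 + (f : K) = f * (1 + s ^ 2 / f) := by field_simp; ring
  have h0 : s ^ 2 + (f : K) ≠ 0 := by rw [e]; exact mul_ne_zero f.ne_zero h1
  refine ⟨h0, ?_⟩
  have : f⁻¹ * Units.mk0 _ h0 = Units.mk0 _ h1 := by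
    ext; push_cast; simp only [Units.val_mk0]; rw [e]; simp
  rwa [this]

theorem Gd.le {v : FP K} (h2 : abv (.inl v) (2 : K) = 1) {c e f : Kˣ} {s : K} (hv : Sum.inl v ∈ Ram c e) (h : Gd (c : K) e (s ^ 2 + f)) :
    abv (.inl v) s ^ 2 ≤ abv (.inl v) (f : K) := by
  by_contra hlt
  push Not at hlt
  have hD : Dv (c : K) e (Units.mk0 _ h.1 : Kˣ) := h.2
  refine D_iff.1 hD _ hv (sq_add_sq_P ?_ h.1)
  rw [abv4 h2, one_mul, map_pow]
  exact hlt

theorem cert_sound {p0 : FP K} {S0 : Set (Pl K)} {r : K} (hRD : RD K ⊆ S0)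
    (hr : ∀ v, Sum.inl v ∉ S0 → abv (.inl v) r = 1) {c e α β d : Kˣ} {x1 x2 x3 y y' z' u : K}
    (hcP : ∀ w ∈ S0, w ≠ .inl p0 → c ∈ P w) (hce : hs (.inl p0) c e = -1)
    (g1 : Gd (c : K) e (c ^ 2 + c)) (g2 : Gd (c : K) e (e ^ 2 + e))
    (g3 : ∀ x ∈ ({x1, x2, x3} : Set K), Gd (c : K) e ((r * x) ^ 2 + c) ∧ Gd (c : K) e ((r * x) ^ 2 + e))
    (h1 : (α : K) = c * y ^ 2 * (1 + x1)) (h2 : (β * e : K) = (y' ^ 2 - c * z' ^ 2) * (1 + x2)) (h3 : (d : K) = u ^ 2 * (1 + x3)) :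
    ∃ w, d ∈ P w ∧ hs w α β = -1 := by
  have hp0 : Sum.inl p0 ∈ Ram c e := mem_Ram.2 hce
  obtain ⟨w, hw, hwp⟩ : ∃ w ∈ Ram c e, w ≠ .inl p0 := by
    by_contra! hall
    exact O3 (.inl p0) ⟨c, e, Set.eq_singleton_iff_unique_mem.2 ⟨hp0, hall⟩⟩
  have hwS : w ∉ S0 := fun h => by
    have := mem_Ram.1 hw
    rw [hs_P (hcP w h hwp)] at this
    exact absurd this (by decide)
  rcases w with v | s
  swap
  · exact absurd (hRD inr_mem_Sg) hwS
  have hv2 : abv (.inl v) (2 : K) = 1 := by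
    by_contra h
    exact hwS (hRD (inl_mem_Sg.2 h))
  have hrv := hr v hwS
  have hcpos : 0 < abv (.inl v) (c : K) := (abv _).pos c.ne_zero
  have hepos : 0 < abv (.inl v) (e : K) := (abv _).pos e.ne_zero
  have hc1 : abv (.inl v) (c : K) ≤ 1 := by
    have := g1.le hv2 hw
    nlinarith
  have he1 : abv (.inl v) (e : K) ≤ 1 := by
    have := g2.le hv2 hw
    nlinarith
  have hlt : abv (.inl v) (c : K) < 1 ∨ abv (.inl v) (e : K) < 1 := by
    by_contra! hh
    have hc : ord v c = 1 := (fabv_eq_one_iff v c).1 (le_antisymm hc1 hh.1)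
    have he : ord v e = 1 := (fabv_eq_one_iff v e).1 (le_antisymm he1 hh.2)
    have := odd_even hv2 (c := c) (e := e) (by rw [hc]; exact ⟨0, rfl⟩) (by rw [he]; exact ⟨0, rfl⟩)
    exact hs_neg_iff.1 (mem_Ram.1 hw) this
  have hx : ∀ x ∈ ({x1, x2, x3} : Set K), ∃ h : 1 + x ≠ 0, Units.mk0 (1 + x) h ∈ P (.inl v) := by
    intro x hx
    apply one_add_P
    rw [abv4 hv2]
    have ha := (g3 x hx).1.le hv2 hw
    have hb := (g3 x hx).2.le hv2 hw
    rw [map_mul, hrv, one_mul] at ha hb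
    have hn := (abv (.inl v)).nonneg x
    rcases hlt with h | h <;> nlinarith
  obtain ⟨n1, k1⟩ := hx x1 (by simp)
  obtain ⟨n2, k2⟩ := hx x2 (by simp)
  obtain ⟨n3, k3⟩ := hx x3 (by simp)
  have hy : y ≠ 0 := by rintro rfl; exact α.ne_zero (by rw [h1]; simp)
  have hu : u ≠ 0 := by rintro rfl; exact d.ne_zero (by rw [h3]; simp)
  have hn : y' ^ 2 - c * z' ^ 2 ≠ 0 := fun h => (β * e).ne_zero (by push_cast; rw [h2, h]; simp)
  have e1 : α = c * (Units.mk0 y hy ^ 2 * Units.mk0 _ n1) := by ext; push_cast; simp [h1]; ring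
  have e2 : β * e = Units.mk0 _ hn * Units.mk0 _ n2 := by ext; push_cast; simp [h2]
  have e3 : d = Units.mk0 u hu ^ 2 * Units.mk0 _ n3 := by ext; push_cast; simp [h3]
  refine ⟨.inl v, ?_, ?_⟩
  · rw [e3]; exact mul_mem (sq_mem_P _ _) k3
  · rw [e1, hs_mul', hs_P (mul_mem (sq_mem_P _ _) k1), mul_one]
    have h5 : hs (.inl v) c (β * e) = 1 := by
      rw [e2, hs_mul, hs_P' k2, mul_one]
      exact hs_nrm (mem_nrm.2 ⟨y', z', by simp⟩)
    rw [hs_mul, mem_Ram.1 hw] at h5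
    have h6 : hs (.inl v) c β = hs (.inl v) c β * (-1) * (-1) := by simp
    rw [h6, h5, one_mul]

theorem near2 (w : Pl K) (u : Kˣ) : ∃ ε > 0, ∀ x : K, abv w (x - u) < ε → ∃ hx : x ≠ 0, u⁻¹ * Units.mk0 x hx ∈ P w ∧ ∀ p, w = .inl p → abv w x = abv w (u : K) := by
  obtain ⟨ε, hε, H⟩ := (hens w).near u
  refine ⟨min ε (abv w (u : K)), lt_min hε ((abv w).pos u.ne_zero), fun x hx => ?_⟩
  obtain ⟨h0, h⟩ := H x (hx.trans_le (min_le_left _ _))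
  refine ⟨h0, h, ?_⟩
  rintro p rfl
  have := na_add_lt (fna p) (hx.trans_le (min_le_right _ _))
  rwa [add_sub_cancel] at this

theorem wa2 (F : Set (Pl K)) (hF : F.Finite) (hne : F.Nonempty) (g : Pl K → Kˣ) :
    ∃ x : Kˣ, ∀ w ∈ F, (g w)⁻¹ * x ∈ P w ∧ ∀ p, w = .inl p → abv w (x : K) = abv w (g w : K) := by
  choose ε hε H using fun w : Pl K => near2 w (g w)
  obtain ⟨x, hx⟩ := wa F hF (fun w => (g w : K)) ε (fun w _ => hε w)
  obtain ⟨w, hw⟩ := hne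
  obtain ⟨h0, -⟩ := H w x (hx w hw)
  exact ⟨Units.mk0 x h0, fun w hw => (H w x (hx w hw)).2⟩

theorem wanrm2 (c : Kˣ) (F : Set (Pl K)) (hF : F.Finite) (hne : F.Nonempty) (g : Pl K → Kˣ) (hg : ∀ w ∈ F, g w ∈ Nw w c) :
    ∃ x ∈ nrm c, ∀ w ∈ F, (g w)⁻¹ * x ∈ P w ∧ ∀ p, w = .inl p → abv w (x : K) = abv w (g w : K) := by
  choose ε hε H using fun w : Pl K => near2 w (g w)
  obtain ⟨y, z, hx⟩ := nrmApprox c F hF g hg ε (fun w _ => hε w)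
  obtain ⟨w, hw⟩ := hne
  obtain ⟨h0, -⟩ := H w _ (hx w hw)
  exact ⟨Units.mk0 _ h0, mem_nrm.2 ⟨y, z, rfl⟩, fun w hw => (H w _ (hx w hw)).2⟩

theorem exists_small (v : FP K) (u : Kˣ) {δ : ℝ} (hδ : 0 < δ) : ∃ s : Kˣ, abv (.inl v) ((u * s ^ 2 : Kˣ) : K) < δ := by
  obtain ⟨π, hπ⟩ := exists_unif v
  have h1 : abv (.inl v) (π : K) < 1 := by rw [fabv_lt_one_iff, hπ]; exact one_pos
  have hu : 0 < abv (.inl v) (u : K) := (abv _).pos u.ne_zero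
  obtain ⟨n, hn⟩ := exists_pow_lt_of_lt_one (div_pos hδ hu) h1
  refine ⟨π ^ n, ?_⟩
  have hn0 : 0 ≤ abv (.inl v) (π : K) := (abv _).nonneg _
  push_cast
  rw [map_mul, map_pow, map_pow, mul_comm, ← lt_div_iff₀ hu]
  refine lt_of_le_of_lt ?_ hn
  rw [← pow_mul]
  exact pow_le_pow_of_le_one hn0 h1.le (by omega)

theorem exists_big (v : FP K) (u : Kˣ) : ∃ s : Kˣ, abv (.inl v) (u : K) ≤ abv (.inl v) ((s ^ 2 : Kˣ) : K) := by
  obtain ⟨s, hs⟩ := exists_small v u one_pos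
  refine ⟨s⁻¹, ?_⟩
  push_cast at hs ⊢
  have hp : 0 < abv (.inl v) (s : K) := (abv _).pos s.ne_zero
  rw [map_mul, map_pow] at hs
  rw [map_pow, map_inv₀, inv_pow, ← one_div, le_div_iff₀ (by positivity)]
  exact hs.le

theorem tgt {v p0 : FP K} (hne : v ≠ p0) (γ : Kˣ) {δ : ℝ} (hδ : 0 < δ) : ∃ (Q : Pl K → Kˣ) (h : Kˣ) (ε : Pl K → ℝ), Q (.inl v) = γ ∧ Q (.inl p0) = h ^ 2 ∧ (∀ w, 0 < ε w) ∧
    ∀ Y : K, (∀ w ∈ ({.inl v, .inl p0} : Set (Pl K)), abv w (Y - Q w) < ε w) → Y ≠ 0 ∧ abv (.inl v) (γ / Y - 1) < δ ∧ abv (.inl p0) (γ / Y - 1) ≤ 1 := by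
  classical
  obtain ⟨h, hh⟩ := exists_big p0 γ
  let Q : Pl K → Kˣ := fun w => if w = .inl v then γ else h ^ 2
  have hpos : ∀ w, 0 < abv w (Q w : K) := fun w => (abv w).pos (Q w).ne_zero
  have hQv : Q (.inl v) = γ := by simp [Q]
  have hQp : Q (.inl p0) = h ^ 2 := by simp [Q, Ne.symm hne]
  refine ⟨Q, h, fun w => min (abv w (Q w : K)) (δ * abv w (Q w : K)), hQv, hQp, fun w => lt_min (hpos w) (mul_pos hδ (hpos w)), fun Y hY => ?_⟩
  have hYv := hY (.inl v) (by simp)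
  have hYp := hY (.inl p0) (by simp)
  have hv := na_add_lt (fna v) (hYv.trans_le (min_le_left _ _))
  have hp := na_add_lt (fna p0) (hYp.trans_le (min_le_left _ _))
  rw [add_sub_cancel] at hv hp
  have hY0 : Y ≠ 0 := by
    rintro rfl
    rw [map_zero] at hv
    exact absurd hv (hpos _).ne
  refine ⟨hY0, ?_, ?_⟩
  · have e : (γ : K) / Y - 1 = -((Y - Q (.inl v)) / Y) := by rw [hQv]; field_simp; ring
    rw [e, (abv _).map_neg, map_div₀, hv, div_lt_iff₀ (hpos _)]
    exact hYv.trans_le (min_le_right _ _)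
  · refine (na_sub (fna p0) _ _).trans (max_le ?_ (by simp))
    rw [map_div₀, hp, div_le_one (hpos _), hQp]
    exact hh

theorem good_of {v p0 : FP K} {c e f : Kˣ} (hR : Ram c e = {.inl v, .inl p0}) (hf : f = c ∨ f = e) {s : K}
    (h1 : abv (.inl v) s ^ 2 < abv (.inl v) 4 * abv (.inl v) (f : K)) (h2 : abv (.inl p0) s ^ 2 < abv (.inl p0) 4 * abv (.inl p0) (f : K)) :
    Gd (c : K) e (s ^ 2 + f) := by
  rw [← map_pow] at h1 h2
  obtain ⟨h0, ha⟩ := sq_add_cP h1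
  obtain ⟨h0', hb⟩ := sq_add_cP h2
  have hfP : ∀ w ∈ Ram c e, f ∉ P w := by
    intro w hw hP
    have hw := mem_Ram.1 hw
    rcases hf with rfl | rfl
    · rw [hs_P hP] at hw; exact absurd hw (by decide)
    · rw [hs_P' hP] at hw; exact absurd hw (by decide)
  have : Dv (c : K) e (Units.mk0 _ h0 : Kˣ) := by
    rw [D_iff, hR]
    rintro w (rfl | rfl) hP
    · exact hfP (.inl v) (by rw [hR]; simp) (P_mem_congr (P_symm ha) hP)
    · exact hfP (.inl p0) (by rw [hR]; simp) (P_mem_congr (P_symm hb) hP)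
  exact ⟨h0, this⟩

theorem sq_lt_aux {a b : ℝ} (ha : 0 < a) (h : a < b) : a ^ 2 < b * a := by
  rw [pow_two]; exact mul_lt_mul_of_pos_right h ha

theorem sq_lt_aux2 {a b : ℝ} (ha : 0 ≤ a) (h : a < b) (hb : b < 1) : a ^ 2 < b := by
  rw [pow_two]
  exact (mul_le_of_le_one_right ha (h.trans hb).le).trans_lt h

set_option maxHeartbeats 1000000 in
theorem cert_complete {p0 : FP K} {S0 : Set (Pl K)} (hfin : S0.Finite) (hp0 : .inl p0 ∈ S0) {r : K} (hRD : RD K ⊆ S0)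
    (hr : ∀ v, Sum.inl v ∉ S0 → abv (.inl v) r = 1) {c0 e0 : Kˣ} (hce0 : hs (.inl p0) c0 e0 = -1)
    (hc0 : abv (.inl p0) (c0 : K) < abv (.inl p0) 4) (he0 : abv (.inl p0) (e0 : K) < abv (.inl p0) 4)
    (hrc : abv (.inl p0) r ^ 2 < abv (.inl p0) 4 * abv (.inl p0) (c0 : K))
    (hre : abv (.inl p0) r ^ 2 < abv (.inl p0) 4 * abv (.inl p0) (e0 : K))
    {α β d : Kˣ} {v : FP K} (hv : Sum.inl v ∉ S0) (hd : d ∈ P (.inl v)) (hab : hs (.inl v) α β = -1) :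
    ∃ (c e : Kˣ) (x1 x2 x3 y y' z' u : K),
    (∀ w ∈ S0, w ≠ .inl p0 → c ∈ P w) ∧ hs (.inl p0) c e = -1 ∧
    Gd (c : K) e (c ^ 2 + c) ∧ Gd (c : K) e (e ^ 2 + e) ∧
    (∀ x ∈ ({x1, x2, x3} : Set K), Gd (c : K) e ((r * x) ^ 2 + c) ∧ Gd (c : K) e ((r * x) ^ 2 + e)) ∧
    (α : K) = c * y ^ 2 * (1 + x1) ∧ (β * e : K) = (y' ^ 2 - c * z' ^ 2) * (1 + x2) ∧ (d : K) = u ^ 2 * (1 + x3) := by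
  classical
  have hv2 : abv (.inl v) (2 : K) = 1 := by
    by_contra h
    exact hv (hRD (inl_mem_Sg.2 h))
  have hv4 := abv4 hv2
  have hrv := hr v hv
  have hne : v ≠ p0 := by rintro rfl; exact hv hp0
  have hneS : (Sum.inl v : Pl K) ≠ .inl p0 := fun h => hne (Sum.inl_injective h)
  obtain ⟨s, hs1⟩ := exists_small v α one_pos
  -- choice of c
  obtain ⟨c, hc⟩ := wa2 (insert (.inl v) S0) (hfin.insert _) ⟨_, Or.inl rfl⟩
    (fun w => if w = .inl v then α * s ^ 2 else if w = .inl p0 then c0 else 1)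
  have hcv := hc (.inl v) (Or.inl rfl)
  have hcp := hc (.inl p0) (Or.inr hp0)
  simp only [if_true] at hcv
  simp only [if_neg hneS.symm, if_true] at hcp
  have hcv1 : α⁻¹ * c ∈ P (.inl v) := by
    have := mul_mem hcv.1 (sq_mem_P (.inl v) s)
    have e : (α * s ^ 2)⁻¹ * c * s ^ 2 = α⁻¹ * c := by
      rw [mul_inv]
      calc α⁻¹ * (s ^ 2)⁻¹ * c * s ^ 2 = α⁻¹ * c * ((s ^ 2)⁻¹ * s ^ 2) := by simp only [mul_assoc, mul_comm, mul_left_comm]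
        _ = _ := by simp
    rwa [e] at this
  have hcv2 : abv (.inl v) (c : K) < 1 := by rw [hcv.2 v rfl]; exact hs1
  have hcp2 : abv (.inl p0) (c : K) = abv (.inl p0) (c0 : K) := hcp.2 p0 rfl
  have hcS : ∀ w ∈ S0, w ≠ .inl p0 → c ∈ P w := by
    intro w hw hwp
    have hwv : w ≠ .inl v := by rintro rfl; exact hv hw
    have := (hc w (Or.inr hw)).1
    simpa [hwv, hwp] using this
  have hcnv : c ∉ P (.inl v) := fun h => by
    rw [hs_P (P_mem_congr (P_symm hcv1) h)] at hab
    exact absurd hab (by decide)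
  have hcnp : c ∉ P (.inl p0) := fun h => by
    rw [hs_P (P_mem_congr (P_symm hcp.1) h)] at hce0
    exact absurd hce0 (by decide)
  -- choice of e
  obtain ⟨e1, he1⟩ := O2 hcnv hcnp hneS
  have he1p : hs (.inl p0) c e1 = -1 := mem_Ram.1 (by rw [he1]; simp)
  have he0p : hs (.inl p0) c e0 = -1 := by
    rw [hs_congr2 (e := e0) hcp.1 (by simp [one_mem]), hce0]
  obtain ⟨s', hs1'⟩ := exists_small v e1 one_pos
  obtain ⟨n, hn, hnF⟩ := wanrm2 c {.inl v, .inl p0} (by simp) ⟨_, Or.inl rfl⟩ (fun w => if w = .inl v then s' ^ 2 else e1⁻¹ * e0) (by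
    rintro w (rfl | rfl)
    · simp only [if_true]; exact sq_mem_Nw _ _ _
    · simp only [if_neg hneS.symm]
      rw [← hs_one_iff, hs_mul, hs_inv, he1p, he0p]; rfl)
  have hnv := (hnF (.inl v) (by simp)).2 v rfl
  have hnp := (hnF (.inl p0) (by simp)).2 p0 rfl
  simp only [if_true] at hnv
  simp only [if_neg hneS.symm] at hnp
  obtain ⟨e, he⟩ : ∃ e, e = e1 * n := ⟨_, rfl⟩
  have hR : Ram c e = {.inl v, .inl p0} := by
    rw [← he1]
    refine Ram_eq fun w => ?_
    rw [he, hs_mul, hs_nrm hn, mul_one]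
  have hev : abv (.inl v) (e : K) < 1 := by
    rw [he]; push_cast at hs1' ⊢
    rw [map_mul, hnv, Units.val_pow_eq_pow_val, ← map_mul]; exact hs1'
  have hep : abv (.inl p0) (e : K) = abv (.inl p0) (e0 : K) := by
    rw [he]; push_cast
    rw [map_mul, hnp, ← map_mul]; congr 1; push_cast; simp
  have hcev : hs (.inl v) c e = -1 := mem_Ram.1 (by rw [hR]; simp)
  have hcep : hs (.inl p0) c e = -1 := mem_Ram.1 (by rw [hR]; simp)
  have hcpos : 0 < abv (.inl v) (c : K) := (abv _).pos c.ne_zero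
  have hepos : 0 < abv (.inl v) (e : K) := (abv _).pos e.ne_zero
  have hcpos' : 0 < abv (.inl p0) (c : K) := (abv _).pos c.ne_zero
  have hepos' : 0 < abv (.inl p0) (e : K) := (abv _).pos e.ne_zero
  -- the approximations
  obtain ⟨δ, hδ, hδc, hδe⟩ : ∃ δ : ℝ, 0 < δ ∧ δ ≤ abv (.inl v) (c : K) ∧ δ ≤ abv (.inl v) (e : K) :=
    ⟨min _ _, lt_min hcpos hepos, min_le_left _ _, min_le_right _ _⟩
  have hF2 : ({.inl v, .inl p0} : Set (Pl K)).Finite := by simp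
  have hsqA : ∀ γ : Kˣ, γ ∈ P (.inl v) → ∃ y : K, y ^ 2 ≠ 0 ∧ abv (.inl v) (γ / y ^ 2 - 1) < δ ∧ abv (.inl p0) (γ / y ^ 2 - 1) ≤ 1 := by
    intro γ hγ
    obtain ⟨Q, h, ε, hQv, hQp, hε, H⟩ := tgt hne γ hδ
    obtain ⟨y, hy⟩ := sqApprox {.inl v, .inl p0} hF2 Q (by
      rintro w (rfl | rfl)
      · rwa [hQv]
      · rw [hQp]; exact sq_mem_P _ _) ε (fun w _ => hε w)
    exact ⟨y, H _ hy⟩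
  obtain ⟨y, hy0, hyv, hyp⟩ := hsqA (c⁻¹ * α) (P_symm hcv1)
  obtain ⟨u, hu0, huv, hup⟩ := hsqA d hd
  have hβ : β * e ∈ Nw (.inl v) c := by
    rw [← hs_one_iff, hs_mul, hcev, hs_congr2 (e := β) hcv1 (by simp [one_mem]), hab]; rfl
  obtain ⟨Q, h, ε, hQv, hQp, hε, H⟩ := tgt hne (β * e) hδ
  obtain ⟨y', z', hyz⟩ := nrmApprox c {.inl v, .inl p0} hF2 Q (by
    rintro w (rfl | rfl)
    · rwa [hQv]
    · rw [hQp]; exact sq_mem_Nw _ _ _) ε (fun w _ => hε w)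
  obtain ⟨hn0, hnv, hnp⟩ := H _ hyz
  refine ⟨c, e, ((c⁻¹ * α : Kˣ) : K) / y ^ 2 - 1, ((β * e : Kˣ) : K) / (y' ^ 2 - c * z' ^ 2) - 1, d / u ^ 2 - 1, y, y', z', u,
    hcS, hcep, ?_, ?_, ?_, ?_, ?_, ?_⟩
  · apply good_of hR (Or.inl rfl)
    · rw [hv4]; exact sq_lt_aux hcpos hcv2
    · exact sq_lt_aux hcpos' (by rw [hcp2]; exact hc0)
  · apply good_of hR (Or.inr rfl)
    · rw [hv4]; exact sq_lt_aux hepos hev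
    · exact sq_lt_aux hepos' (by rw [hep]; exact he0)
  · intro x hx
    have hxx : abv (.inl v) x < δ ∧ abv (.inl p0) x ≤ 1 := by
      rcases hx with rfl | rfl | rfl
      exacts [⟨hyv, hyp⟩, ⟨hnv, hnp⟩, ⟨huv, hup⟩]
    have hn1 := (abv (.inl v)).nonneg x
    have hn2 := (abv (.inl p0)).nonneg x
    have hn3 := (abv (.inl p0)).nonneg r
    have hsq : abv (.inl v) x ^ 2 < δ := sq_lt_aux2 hn1 hxx.1 (hδc.trans_lt hcv2)
    have hsq' : (abv (.inl p0) r * abv (.inl p0) x) ^ 2 ≤ abv (.inl p0) r ^ 2 := by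
      rw [mul_pow]
      exact mul_le_of_le_one_right (by positivity) (pow_le_one₀ hn2 hxx.2)
    constructor
    · apply good_of hR (Or.inl rfl)
      · rw [map_mul, hrv, hv4, one_mul, one_mul]; linarith
      · rw [map_mul, hcp2]; linarith
    · apply good_of hR (Or.inr rfl)
      · rw [map_mul, hrv, hv4, one_mul, one_mul]; linarith
      · rw [map_mul, hep]; linarith
  · push_cast
    have : y ≠ 0 := fun h => hy0 (by simp [h])
    field_simp
    ring
  · push_cast
    field_simp
    ring
  · have : u ≠ 0 := fun h => hu0 (by simp [h])
    field_simp
    ring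

end
end QF


namespace QF
open NumberField IsDedekindDomain HeightOneSpectrum

section
variable {K : Type*} [Field K] [NumberField K]

theorem exists_base (p0 : FP K) : ∃ c0 e0 : Kˣ, hs (.inl p0) c0 e0 = -1 ∧ abv (.inl p0) (c0 : K) < abv (.inl p0) 4 ∧
    abv (.inl p0) (e0 : K) < abv (.inl p0) 4 := by
  have h4 : 0 < abv (.inl p0) (4 : K) := (abv _).pos (by norm_num)
  obtain ⟨c, hc⟩ := exists_not_P (.inl p0 : Pl K)
  obtain ⟨e, he⟩ : ∃ e, e ∉ Nw (.inl p0) c := by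
    by_contra! h
    exact hc (Nw_nondeg h)
  obtain ⟨s, hs1⟩ := exists_small p0 c h4
  obtain ⟨t, ht1⟩ := exists_small p0 e h4
  refine ⟨c * s ^ 2, e * t ^ 2, ?_, hs1, ht1⟩
  rw [hs_mul, hs_mul', hs_P (sq_mem_P _ _), hs_P' (sq_mem_P _ _), mul_one, mul_one, hs_neg_iff]
  exact he

theorem Di.gd {ι : Type} {f g h : (ι → K) → K} (hf : Po f) (hg : Po g) (hh : Po h) : Di (fun a => Gd (f a) (g a) (h a)) :=
  (Di.ne0 hh).and (Di.dv hf hg hh)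

theorem aniso4 : Di (fun a : Fin 4 → K => (∀ i, a i ≠ 0) ∧ ¬ Iso a) := by
  obtain ⟨p0⟩ := exists_finite_place K
  obtain ⟨c0, e0, hce0, hc0, he0⟩ := exists_base p0
  let r : Kˣ := Units.mk0 4 (by norm_num) * c0 * e0
  have hr : (r : K) = 4 * c0 * e0 := by simp [r]
  let S0 : Set (Pl K) := RD K ∪ ({.inl p0} ∪ Sum.inl '' {v : FP K | ord v r ≠ 1})
  have hfin : S0.Finite := RD_finite.union ((Set.finite_singleton _).union ((ord_finite r).image _))
  have hp0 : .inl p0 ∈ S0 := Or.inr (Or.inl rfl)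
  have hRD : RD K ⊆ S0 := fun w hw => Or.inl hw
  have hrS : ∀ v, Sum.inl v ∉ S0 → abv (.inl v) (r : K) = 1 := by
    intro v hv
    rw [fabv_eq_one_iff]
    by_contra h
    exact hv (Or.inr (Or.inr ⟨v, h, rfl⟩))
  have h4p : 0 < abv (.inl p0) (4 : K) := (abv _).pos (by norm_num)
  have h41 : abv (.inl p0) (4 : K) ≤ 1 := by exact_mod_cast na_nat (fna p0) 4
  have hcp : 0 < abv (.inl p0) (c0 : K) := (abv _).pos c0.ne_zero
  have hep : 0 < abv (.inl p0) (e0 : K) := (abv _).pos e0.ne_zero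
  have haux : ∀ x y z : ℝ, 0 < x → x ≤ 1 → 0 < y → y < 1 → 0 < z → z < 1 → (x * y * z) ^ 2 < x * y ∧ (x * y * z) ^ 2 < x * z := by
    intro x y z hx hx1 hy hy1 hz hz1
    have h1 : x * y * z < x * y := mul_lt_of_lt_one_right (mul_pos hx hy) hz1
    have h2 : x * y * z < x * z := by
      rw [mul_right_comm]; exact mul_lt_of_lt_one_right (mul_pos hx hz) hy1
    have h3 : x * y * z ≤ 1 := h1.le.trans (mul_le_one₀ hx1 hy.le hy1.le)
    have h4 : (x * y * z) ^ 2 ≤ x * y * z := by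
      rw [pow_two]; exact mul_le_of_le_one_right (by positivity) h3
    exact ⟨h4.trans_lt h1, h4.trans_lt h2⟩
  obtain ⟨hrc, hre⟩ := haux _ _ _ h4p h41 hcp (hc0.trans_le h41) hep (he0.trans_le h41)
  have hr' : abv (.inl p0) (r : K) = abv (.inl p0) 4 * abv (.inl p0) (c0 : K) * abv (.inl p0) (e0 : K) := by
    rw [hr, map_mul, map_mul]
  rw [← hr'] at hrc hre
  have D1 : Di (fun a : Fin 4 → K => ∃ w ∈ S0, ∃ b ∈ {b : Fin 4 → Kˣ | Bad4 w b}, ∀ i, a i = b i) :=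
    Di.exFin hfin fun w _ => Di.cls w fun b b' h hb => hb.congr h
  have D2 : Di (fun a : Fin 4 → K => (∀ i, a i ≠ 0) ∧ ∃ b : Fin 9 → K,
      (∀ w ∈ S0 \ {.inl p0}, InU (P w : Set Kˣ) (b 0)) ∧
      (∃ d ∈ {d : Fin 2 → Kˣ | hs (.inl p0) (d 0) (d 1) = -1}, ∀ i, (![b 0, b 1] : Fin 2 → K) i = d i) ∧
      Gd (b 0) (b 1) (b 0 ^ 2 + b 0) ∧ Gd (b 0) (b 1) (b 1 ^ 2 + b 1) ∧
      (∀ i : Fin 3, Gd (b 0) (b 1) ((r * b (![2, 3, 4] i)) ^ 2 + b 0) ∧ Gd (b 0) (b 1) ((r * b (![2, 3, 4] i)) ^ 2 + b 1)) ∧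
      -(a 0 * a 1) = b 0 * b 5 ^ 2 * (1 + b 2) ∧ -(a 0 * a 2) * b 1 = (b 6 ^ 2 - b 0 * b 7 ^ 2) * (1 + b 3) ∧
      a 0 * a 1 * a 2 * a 3 = b 8 ^ 2 * (1 + b 4)) := by
    apply Di.and
    · exact Di.all fun i => Di.ne0 (Po.coord i)
    apply Di.ex (κ := Fin 9) (p := fun a b => (∀ w ∈ S0 \ {.inl p0}, InU (P w : Set Kˣ) (b 0)) ∧
      (∃ d ∈ {d : Fin 2 → Kˣ | hs (.inl p0) (d 0) (d 1) = -1}, ∀ i, (![b 0, b 1] : Fin 2 → K) i = d i) ∧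
      Gd (b 0) (b 1) (b 0 ^ 2 + b 0) ∧ Gd (b 0) (b 1) (b 1 ^ 2 + b 1) ∧
      (∀ i : Fin 3, Gd (b 0) (b 1) ((r * b (![2, 3, 4] i)) ^ 2 + b 0) ∧ Gd (b 0) (b 1) ((r * b (![2, 3, 4] i)) ^ 2 + b 1)) ∧
      -(a 0 * a 1) = b 0 * b 5 ^ 2 * (1 + b 2) ∧ -(a 0 * a 2) * b 1 = (b 6 ^ 2 - b 0 * b 7 ^ 2) * (1 + b 3) ∧
      a 0 * a 1 * a 2 * a 3 = b 8 ^ 2 * (1 + b 4))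
    refine Di.and ?_ (Di.and ?_ (Di.and ?_ (Di.and ?_ (Di.and ?_ (Di.and ?_ (Di.and ?_ ?_))))))
    · exact Di.allFin (hfin.subset Set.diff_subset) fun w _ => Di.inP w (Po.coord _)
    · refine Di.comp (p := fun y : Fin 2 → K => ∃ d ∈ {d : Fin 2 → Kˣ | hs (.inl p0) (d 0) (d 1) = -1}, ∀ i, y i = d i)
        (Di.cls (.inl p0) fun b b' h hb => ?_) (g := fun z : Fin 4 ⊕ Fin 9 → K => ![z (.inr 0), z (.inr 1)]) fun j => ?_
      · rw [Set.mem_ofPred_eq] at hb ⊢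
        rw [hs_congr2 (h 0) (h 1), hb]
      · fin_cases j
        · exact Po.coord _
        · exact Po.coord _
    · exact Di.gd (Po.coord _) (Po.coord _) (((Po.coord _).pow 2).add (Po.coord _))
    · exact Di.gd (Po.coord _) (Po.coord _) (((Po.coord _).pow 2).add (Po.coord _))
    · refine Di.all fun i => Di.and ?_ ?_ <;>
      exact Di.gd (Po.coord _) (Po.coord _) ((((Po.const _).mul (Po.coord _)).pow 2).add (Po.coord _))
    · exact Di.eq ((Po.coord _).mul (Po.coord _)).neg (((Po.coord _).mul ((Po.coord _).pow 2)).mul ((Po.const _).add (Po.coord _)))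
    · exact Di.eq (((Po.coord _).mul (Po.coord _)).neg.mul (Po.coord _))
        ((((Po.coord _).pow 2).sub ((Po.coord _).mul ((Po.coord _).pow 2))).mul ((Po.const _).add (Po.coord _)))
    · exact Di.eq ((((Po.coord _).mul (Po.coord _)).mul (Po.coord _)).mul (Po.coord _)) (((Po.coord _).pow 2).mul ((Po.const _).add (Po.coord _)))
  refine (D1.or D2).congr fun a => ?_
  constructor
  · rintro ⟨h0, hi⟩
    obtain ⟨b, rfl⟩ : ∃ b : Fin 4 → Kˣ, a = fun i => (b i : K) := ⟨fun i => Units.mk0 _ (h0 i), rfl⟩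
    rw [iso4_bad] at hi
    push Not at hi
    obtain ⟨w, hw⟩ := hi
    by_cases hwS : w ∈ S0
    · exact Or.inl ⟨w, hwS, b, hw, fun _ => rfl⟩
    · rcases w with v | s
      swap
      · exact absurd (hRD inr_mem_Sg) hwS
      obtain ⟨c, e, x1, x2, x3, y, y', z', u, k1, k2, k3, k4, k5, k6, k7, k8⟩ := cert_complete hfin hp0 hRD hrS hce0 hc0 he0 hrc hre hwS hw.1 hw.2
      refine Or.inr ⟨h0, ![c, e, x1, x2, x3, y, y', z', u], ?_, ⟨![c, e], k2, ?_⟩, k3, k4, ?_, ?_, ?_, ?_⟩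
      · exact fun w hw => ⟨c, rfl, k1 w hw.1 hw.2⟩
      · intro i; fin_cases i <;> rfl
      · intro i
        fin_cases i
        · exact k5 x1 (by simp)
        · exact k5 x2 (by simp)
        · exact k5 x3 (by simp)
      · push_cast at k6; exact k6
      · push_cast at k7; exact k7
      · push_cast at k8; exact k8
  · rintro (⟨w, hw, b, hb, hab⟩ | ⟨h0, b, k1, ⟨d, k2, hd⟩, k3, k4, k5, k6, k7, k8⟩)
    · obtain rfl : a = fun i => (b i : K) := funext hab
      exact ⟨fun i => (b i).ne_zero, fun h => iso4_bad.1 h w hb⟩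
    · refine ⟨h0, ?_⟩
      obtain ⟨a', rfl⟩ : ∃ b : Fin 4 → Kˣ, a = fun i => (b i : K) := ⟨fun i => Units.mk0 _ (h0 i), rfl⟩
      have hd0 : b 0 = d 0 := hd 0
      have hd1 : b 1 = d 1 := hd 1
      rw [hd0, hd1] at k3 k4 k5 k7
      rw [hd0] at k6
      rw [iso4_bad]
      push Not
      refine cert_sound (p0 := p0) (S0 := S0) (r := r) (c := d 0) (e := d 1) (x1 := b 2) (x2 := b 3) (x3 := b 4) (y := b 5) (y' := b 6) (z' := b 7) (u := b 8)
        hRD hrS ?_ k2 k3 k4 ?_ ?_ ?_ ?_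
      · intro w hw hwp
        have := k1 w ⟨hw, hwp⟩
        rw [hd0, inU_coe] at this
        exact this
      · rintro x (rfl | rfl | rfl)
        · exact k5 0
        · exact k5 1
        · exact k5 2
      · push_cast; exact k6
      · push_cast; exact k7
      · push_cast; exact k8

theorem iso3_iff4 (a : Fin 3 → Kˣ) : Iso (fun i => (a i : K)) ↔ Iso (fun i => ((![a 0, a 1, a 2, a 0 * a 1 * a 2] : Fin 4 → Kˣ) i : K)) := by
  constructor
  · rintro ⟨x, hx, h⟩
    refine ⟨![x 0, x 1, x 2, 0], fun h0 => hx ?_, ?_⟩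
    · ext i
      fin_cases i
      · exact congrFun h0 0
      · exact congrFun h0 1
      · exact congrFun h0 2
    · rw [Fin.sum_univ_three] at h
      simp only [Fin.sum_univ_four]
      simpa using h
  · intro h
    rw [iso4_bad] at h
    have hn : -(a 0 * a 2) ∈ nrm (-(a 0 * a 1)) := by
      apply O1
      intro w
      by_contra hw
      refine h w ⟨?_, hs_neg_iff.2 hw⟩
      have : ((a 0 * a 1 * a 2) ^ 2 : Kˣ) ∈ P w := sq_mem_P _ _
      rw [pow_two] at this
      exact this
    obtain ⟨y, z, hyz⟩ := mem_nrm.1 hn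
    push_cast at hyz
    refine ⟨![y / a 0, z, 1], fun h0 => ?_, ?_⟩
    · have := congrFun h0 2
      simp at this
    · rw [Fin.sum_univ_three]
      simp
      field_simp
      linear_combination -hyz

theorem aniso3 : Di (fun a : Fin 3 → K => (∀ i, a i ≠ 0) ∧ ¬ Iso a) := by
  have D := Di.comp (aniso4 (K := K)) (g := fun a : Fin 3 → K => ![a 0, a 1, a 2, a 0 * a 1 * a 2]) (fun j => by
    fin_cases j
    · exact Po.coord _
    · exact Po.coord _
    · exact Po.coord _
    · exact ((Po.coord _).mul (Po.coord _)).mul (Po.coord _))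
  have key : ∀ b : Fin 3 → Kˣ, (![(b 0 : K), b 1, b 2, b 0 * b 1 * b 2] : Fin 4 → K) = fun i => ((![b 0, b 1, b 2, b 0 * b 1 * b 2] : Fin 4 → Kˣ) i : K) := by
    intro b; ext i; fin_cases i <;> simp
  refine D.congr fun a => ?_
  constructor
  · rintro ⟨h0, h⟩
    obtain ⟨b, rfl⟩ : ∃ b : Fin 3 → Kˣ, a = fun i => (b i : K) := ⟨fun i => Units.mk0 _ (h0 i), rfl⟩
    rw [iso3_iff4, ← key] at h
    refine ⟨?_, h⟩
    intro i
    rw [key]; exact Units.ne_zero _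
  · rintro ⟨h0, h⟩
    have h0' : ∀ i, a i ≠ 0 := by
      intro i
      fin_cases i
      exacts [h0 0, h0 1, h0 2]
    obtain ⟨b, rfl⟩ : ∃ b : Fin 3 → Kˣ, a = fun i => (b i : K) := ⟨fun i => Units.mk0 _ (h0' i), rfl⟩
    refine ⟨h0', ?_⟩
    rw [iso3_iff4, ← key]
    exact h

theorem aniso2 : Di (fun a : Fin 2 → K => (∀ i, a i ≠ 0) ∧ ¬ Iso a) := by
  have D : Di (fun a : Fin 2 → K => ∃ e : Fin 1 → K, (∀ i, (![a 0, a 1, e 0] : Fin 3 → K) i ≠ 0) ∧ ¬ Iso (![a 0, a 1, e 0] : Fin 3 → K)) := by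
    apply Di.ex (p := fun a e => (∀ i, (![a 0, a 1, e 0] : Fin 3 → K) i ≠ 0) ∧ ¬ Iso (![a 0, a 1, e 0] : Fin 3 → K))
    refine Di.comp (aniso3 (K := K)) (g := fun z : Fin 2 ⊕ Fin 1 → K => ![z (.inl 0), z (.inl 1), z (.inr 0)]) (fun j => ?_)
    fin_cases j
    · exact Po.coord _
    · exact Po.coord _
    · exact Po.coord _
  refine D.congr fun a => ?_
  constructor
  · rintro ⟨h0, h⟩
    obtain ⟨b, rfl⟩ : ∃ b : Fin 2 → Kˣ, a = fun i => (b i : K) := ⟨fun i => Units.mk0 _ (h0 i), rfl⟩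
    have hns : ¬ IsSquare ((-(b 0 * b 1) : Kˣ) : K) := by
      rintro ⟨s, hs⟩
      push_cast at hs
      refine h ⟨![s, b 0], fun h => ?_, ?_⟩
      · exact (b 0).ne_zero (by simpa using congrFun h 1)
      · rw [Fin.sum_univ_two]
        simp
        linear_combination -(b 0 : K) * hs
    obtain ⟨v, -, hv⟩ := GS hns Set.finite_empty
    obtain ⟨f, hf⟩ : ∃ f, f ∉ Nw (.inl v) (-(b 0 * b 1)) := by
      by_contra! h
      exact hv (Nw_nondeg h)
    have he : -(b 0 * (-((b 0)⁻¹ * f))) = f := by simp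
    refine ⟨fun _ => (-((b 0)⁻¹ * f) : Kˣ), ?_, ?_⟩
    · intro i
      fin_cases i
      exacts [(b 0).ne_zero, (b 1).ne_zero, Units.ne_zero _]
    · rintro ⟨x, hx, hq⟩
      rw [Fin.sum_univ_three] at hq
      have := iso3_nrm (a := b 0) (b := b 1) (c := -((b 0)⁻¹ * f)) (x := x 0) (y := x 1) (z := x 2) (fun h => hx (by
        ext i
        fin_cases i
        exacts [h.1, h.2.1, h.2.2])) hq
      rw [he] at this
      exact hf (nrm_le_locN _ _ this)
  · rintro ⟨e, h0, h⟩
    refine ⟨?_, ?_⟩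
    · intro i
      fin_cases i
      exacts [h0 0, h0 1]
    · rintro ⟨x, hx, hq⟩
      refine h ⟨![x 0, x 1, 0], fun h => hx ?_, ?_⟩
      · ext i
        fin_cases i
        exacts [congrFun h 0, congrFun h 1]
      · rw [Fin.sum_univ_two] at hq
        rw [Fin.sum_univ_three]
        simpa using hq

theorem aniso1 : Di (fun a : Fin 1 → K => (∀ i, a i ≠ 0) ∧ ¬ Iso a) := by
  refine (Di.ne0 (Po.coord (0 : Fin 1))).congr fun a => ?_
  constructor
  · exact fun h => h.1 0
  · intro h
    refine ⟨fun i => by rwa [Subsingleton.elim i 0], ?_⟩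
    rintro ⟨x, hx, hq⟩
    apply hx
    rw [Fin.sum_univ_one] at hq
    ext i
    rw [Subsingleton.elim i 0]
    rcases mul_eq_zero.1 hq with h1 | h1
    · exact absurd h1 h
    · exact pow_eq_zero_iff (two_ne_zero) |>.1 h1

theorem aniso (m : ℕ) (hm : 1 ≤ m) : Di (fun a : Fin m → K => (∀ i, a i ≠ 0) ∧ ¬ Iso a) := by
  rcases Nat.lt_or_ge m 5 with h | h
  · interval_cases m
    exacts [aniso1, aniso2, aniso3, aniso4]
  · exact aniso5 h

end
end QF

/-- Over a number field `K`, the set of `m`-tuples of nonzero coefficients whose associated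
diagonal quadratic form is anisotropic is diophantine over `K`. -/
theorem anisotropic_diagonal_diophantine_numberField
    (K : Type*) [Field K] [NumberField K] (m : ℕ) (hm : 1 ≤ m) :
    IsDiophantine {a : Fin m → K |
      (∀ i, a i ≠ 0) ∧
      ∀ x : Fin m → K, (∑ i, a i * x i ^ 2) = 0 → x = 0} := by
  refine QF.Di.isDiophantine ((QF.aniso (K := K) m hm).congr fun a => ?_)
  rw [QF.not_iso_iff]
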